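/- Let n ≥ 1 and let f : ℝⁿ → ℝ be real analytic on a neighborhood U of 0 with f(0) = 0 and ∇f(0) = 0. Assume there exist g > 1/(n+1), an integer 0 ≤ k ≤ n−1, and r₀ > 0 such that for every 0 < r < r₀ there is c_r > 0 with m({x : |x| < r, |f(x)| < ε}) = c_r ε^g (log(1/ε))^k + o(ε^g (log(1/ε))^k) as ε → 0⁺. Then there is a neighborhood N ⊆ U of 0 such that for every smooth compactly supported φ : ℝⁿ → ℝ with support in N there is a constant C > 0 such that for all ξ = (ξ₁,…,ξ_{n+1}) ∈ ℝ^{n+1} with |ξ| > 2 one has |∫_{ℝⁿ} φ(x) e^{−i(ξ_{n+1} f(x) + ξ₁x₁ + ⋯ + ξₙxₙ)} dx| ≤ C |ξ|^{−1/(n+1)}. -/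

import Mathlib

open MeasureTheory Filter Topology Asymptotics Complex

namespace OscillatoryDecay

/-- `F` is, near the origin, a monomial times a nonvanishing analytic function. -/
def NormalCrossing {n : ℕ} (F : (Fin n → ℝ) → ℝ) : Prop :=
  ∃ (α : Fin n → ℕ) (u : (Fin n → ℝ) → ℝ), AnalyticAt ℝ u 0 ∧ u 0 ≠ 0 ∧
    F =ᶠ[𝓝 0] fun y => (∏ i, y i ^ α i) * u y

/-- The substitution `x_i = y_k (c + y_i)`. -/
def blowUp {n : ℕ} (i k : Fin n) (c : ℝ) (y : Fin n → ℝ) : Fin n → ℝ :=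
  Function.update y i (y k * (c + y i))

/-- The substitution `x_k = σ y_k ^ (2 p)`. -/
def powMap {n : ℕ} (k : Fin n) (p : ℕ) (σ : ℝ) (y : Fin n → ℝ) : Fin n → ℝ :=
  Function.update y k (σ * y k ^ (2 * p))

/-- `Resolution Q`: the origin can be covered by finitely many towers of analytic coordinate
changes, even power substitutions and codimension two blow-ups such that `Q π D` holds for each
composite map `π` and the monomial part `D` of its Jacobian. -/
inductive Resolution {n : ℕ} :
    (((Fin n → ℝ) → (Fin n → ℝ)) → ((Fin n → ℝ) → ℝ) → Prop) → Prop
  | leaf (Q : ((Fin n → ℝ) → (Fin n → ℝ)) → ((Fin n → ℝ) → ℝ) → Prop) :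
      Q id 1 → Resolution Q
  | diffeo (Q : ((Fin n → ℝ) → (Fin n → ℝ)) → ((Fin n → ℝ) → ℝ) → Prop)
      (h k : (Fin n → ℝ) → (Fin n → ℝ)) (hh : AnalyticAt ℝ h 0) (hk : AnalyticAt ℝ k 0)
      (h0 : h 0 = 0) (k0 : k 0 = 0)
      (hkh : ∀ᶠ x in 𝓝 0, k (h x) = x) (hhk : ∀ᶠ x in 𝓝 0, h (k x) = x) :
      Resolution (fun π D => Q (h ∘ π) D) → Resolution Q
  | pow (Q : ((Fin n → ℝ) → (Fin n → ℝ)) → ((Fin n → ℝ) → ℝ) → Prop) (k : Fin n) (p : ℕ)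
      (hp : 0 < p) :
      Resolution (fun π D => Q (powMap k p 1 ∘ π) (fun y => π y k ^ (2 * p - 1) * D y)) →
      Resolution (fun π D => Q (powMap k p (-1) ∘ π) (fun y => π y k ^ (2 * p - 1) * D y)) →
      Resolution Q
  | blow (Q : ((Fin n → ℝ) → (Fin n → ℝ)) → ((Fin n → ℝ) → ℝ) → Prop) (i k : Fin n)
      (hik : i ≠ k) :
      Resolution (fun π D => Q (blowUp k i 0 ∘ π) (fun y => π y i * D y)) →
      (∀ c : ℝ, Resolution (fun π D => Q (blowUp i k c ∘ π) (fun y => π y k * D y))) →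
      Resolution Q

section maps
variable {n : ℕ}

theorem analyticAt_coord (i : Fin n) (x : Fin n → ℝ) :
    AnalyticAt ℝ (fun y : Fin n → ℝ => y i) x :=
  (ContinuousLinearMap.proj (R := ℝ) (φ := fun _ : Fin n => ℝ) i).analyticAt x

theorem analyticAt_update {k : Fin n} {g : (Fin n → ℝ) → ℝ} {x : Fin n → ℝ}
    (hg : AnalyticAt ℝ g x) : AnalyticAt ℝ (fun y : Fin n → ℝ => Function.update y k (g y)) x := by
  rw [analyticAt_pi_iff]
  intro i
  by_cases h : i = k
  · subst h; simpa using hg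
  · simpa [Function.update_of_ne h] using analyticAt_coord i x

theorem analyticAt_blowUp (i k : Fin n) (c : ℝ) (x : Fin n → ℝ) :
    AnalyticAt ℝ (blowUp i k c) x :=
  analyticAt_update ((analyticAt_coord k x).mul (analyticAt_const.add (analyticAt_coord i x)))

theorem analyticAt_powMap (k : Fin n) (p : ℕ) (σ : ℝ) (x : Fin n → ℝ) :
    AnalyticAt ℝ (powMap k p σ) x :=
  analyticAt_update (analyticAt_const.mul ((analyticAt_coord k x).pow _))

@[simp] theorem blowUp_zero (i k : Fin n) (c : ℝ) : blowUp i k c 0 = 0 := by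
  simp [blowUp]

theorem powMap_zero (k : Fin n) {p : ℕ} (hp : 0 < p) (σ : ℝ) : powMap k p σ 0 = 0 := by
  have : 2 * p ≠ 0 := by omega
  simp [powMap, this]

theorem analyticAt_monomial (α : Fin n → ℕ) (x : Fin n → ℝ) :
    AnalyticAt ℝ (fun y : Fin n → ℝ => ∏ i, y i ^ α i) x :=
  Finset.univ.analyticAt_fun_prod fun i _ => (analyticAt_coord i x).pow _

theorem comp_congr {E F : Type*} [TopologicalSpace E] [Zero E] {f g : E → F} {π : E → E}
    (h : f =ᶠ[𝓝 0] g) (hc : ContinuousAt π 0) (h0 : π 0 = 0) :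
    f ∘ π =ᶠ[𝓝 0] g ∘ π := by
  have : Tendsto π (𝓝 0) (𝓝 0) := by simpa [ContinuousAt, h0] using hc
  exact h.comp_tendsto this

end maps

namespace Resolution
variable {n : ℕ} {Q Q' : ((Fin n → ℝ) → (Fin n → ℝ)) → ((Fin n → ℝ) → ℝ) → Prop}

theorem bind (h : Resolution Q) : ∀ {Q' : ((Fin n → ℝ) → (Fin n → ℝ)) → ((Fin n → ℝ) → ℝ) → Prop},
    (∀ π D, AnalyticAt ℝ π 0 → π 0 = 0 → Q π D →
      Resolution (fun π' D' => Q' (π ∘ π') (fun y => D (π' y) * D' y))) → Resolution Q' := by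
  induction h with
  | leaf Q hQ =>
    intro Q' H
    simpa using H id 1 analyticAt_id rfl hQ
  | diffeo Q h k hh hk h0 k0 hkh hhk _ ih =>
    intro Q' H
    refine Resolution.diffeo Q' h k hh hk h0 k0 hkh hhk (ih fun π D hπ hπ0 hQ => ?_)
    refine H _ _ (AnalyticAt.comp (by rwa [hπ0]) hπ) (by simp [hπ0, h0]) hQ
  | pow Q k p hp _ _ ih1 ih2 =>
    intro Q' H
    refine Resolution.pow Q' k p hp (ih1 fun π D hπ hπ0 hQ => ?_) (ih2 fun π D hπ hπ0 hQ => ?_)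
    · have := H _ _ ((analyticAt_powMap k p 1 (π 0)).comp hπ)
        (by simp [hπ0, powMap_zero k hp]) hQ
      simpa only [mul_assoc, Function.comp_assoc, Function.comp_apply] using this
    · have := H _ _ ((analyticAt_powMap k p (-1) (π 0)).comp hπ)
        (by simp [hπ0, powMap_zero k hp]) hQ
      simpa only [mul_assoc, Function.comp_assoc, Function.comp_apply] using this
  | blow Q i k hik _ _ ih1 ih2 =>
    intro Q' H
    refine Resolution.blow Q' i k hik (ih1 fun π D hπ hπ0 hQ => ?_)
      (fun c => ih2 c fun π D hπ hπ0 hQ => ?_)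
    · have := H _ _ ((analyticAt_blowUp k i 0 (π 0)).comp hπ) (by simp [hπ0]) hQ
      simpa only [mul_assoc, Function.comp_assoc, Function.comp_apply] using this
    · have := H _ _ ((analyticAt_blowUp i k c (π 0)).comp hπ) (by simp [hπ0]) hQ
      simpa only [mul_assoc, Function.comp_assoc, Function.comp_apply] using this

theorem mono (h : Resolution Q)
    (H : ∀ π D, AnalyticAt ℝ π 0 → π 0 = 0 → Q π D → Q' π D) : Resolution Q' :=
  h.bind fun π D hπ h0 hQ => Resolution.leaf _ (by simpa using H π D hπ h0 hQ)

end Resolution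

section normalCrossing
variable {n : ℕ} {F G : (Fin n → ℝ) → ℝ}

theorem NormalCrossing.congr (h : NormalCrossing F) (hFG : G =ᶠ[𝓝 0] F) : NormalCrossing G := by
  obtain ⟨α, u, hu, hu0, h⟩ := h
  exact ⟨α, u, hu, hu0, hFG.trans h⟩

theorem NormalCrossing.mul (hF : NormalCrossing F) (hG : NormalCrossing G) :
    NormalCrossing (fun y => F y * G y) := by
  obtain ⟨α, u, hu, hu0, hF⟩ := hF
  obtain ⟨β, v, hv, hv0, hG⟩ := hG
  refine ⟨α + β, fun y => u y * v y, hu.mul hv, mul_ne_zero hu0 hv0, ?_⟩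
  filter_upwards [hF, hG] with y h1 h2
  simp only [h1, h2, Pi.add_apply, pow_add, Finset.prod_mul_distrib]
  ring

theorem normalCrossing_of_ne_zero (hF : AnalyticAt ℝ F 0) (h0 : F 0 ≠ 0) : NormalCrossing F :=
  ⟨0, F, hF, h0, by simp⟩

theorem normalCrossing_coord (i : Fin n) : NormalCrossing (fun y : Fin n → ℝ => y i) := by
  classical
  refine ⟨Pi.single i 1, fun _ => 1, analyticAt_const, one_ne_zero, .of_forall fun y => ?_⟩
  have : ∀ j, y j ^ (Pi.single i 1 : Fin n → ℕ) j = if j = i then y i else 1 := by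
    intro j
    by_cases h : j = i
    · subst h; simp
    · simp [h]
  simp [this]

theorem NormalCrossing.pow (hF : NormalCrossing F) (k : ℕ) : NormalCrossing (fun y => F y ^ k) := by
  induction k with
  | zero =>
    simpa using normalCrossing_of_ne_zero (n := n) (F := fun _ => 1) analyticAt_const (by simp)
  | succ k ih => simpa only [pow_succ] using ih.mul hF

theorem NormalCrossing.analyticAt (hF : NormalCrossing F) : AnalyticAt ℝ F 0 := by
  obtain ⟨α, u, hu, -, h⟩ := hF
  exact ((analyticAt_monomial α 0).mul hu).congr h.symm

/-- Points with all coordinates nonzero accumulate at the origin. -/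
theorem frequently_coord_ne_zero : ∃ᶠ y : Fin n → ℝ in 𝓝 0, ∀ i, y i ≠ 0 := by
  have h : Tendsto (fun t : ℝ => (fun _ => t : Fin n → ℝ)) (𝓝[≠] 0) (𝓝 0) := by
    have : Continuous (fun t : ℝ => (fun _ => t : Fin n → ℝ)) := by fun_prop
    simpa using (this.tendsto' 0 0 rfl).mono_left nhdsWithin_le_nhds
  refine h.frequently (Eventually.frequently ?_)
  filter_upwards [self_mem_nhdsWithin] with t ht i using ht

theorem NormalCrossing.not_eventually_zero (hF : NormalCrossing F) : ¬ F =ᶠ[𝓝 0] 0 := by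
  obtain ⟨α, u, hu, hu0, h⟩ := hF
  intro h'
  have h1 : ∀ᶠ y in 𝓝 (0 : Fin n → ℝ), u y ≠ 0 := hu.continuousAt.eventually_ne hu0
  obtain ⟨y, hy, h2, h3, h4⟩ := (frequently_coord_ne_zero.and_eventually
    ((h.and (h'.and h1)))).exists
  rw [h3] at h2
  exact (mul_ne_zero (Finset.prod_ne_zero_iff.2 fun i _ => pow_ne_zero _ (hy i)) h4) h2.symm

theorem prod_blowUp (i k : Fin n) (α : Fin n → ℕ) (y : Fin n → ℝ) :
    ∏ l, blowUp i k 0 y l ^ α l = (∏ l, y l ^ α l) * y k ^ α i := by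
  classical
  have : ∀ l, blowUp i k 0 y l ^ α l = y l ^ α l * (if l = i then y k ^ α i else 1) := by
    intro l
    by_cases h : l = i
    · subst h; simp [blowUp, mul_pow, mul_comm]
    · simp [blowUp, h]
  simp only [this, Finset.prod_mul_distrib, Finset.prod_ite_eq', Finset.mem_univ, if_true]

theorem NormalCrossing.comp_blowUp (hF : NormalCrossing F) (i k : Fin n) :
    NormalCrossing (F ∘ blowUp i k 0) := by
  obtain ⟨α, u, hu, hu0, h⟩ := hF
  have hb := analyticAt_blowUp i k 0 (0 : Fin n → ℝ)
  have h1 : NormalCrossing fun y : Fin n → ℝ => (∏ l, y l ^ α l) * (u ∘ blowUp i k 0) y :=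
    ⟨α, _, AnalyticAt.comp (by simpa using hu) hb, by simpa using hu0, .rfl⟩
  refine (h1.mul ((normalCrossing_coord k).pow (α i))).congr ?_
  refine (comp_congr h hb.continuousAt (by simp)).trans (.of_forall fun y => ?_)
  simp only [Function.comp, prod_blowUp]
  ring

end normalCrossing

section division
variable {E : Type*} [NormedAddCommGroup E] [NormedSpace ℝ E]

/-- The divided difference of a homogeneous term along `e`. -/
noncomputable def divTerm (P : E →L[ℝ] E) (e : E) (k : ℕ)
    (p : ContinuousMultilinearMap ℝ (fun _ : Fin (k + 1) => E) ℝ) :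
    ContinuousMultilinearMap ℝ (fun _ : Fin k => E) ℝ :=
  ∑ j : Fin (k + 1), (p.curryMid j e).compContinuousLinearMap
    fun i => if i.castSucc < j then P else ContinuousLinearMap.id ℝ E

theorem norm_divTerm_le {P : E →L[ℝ] E} (hP : ‖P‖ ≤ 1) (e : E) (k : ℕ)
    (p : ContinuousMultilinearMap ℝ (fun _ : Fin (k + 1) => E) ℝ) :
    ‖divTerm P e k p‖ ≤ (k + 1) * (‖p‖ * ‖e‖) := by
  have key : ∀ j : Fin (k + 1), ‖(p.curryMid j e).compContinuousLinearMap
      fun i : Fin k => if i.castSucc < j then P else ContinuousLinearMap.id ℝ E‖ ≤ ‖p‖ * ‖e‖ := by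
    intro j
    refine (ContinuousMultilinearMap.norm_compContinuousLinearMap_le _ _).trans ?_
    have h1 : ∏ i : Fin k, ‖(if i.castSucc < j then P else ContinuousLinearMap.id ℝ E)‖ ≤ 1 := by
      refine Finset.prod_le_one (fun i _ => norm_nonneg _) fun i _ => ?_
      split_ifs
      · exact hP
      · exact ContinuousLinearMap.norm_id_le
    have h2 : ‖p.curryMid j e‖ ≤ ‖p‖ * ‖e‖ := by
      refine ((p.curryMid j).le_opNorm e).trans ?_
      gcongr
      exact MultilinearMap.mkContinuousLinear_norm_le _ (norm_nonneg p) _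
    calc _ ≤ ‖p.curryMid j e‖ * 1 := by gcongr
      _ ≤ _ := by simpa using h2
  refine (norm_sum_le _ _).trans ((Finset.sum_le_sum fun j _ => key j).trans ?_)
  simp

theorem mul_divTerm_apply {P : E →L[ℝ] E} {e : E} (l : E → ℝ) (h : ∀ x, x = P x + l x • e) (k : ℕ)
    (p : ContinuousMultilinearMap ℝ (fun _ : Fin (k + 1) => E) ℝ) (x : E) :
    l x * divTerm P e k p (fun _ => x) = p (fun _ => x) - p (fun _ => P x) := by
  let T : ℕ → ℝ := fun j => p fun i => if (i : ℕ) < j then P x else x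
  have h1 : ∀ j : Fin (k + 1), l x * ((p.curryMid j e).compContinuousLinearMap
      fun i : Fin k => if i.castSucc < j then P else ContinuousLinearMap.id ℝ E) (fun _ => x) =
      T j - T (j + 1) := by
    intro j
    let v : Fin (k + 1) → E := fun i => if (i : ℕ) < j then P x else x
    have e1 : (fun i : Fin (k + 1) => if (i : ℕ) < j then P x else x) =
        Function.update v j (P x + l x • e) := by
      rw [← h x]
      ext i
      by_cases hi : i = j
      · subst hi; simp
      · simp [hi, v]
    have e2 : (fun i : Fin (k + 1) => if (i : ℕ) < j + 1 then P x else x) =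
        Function.update v j (P x) := by
      ext i
      by_cases hi : i = j
      · subst hi; simp
      · have : (i : ℕ) ≠ j := fun h => hi (Fin.ext h)
        have : (i : ℕ) < j + 1 ↔ (i : ℕ) < j := by omega
        simp [hi, v, this]
    have e3 : (fun i : Fin k => (if i.castSucc < j then P else ContinuousLinearMap.id ℝ E) x) =
        fun i : Fin k => v (j.succAbove i) := by
      ext i
      by_cases hi : i.castSucc < j
      · simp [Fin.succAbove_of_castSucc_lt _ _ hi, v, hi]
      · have hi' : ¬ i.succ < j := fun h' => hi ((Fin.castSucc_lt_succ).trans h')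
        simp [Fin.succAbove_of_le_castSucc _ _ (not_lt.1 hi), v, hi, hi']
    have e4 : ∀ z : E, (j.insertNth z (fun i : Fin k => v (j.succAbove i)) : Fin (k + 1) → E)
        = Function.update v j z := by
      intro z
      exact Fin.insertNth_removeNth j z v
    simp only [T, e1, e2, ContinuousMultilinearMap.compContinuousLinearMap_apply,
      ContinuousMultilinearMap.curryMid_apply, e3, e4, ContinuousMultilinearMap.map_update_add,
      ContinuousMultilinearMap.map_update_smul, smul_eq_mul]
    ring
  have h2 : l x * divTerm P e k p (fun _ => x) = ∑ j : Fin (k + 1), (T j - T (j + 1)) := by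
    simp only [divTerm, sum_apply, Finset.mul_sum]
    exact Finset.sum_congr rfl fun j _ => h1 j
  rw [h2, Fin.sum_univ_eq_sum_range (fun j => T j - T (j + 1)), Finset.sum_range_sub']
  have e5 : (fun i : Fin (k + 1) => if (i : ℕ) < k + 1 then P x else x) = fun _ => P x :=
    funext fun i => if_pos i.2
  simp only [T, e5, Nat.not_lt_zero, if_false]

theorem exists_analytic_division {P : E →L[ℝ] E} (hP : ‖P‖ ≤ 1) {e : E} {l : E → ℝ}
    (h : ∀ x, x = P x + l x • e) {G : E → ℝ} (hG : AnalyticAt ℝ G 0) :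
    ∃ G₁ : E → ℝ, AnalyticAt ℝ G₁ 0 ∧ ∀ᶠ x in 𝓝 0, G x = G (P x) + l x * G₁ x := by
  obtain ⟨p, r, hp⟩ := hG
  let q : FormalMultilinearSeries ℝ E ℝ := fun k => divTerm P e k (p (k + 1))
  obtain ⟨C, a, hC, ha, hpa⟩ : ∃ C a : ℝ, 0 < C ∧ 0 < a ∧ ∀ k, ‖p k‖ ≤ C * a ^ k := by
    obtain ⟨C, a, hC, ha, hpa⟩ := p.le_mul_pow_of_radius_pos (hp.r_pos.trans_le hp.r_le)
    exact ⟨C, a, hC, ha, hpa⟩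
  have hq : ∀ k, ‖q k‖ ≤ (C * a * ‖e‖) * (2 * a) ^ k := by
    intro k
    refine (norm_divTerm_le hP e k _).trans ?_
    have h1 : ((k : ℝ) + 1) ≤ 2 ^ k := by exact_mod_cast Nat.lt_two_pow_self (n := k)
    calc ((k : ℝ) + 1) * (‖p (k + 1)‖ * ‖e‖) ≤ 2 ^ k * (C * a ^ (k + 1) * ‖e‖) := by
          gcongr; exact hpa _
      _ = _ := by rw [mul_pow]; ring
  have hrad : 0 < q.radius := by
    have : ENNReal.ofNNReal (Real.toNNReal (2 * a)⁻¹) ≤ q.radius := by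
      refine q.le_radius_of_bound (C * a * ‖e‖) fun k => ?_
      rw [Real.coe_toNNReal _ (by positivity)]
      calc ‖q k‖ * (2 * a)⁻¹ ^ k ≤ (C * a * ‖e‖) * (2 * a) ^ k * (2 * a)⁻¹ ^ k := by
            gcongr; exact hq k
        _ = C * a * ‖e‖ := by
            rw [mul_assoc, ← mul_pow, mul_inv_cancel₀ (by positivity)]; simp
    exact lt_of_lt_of_le (by simpa using ha) this
  have hqs := q.hasFPowerSeriesOnBall hrad
  refine ⟨q.sum, hqs.analyticAt, ?_⟩
  have hPc : Tendsto P (𝓝 0) (𝓝 0) := by simpa using P.continuous.tendsto 0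
  have hb := Metric.eball_mem_nhds (0 : E) hp.r_pos
  filter_upwards [hb, hPc hb, Metric.eball_mem_nhds (0 : E) hrad] with x hx hx1 hx2
  have s1 := (hasSum_nat_add_iff' 1).2 (hp.hasSum hx)
  have s2 := (hasSum_nat_add_iff' 1).2 (hp.hasSum hx1)
  have s3 := (hqs.hasSum hx2).mul_left (l x)
  have s4 := s1.sub s2
  have s5 : ∀ k, l x * q k (fun _ => x) = p (k + 1) (fun _ => x) - p (k + 1) (fun _ => P x) :=
    fun k => mul_divTerm_apply l h k (p (k + 1)) x
  simp only [s5] at s3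
  have := s3.unique s4
  have e0 : p 0 (fun _ => x) = p 0 (fun _ => P x) := by
    congr 1; ext i; exact i.elim0
  simp only [zero_add, Finset.range_one, Finset.sum_singleton, e0] at this
  linarith

end division

section expansion
variable {m : ℕ}

theorem analyticAt_tail (x : Fin (m + 1) → ℝ) :
    AnalyticAt ℝ (fun y : Fin (m + 1) → ℝ => Fin.tail y) x := by
  rw [analyticAt_pi_iff]
  exact fun i => analyticAt_coord i.succ x

@[simp] theorem tail_zero : Fin.tail (0 : Fin (m + 1) → ℝ) = 0 := rfl

@[simp] theorem cons_zero_zero : (Fin.cons 0 0 : Fin (m + 1) → ℝ) = 0 := by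
  ext i; refine Fin.cases ?_ (fun j => ?_) i <;> simp

theorem _root_.AnalyticAt.finCons {E : Type*} [NormedAddCommGroup E] [NormedSpace ℝ E]
    {g : E → ℝ} {h : E → (Fin m → ℝ)} {x : E} (hg : AnalyticAt ℝ g x) (hh : AnalyticAt ℝ h x) :
    AnalyticAt ℝ (fun y => (Fin.cons (g y) (h y) : Fin (m + 1) → ℝ)) x := by
  rw [analyticAt_pi_iff] at hh ⊢
  intro i
  refine Fin.cases ?_ (fun j => ?_) i
  · simpa using hg
  · simpa using hh j

theorem tendsto_tail : Tendsto (fun y : Fin (m + 1) → ℝ => Fin.tail y) (𝓝 0) (𝓝 0) := by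
  simpa using (analyticAt_tail (0 : Fin (m + 1) → ℝ)).continuousAt.tendsto

theorem analyticAt_axis : AnalyticAt ℝ (fun t : ℝ => (Fin.cons t 0 : Fin (m + 1) → ℝ)) 0 :=
  analyticAt_id.finCons analyticAt_const

theorem tendsto_axis : Tendsto (fun t : ℝ => (Fin.cons t 0 : Fin (m + 1) → ℝ)) (𝓝 0) (𝓝 0) := by
  simpa using (analyticAt_axis (m := m)).continuousAt.tendsto

theorem analyticAt_slice : AnalyticAt ℝ (fun y : Fin m → ℝ => (Fin.cons 0 y : Fin (m + 1) → ℝ)) 0 :=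
  analyticAt_const.finCons analyticAt_id

theorem tendsto_slice :
    Tendsto (fun y : Fin m → ℝ => (Fin.cons 0 y : Fin (m + 1) → ℝ)) (𝓝 0) (𝓝 0) := by
  simpa using (analyticAt_slice (m := m)).continuousAt.tendsto

theorem comp_tail_analyticAt {c : (Fin m → ℝ) → ℝ} (hc : AnalyticAt ℝ c 0) :
    AnalyticAt ℝ (fun y : Fin (m + 1) → ℝ => c (Fin.tail y)) 0 :=
  AnalyticAt.comp (g := c) (by simpa using hc) (analyticAt_tail 0)

theorem exists_division_first {G : (Fin (m + 1) → ℝ) → ℝ} (hG : AnalyticAt ℝ G 0) :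
    ∃ (c : (Fin m → ℝ) → ℝ) (G₁ : (Fin (m + 1) → ℝ) → ℝ), AnalyticAt ℝ c 0 ∧ AnalyticAt ℝ G₁ 0 ∧
      G =ᶠ[𝓝 0] fun x => c (Fin.tail x) + x 0 * G₁ x := by
  let P : (Fin (m + 1) → ℝ) →L[ℝ] (Fin (m + 1) → ℝ) :=
    ContinuousLinearMap.pi fun i => if i = 0 then 0 else ContinuousLinearMap.proj i
  have hPx : ∀ x, P x = Fin.cons 0 (Fin.tail x) := by
    intro x
    ext i
    refine Fin.cases ?_ (fun j => ?_) i
    · simp [P]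
    · simp [P, Fin.tail]
  have hP : ‖P‖ ≤ 1 := by
    refine ContinuousLinearMap.opNorm_le_bound _ zero_le_one fun x => ?_
    rw [one_mul, pi_norm_le_iff_of_nonneg (norm_nonneg x)]
    intro i
    by_cases hi : i = 0
    · simp [P, hi]
    · simpa [P, hi] using norm_le_pi_norm x i
  have hx : ∀ x : Fin (m + 1) → ℝ, x = P x + x 0 • (Fin.cons 1 0 : Fin (m + 1) → ℝ) := by
    intro x
    rw [hPx]
    ext i
    refine Fin.cases ?_ (fun j => ?_) i
    · simp
    · simp [Fin.tail]
  obtain ⟨G₁, hG₁, h⟩ := exists_analytic_division hP hx hG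
  refine ⟨fun y => G (Fin.cons 0 y), G₁, ?_, hG₁, ?_⟩
  · exact AnalyticAt.comp (g := G) (by simpa using hG) analyticAt_slice
  · filter_upwards [h] with x hx'
    rw [hx', hPx]

/-- `G` equals `∑ j < d, c j (x') x₀ ^ j + x₀ ^ d H` near the origin. -/
def Expansion (d : ℕ) (G : (Fin (m + 1) → ℝ) → ℝ) (c : ℕ → (Fin m → ℝ) → ℝ)
    (H : (Fin (m + 1) → ℝ) → ℝ) : Prop :=
  (∀ j, AnalyticAt ℝ (c j) 0) ∧ AnalyticAt ℝ H 0 ∧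
    G =ᶠ[𝓝 0] fun x => ∑ j ∈ Finset.range d, c j (Fin.tail x) * x 0 ^ j + x 0 ^ d * H x

/-- `G` is analytic and vanishes to order exactly `d` along the first coordinate axis. -/
def Regular (d : ℕ) (G : (Fin (m + 1) → ℝ) → ℝ) : Prop :=
  ∃ c H, Expansion d G c H ∧ H 0 ≠ 0 ∧ ∀ j < d, c j 0 = 0

theorem Expansion.analyticAt {d : ℕ} {G : (Fin (m + 1) → ℝ) → ℝ} {c : ℕ → (Fin m → ℝ) → ℝ}
    {H : (Fin (m + 1) → ℝ) → ℝ} (h : Expansion d G c H) : AnalyticAt ℝ G 0 := by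
  refine AnalyticAt.congr ?_ h.2.2.symm
  refine AnalyticAt.add ?_ (((analyticAt_coord 0 0).pow d).mul h.2.1)
  exact Finset.analyticAt_fun_sum _ fun j _ =>
    (comp_tail_analyticAt (h.1 j)).mul ((analyticAt_coord 0 0).pow j)

theorem Expansion.axis {d : ℕ} {G : (Fin (m + 1) → ℝ) → ℝ} {c : ℕ → (Fin m → ℝ) → ℝ}
    {H : (Fin (m + 1) → ℝ) → ℝ} (h : Expansion d G c H) :
    ∀ᶠ t in 𝓝 (0 : ℝ), G (Fin.cons t 0) =
      ∑ j ∈ Finset.range d, c j 0 * t ^ j + t ^ d * H (Fin.cons t 0) := by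
  filter_upwards [tendsto_axis.eventually h.2.2] with t ht
  simpa using ht

theorem continuousAt_axis {H : (Fin (m + 1) → ℝ) → ℝ} (hH : AnalyticAt ℝ H 0) :
    ContinuousAt (fun t : ℝ => H (Fin.cons t 0)) 0 :=
  ContinuousAt.comp (g := H) (by simpa using hH.continuousAt) analyticAt_axis.continuousAt

theorem regular_of_axis : ∀ (d : ℕ) {G : (Fin (m + 1) → ℝ) → ℝ} (_ : AnalyticAt ℝ G 0) {u : ℝ → ℝ}
    (_ : ContinuousAt u 0) (_ : u 0 ≠ 0)
    (_ : ∀ᶠ t in 𝓝[≠] (0 : ℝ), G (Fin.cons t 0) = t ^ d * u t), Regular d G := by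
  intro d
  induction d with
  | zero =>
    intro G hG u hu hu0 h
    refine ⟨0, G, ⟨fun _ => analyticAt_const, hG, by simp⟩, ?_, by simp⟩
    have h1 : Tendsto (fun t : ℝ => G (Fin.cons t 0)) (𝓝[≠] 0) (𝓝 (G 0)) := by
      simpa using (continuousAt_axis hG).tendsto.mono_left nhdsWithin_le_nhds
    have h2 : Tendsto u (𝓝[≠] 0) (𝓝 (u 0)) := hu.tendsto.mono_left nhdsWithin_le_nhds
    rw [tendsto_nhds_unique h1 (h2.congr' ?_)]
    · exact hu0
    · filter_upwards [h] with t ht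
      simp [ht]
  | succ d ih =>
    intro G hG u hu hu0 h
    obtain ⟨c₀, G₁, hc₀, hG₁, hd⟩ := exists_division_first hG
    have hd' : ∀ᶠ t in 𝓝 (0 : ℝ), G (Fin.cons t 0) = c₀ 0 + t * G₁ (Fin.cons t 0) := by
      filter_upwards [tendsto_axis.eventually hd] with t ht
      simpa using ht
    have h1 : Tendsto (fun t : ℝ => c₀ 0 + t * G₁ (Fin.cons t 0)) (𝓝[≠] 0) (𝓝 (c₀ 0)) := by
      have : ContinuousAt (fun t : ℝ => c₀ 0 + t * G₁ (Fin.cons t 0)) 0 :=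
        continuousAt_const.add (continuousAt_id.mul (continuousAt_axis hG₁))
      simpa using this.tendsto.mono_left nhdsWithin_le_nhds
    have h2 : Tendsto (fun t : ℝ => t ^ (d + 1) * u t) (𝓝[≠] 0) (𝓝 0) := by
      have : ContinuousAt (fun t : ℝ => t ^ (d + 1) * u t) 0 := (continuousAt_id.pow _).mul hu
      simpa using this.tendsto.mono_left nhdsWithin_le_nhds
    have hc0 : c₀ 0 = 0 := by
      refine tendsto_nhds_unique h1 (h2.congr' ?_)
      filter_upwards [h, hd'.filter_mono nhdsWithin_le_nhds] with t ht ht'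
      rw [← ht, ht']
    obtain ⟨c, H, ⟨hc, hH, hexp⟩, hH0, hcz⟩ := ih hG₁ hu hu0 (by
      filter_upwards [h, hd'.filter_mono nhdsWithin_le_nhds, self_mem_nhdsWithin] with t ht ht' h0
      have h0 : t ≠ 0 := h0
      rw [ht', hc0, zero_add, pow_succ] at ht
      apply mul_left_cancel₀ h0
      rw [ht]; ring)
    refine ⟨fun j => Nat.casesOn j c₀ c, H, ⟨fun j => ?_, hH, ?_⟩, hH0, fun j hj => ?_⟩
    · cases j with
      | zero => exact hc₀
      | succ j => exact hc j
    · filter_upwards [hd, hexp] with x h1 h2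
      rw [h1, h2, Finset.sum_range_succ', mul_add, Finset.mul_sum]
      have : ∀ j, x 0 * (c j (Fin.tail x) * x 0 ^ j) = c j (Fin.tail x) * x 0 ^ (j + 1) := by
        intro j; ring
      simp only [this]
      change _ = (∑ j ∈ Finset.range d, c j (Fin.tail x) * x 0 ^ (j + 1) +
        c₀ (Fin.tail x) * x 0 ^ 0) + x 0 ^ (d + 1) * H x
      ring
    · cases j with
      | zero => exact hc0
      | succ j => exact hcz j (by omega)

theorem regular_of_coeff_ne_zero {G : (Fin (m + 1) → ℝ) → ℝ} (hG : AnalyticAt ℝ G 0)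
    {q : Polynomial ℝ} {d : ℕ} {h : ℝ → ℝ} (hh : ContinuousAt h 0)
    (hax : ∀ᶠ t in 𝓝 (0 : ℝ), G (Fin.cons t 0) = q.eval t + t ^ d * h t)
    {j : ℕ} (hj : j < d) (hq : q.coeff j ≠ 0) : ∃ d' ≤ j, Regular d' G := by
  classical
  have hex : ∃ j, q.coeff j ≠ 0 := ⟨j, hq⟩
  set j₀ := Nat.find hex with hj₀
  have hle : j₀ ≤ j := Nat.find_min' hex hq
  obtain ⟨q', hq'⟩ : Polynomial.X ^ j₀ ∣ q :=
    Polynomial.X_pow_dvd_iff.2 fun i hi => not_not.1 (Nat.find_min hex hi)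
  have hspec : q.coeff j₀ ≠ 0 := Nat.find_spec hex
  have h0 : q'.eval 0 ≠ 0 := by
    rw [hq', Polynomial.coeff_X_pow_mul', if_pos le_rfl, Nat.sub_self,
      Polynomial.coeff_zero_eq_eval_zero] at hspec
    exact hspec
  refine ⟨j₀, hle, regular_of_axis j₀ hG (u := fun t => q'.eval t + t ^ (d - j₀) * h t) ?_ ?_ ?_⟩
  · exact q'.continuous.continuousAt.add ((continuousAt_id.pow _).mul hh)
  · have : d - j₀ ≠ 0 := by omega
    simpa [this] using h0
  · filter_upwards [hax.filter_mono nhdsWithin_le_nhds] with t ht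
    have : t ^ d = t ^ j₀ * t ^ (d - j₀) := by rw [← pow_add]; congr 1; omega
    rw [ht, hq', this, Polynomial.eval_mul, Polynomial.eval_pow, Polynomial.eval_X]
    ring

theorem exists_regular {G : (Fin (m + 1) → ℝ) → ℝ} (hG : AnalyticAt ℝ G 0)
    (h : ¬ ∀ᶠ t in 𝓝 (0 : ℝ), G (Fin.cons t 0) = 0) : ∃ d, Regular d G := by
  have ha : AnalyticAt ℝ (fun t : ℝ => G (Fin.cons t 0)) 0 :=
    AnalyticAt.comp (g := G) (by simpa using hG) analyticAt_axis
  obtain ⟨d, u, hu, hu0, hd⟩ := (ha.exists_eventuallyEq_pow_smul_nonzero_iff).2 h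
  refine ⟨d, regular_of_axis d hG hu.continuousAt hu0 ?_⟩
  filter_upwards [hd.filter_mono nhdsWithin_le_nhds] with t ht
  simpa using ht

theorem Regular.analyticAt {d : ℕ} {G : (Fin (m + 1) → ℝ) → ℝ} (h : Regular d G) :
    AnalyticAt ℝ G 0 := by
  obtain ⟨c, H, h, -⟩ := h
  exact h.analyticAt

/-- The derivative with respect to the first coordinate. -/
noncomputable def deriv₀ (G : (Fin (m + 1) → ℝ) → ℝ) (x : Fin (m + 1) → ℝ) : ℝ :=
  fderiv ℝ G x (Fin.cons 1 0)

theorem analyticAt_deriv₀ {G : (Fin (m + 1) → ℝ) → ℝ} {x : Fin (m + 1) → ℝ}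
    (hG : AnalyticAt ℝ G x) : AnalyticAt ℝ (deriv₀ G) x :=
  ((ContinuousLinearMap.apply ℝ ℝ (Fin.cons 1 0 : Fin (m + 1) → ℝ)).analyticAt _).comp hG.fderiv

theorem deriv₀_congr {G G' : (Fin (m + 1) → ℝ) → ℝ} (h : G =ᶠ[𝓝 0] G') :
    deriv₀ G =ᶠ[𝓝 0] deriv₀ G' := by
  filter_upwards [h.fderiv (𝕜 := ℝ)] with x hx
  rw [deriv₀, deriv₀, hx]

theorem deriv₀_eq_deriv (G : (Fin (m + 1) → ℝ) → ℝ) {x : Fin (m + 1) → ℝ}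
    (hG : DifferentiableAt ℝ G x) :
    HasDerivAt (fun t => G (Fin.cons t (Fin.tail x))) (deriv₀ G x) (x 0) := by
  have h1 : HasDerivAt (fun t : ℝ => (Fin.cons t (Fin.tail x) : Fin (m + 1) → ℝ))
      (Fin.cons 1 0) (x 0) := by
    rw [hasDerivAt_pi]
    intro i
    refine Fin.cases ?_ (fun j => ?_) i
    · simpa using hasDerivAt_id' (x 0)
    · simpa using hasDerivAt_const (x 0) (Fin.tail x j)
  have hx : (Fin.cons (x 0) (Fin.tail x) : Fin (m + 1) → ℝ) = x := Fin.cons_self_tail x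
  have h2 : HasFDerivAt G (fderiv ℝ G x) (Fin.cons (x 0) (Fin.tail x)) := by
    rw [hx]; exact hG.hasFDerivAt
  exact h2.comp_hasDerivAt (x 0) h1

theorem Expansion.deriv₀ {d : ℕ} {G : (Fin (m + 1) → ℝ) → ℝ} {c : ℕ → (Fin m → ℝ) → ℝ}
    {H : (Fin (m + 1) → ℝ) → ℝ} (h : Expansion (d + 1) G c H) :
    Expansion d (deriv₀ G) (fun j y => (j + 1) * c (j + 1) y)
      (fun x => (d + 1) * H x + x 0 * OscillatoryDecay.deriv₀ H x) := by
  refine ⟨fun j => analyticAt_const.mul (h.1 _), ?_, ?_⟩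
  · exact (analyticAt_const.mul h.2.1).add ((analyticAt_coord 0 0).mul (analyticAt_deriv₀ h.2.1))
  refine (deriv₀_congr h.2.2).trans ?_
  have hT : AnalyticAt ℝ (fun x : Fin (m + 1) → ℝ => ∑ j ∈ Finset.range (d + 1),
      c j (Fin.tail x) * x 0 ^ j + x 0 ^ (d + 1) * H x) 0 := h.analyticAt.congr h.2.2
  filter_upwards [hT.eventually_analyticAt, h.2.1.eventually_analyticAt] with x hx hHx
  have d1 := deriv₀_eq_deriv _ hx.differentiableAt
  have d2 := deriv₀_eq_deriv _ hHx.differentiableAt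
  simp only [Fin.tail_cons, Fin.cons_zero] at d1 d2
  refine d1.unique ?_
  have d3 : HasDerivAt (fun t => ∑ j ∈ Finset.range (d + 1), c j (Fin.tail x) * t ^ j)
      (∑ j ∈ Finset.range (d + 1), c j (Fin.tail x) * (j * x 0 ^ (j - 1))) (x 0) :=
    HasDerivAt.fun_sum fun j _ => (hasDerivAt_pow j (x 0)).const_mul _
  have d4 := d3.add ((hasDerivAt_pow (d + 1) (x 0)).mul d2)
  refine HasDerivAt.congr_deriv (f := fun t => ∑ j ∈ Finset.range (d + 1),
    c j (Fin.tail x) * t ^ j + t ^ (d + 1) * H (Fin.cons t (Fin.tail x))) d4 ?_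
  rw [Finset.sum_range_succ']
  have hx' : (Fin.cons (x 0) (Fin.tail x) : Fin (m + 1) → ℝ) = x := Fin.cons_self_tail x
  simp only [Nat.cast_zero, zero_mul, mul_zero, add_zero, Nat.add_sub_cancel, hx']
  congr 1
  · refine Finset.sum_congr rfl fun j _ => ?_
    push_cast; ring
  · push_cast; ring

/-- Iterated first-coordinate derivatives isolate the top coefficient of an expansion. -/
theorem Expansion.iterate_deriv₀ : ∀ (d : ℕ) {G : (Fin (m + 1) → ℝ) → ℝ} {c : ℕ → (Fin m → ℝ) → ℝ}
    {H : (Fin (m + 1) → ℝ) → ℝ} (_ : Expansion (d + 1) G c H),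
    ∃ a b : ℝ, a ≠ 0 ∧ b ≠ 0 ∧ ∃ H', H' 0 = b * H 0 ∧
      Expansion 1 (OscillatoryDecay.deriv₀^[d] G) (fun _ y => a * c d y) H' := by
  intro d
  induction d with
  | zero =>
    intro G c H h
    refine ⟨1, 1, one_ne_zero, one_ne_zero, H, by simp, fun _ => by simpa using h.1 0, h.2.1, ?_⟩
    simpa using h.2.2
  | succ d ih =>
    intro G c H h
    obtain ⟨a, b, ha, hb, H', hH', he⟩ := ih h.deriv₀
    refine ⟨a * (d + 1), b * (d + 2), mul_ne_zero ha (by positivity),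
      mul_ne_zero hb (by positivity), H', ?_, ?_⟩
    · rw [hH']; push_cast; simp; ring
    · simpa only [Function.iterate_succ, Function.comp, mul_assoc] using he

end expansion

section shift
variable {m : ℕ}

theorem exists_implicit_function {K : (Fin (m + 1) → ℝ) → ℝ} (hK : AnalyticAt ℝ K 0) (hK0 : K 0 = 0)
    (hd : deriv₀ K 0 ≠ 0) :
    ∃ θ : (Fin m → ℝ) → ℝ, AnalyticAt ℝ θ 0 ∧ θ 0 = 0 ∧ ∀ᶠ y in 𝓝 0, K (Fin.cons (θ y) y) = 0 := by
  let f : (Fin m → ℝ) × ℝ → ℝ := fun z => K (Fin.cons z.2 z.1)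
  have hc : AnalyticAt ℝ (fun z : (Fin m → ℝ) × ℝ => (Fin.cons z.2 z.1 : Fin (m + 1) → ℝ)) (0, 0) :=
    analyticAt_snd.finCons analyticAt_fst
  have hf : AnalyticAt ℝ f (0, 0) := AnalyticAt.comp (g := K) (by simpa using hK) hc
  have cdf : ContDiffAt ℝ ⊤ f (0, 0) := hf.contDiffAt
  have if₂ : (fderiv ℝ f ((0 : Fin m → ℝ), (0 : ℝ)) ∘L .inr ℝ (Fin m → ℝ) ℝ).IsInvertible := by
    refine ⟨ContinuousLinearEquiv.unitsEquivAut ℝ (Units.mk0 _ hd), ?_⟩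
    ext
    have h1 := deriv₀_eq_deriv K hK.differentiableAt
    have h2 : HasDerivAt (fun t : ℝ => ((0 : Fin m → ℝ), t)) (0, 1) 0 :=
      (hasDerivAt_const _ _).prodMk (hasDerivAt_id 0)
    have h3 := (hf.differentiableAt.hasFDerivAt).comp_hasDerivAt (0 : ℝ) h2
    have := h1.unique h3
    simpa using this
  have hn : (⊤ : WithTop ℕ∞) ≠ 0 := by simp
  refine ⟨cdf.implicitFunction hn if₂, ?_, cdf.implicitFunction_apply_self hn if₂, ?_⟩
  · exact (cdf.contDiffAt_implicitFunction hn if₂).analyticAt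
  · filter_upwards [cdf.eventually_apply_implicitFunction hn if₂] with y hy
    simpa [f, hK0] using hy

/-- The shear `x₀ ↦ x₀ + θ (x')`. -/
def shear (θ : (Fin m → ℝ) → ℝ) (x : Fin (m + 1) → ℝ) : Fin (m + 1) → ℝ :=
  Fin.cons (x 0 + θ (Fin.tail x)) (Fin.tail x)

variable {θ : (Fin m → ℝ) → ℝ}

theorem analyticAt_shear (hθ : AnalyticAt ℝ θ 0) : AnalyticAt ℝ (shear θ) 0 :=
  ((analyticAt_coord 0 0).add (comp_tail_analyticAt hθ)).finCons (analyticAt_tail 0)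

theorem shear_zero (h0 : θ 0 = 0) : shear θ 0 = 0 := by simp [shear, h0]

theorem tendsto_shear (hθ : AnalyticAt ℝ θ 0) (h0 : θ 0 = 0) : Tendsto (shear θ) (𝓝 0) (𝓝 0) := by
  simpa [ContinuousAt, shear_zero h0] using (analyticAt_shear hθ).continuousAt

theorem Resolution.shear {Q : ((Fin (m + 1) → ℝ) → (Fin (m + 1) → ℝ)) →
    ((Fin (m + 1) → ℝ) → ℝ) → Prop} (hθ : AnalyticAt ℝ θ 0) (h0 : θ 0 = 0)
    (h : Resolution (fun π D => Q (shear θ ∘ π) D)) : Resolution Q := by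
  refine Resolution.diffeo Q (OscillatoryDecay.shear θ) (OscillatoryDecay.shear fun y => -θ y)
    (analyticAt_shear hθ) (analyticAt_shear hθ.neg) (shear_zero h0)
    (shear_zero (by simp [h0])) (.of_forall fun x => ?_) (.of_forall fun x => ?_) h <;>
  · simp only [OscillatoryDecay.shear, Fin.cons_zero, Fin.tail_cons, add_neg_cancel_right,
      neg_add_cancel_right]
    exact Fin.cons_self_tail x

theorem deriv₀_comp_shear {G : (Fin (m + 1) → ℝ) → ℝ} (hG : AnalyticAt ℝ G 0)
    (hθ : AnalyticAt ℝ θ 0) (h0 : θ 0 = 0) :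
    deriv₀ (G ∘ shear θ) =ᶠ[𝓝 0] deriv₀ G ∘ shear θ := by
  have h1 : AnalyticAt ℝ (G ∘ shear θ) 0 :=
    AnalyticAt.comp (by rwa [shear_zero h0]) (analyticAt_shear hθ)
  filter_upwards [h1.eventually_analyticAt,
    (tendsto_shear hθ h0).eventually hG.eventually_analyticAt] with x hx hx'
  have d1 := deriv₀_eq_deriv _ hx.differentiableAt
  have d2 := deriv₀_eq_deriv _ hx'.differentiableAt
  refine d1.unique ?_
  have d3 := HasDerivAt.comp_add_const (x 0) (θ (Fin.tail x)) d2
  simpa [shear, Function.comp_def] using d3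

theorem iterate_deriv₀_congr (d : ℕ) : ∀ {G G' : (Fin (m + 1) → ℝ) → ℝ} (_ : G =ᶠ[𝓝 0] G'),
    deriv₀^[d] G =ᶠ[𝓝 0] deriv₀^[d] G' := by
  induction d with
  | zero => intro G G' h; simpa using h
  | succ d ih => intro G G' h; exact ih (deriv₀_congr h)

theorem iterate_deriv₀_comp_shear (hθ : AnalyticAt ℝ θ 0) (h0 : θ 0 = 0) (d : ℕ) :
    ∀ {G : (Fin (m + 1) → ℝ) → ℝ} (_ : AnalyticAt ℝ G 0),
    deriv₀^[d] (G ∘ shear θ) =ᶠ[𝓝 0] deriv₀^[d] G ∘ shear θ := by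
  induction d with
  | zero => intro G _; rfl
  | succ d ih =>
    intro G hG
    exact (iterate_deriv₀_congr d (deriv₀_comp_shear hG hθ h0)).trans (ih (analyticAt_deriv₀ hG))

theorem Regular.axis {d : ℕ} {G : (Fin (m + 1) → ℝ) → ℝ} (hG : Regular d G) :
    ∃ u : ℝ → ℝ, ContinuousAt u 0 ∧ u 0 ≠ 0 ∧
      ∀ᶠ t in 𝓝 (0 : ℝ), G (Fin.cons t 0) = t ^ d * u t := by
  obtain ⟨c, H, h, hH, hc⟩ := hG
  refine ⟨fun t => H (Fin.cons t 0), continuousAt_axis h.2.1, by simpa using hH, ?_⟩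
  filter_upwards [h.axis] with t ht
  rw [ht, Finset.sum_eq_zero fun j hj => by rw [hc j (Finset.mem_range.1 hj), zero_mul], zero_add]

theorem Regular.comp_shear {d : ℕ} {G : (Fin (m + 1) → ℝ) → ℝ} (hG : Regular d G)
    (hθ : AnalyticAt ℝ θ 0) (h0 : θ 0 = 0) : Regular d (G ∘ shear θ) := by
  have ha : AnalyticAt ℝ (G ∘ shear θ) 0 :=
    AnalyticAt.comp (by rw [shear_zero h0]; exact hG.analyticAt) (analyticAt_shear hθ)
  obtain ⟨u, hu, hu0, h⟩ := hG.axis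
  refine regular_of_axis d ha hu hu0 ?_
  filter_upwards [h.filter_mono nhdsWithin_le_nhds] with t ht
  simpa [shear, h0] using ht

/-- A shear removes the subleading coefficient. -/
theorem Regular.exists_shear {d : ℕ} {G : (Fin (m + 1) → ℝ) → ℝ} (hG : Regular (d + 1) G) :
    ∃ θ : (Fin m → ℝ) → ℝ, AnalyticAt ℝ θ 0 ∧ θ 0 = 0 ∧ ∃ c H, Expansion (d + 1) (G ∘ shear θ) c H ∧
      H 0 ≠ 0 ∧ (∀ j < d + 1, c j 0 = 0) ∧ c d =ᶠ[𝓝 0] 0 := by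
  obtain ⟨c, H, he, hH, hc⟩ := id hG
  obtain ⟨a, b, ha, hb, K', hK', hK⟩ := he.iterate_deriv₀
  have hK0 : deriv₀^[d] G 0 = 0 := by
    rw [hK.2.2.self_of_nhds]
    simp [hc d (by omega)]
  have hdK : deriv₀ (deriv₀^[d] G) 0 ≠ 0 := by
    have h1 : Expansion 0 (deriv₀ (deriv₀^[d] G)) _ _ := hK.deriv₀
    rw [h1.2.2.self_of_nhds]
    simpa [hK'] using ⟨hb, hH⟩
  obtain ⟨θ, hθ, h0, hKθ⟩ := exists_implicit_function hK.analyticAt hK0 hdK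
  refine ⟨θ, hθ, h0, ?_⟩
  obtain ⟨c', H', he', hH', hc'⟩ := hG.comp_shear hθ h0
  refine ⟨c', H', he', hH', hc', ?_⟩
  obtain ⟨a', b', ha', hb', K'', -, hKK⟩ := he'.iterate_deriv₀
  have h2 := hKK.2.2.symm.trans (iterate_deriv₀_comp_shear hθ h0 d hG.analyticAt)
  filter_upwards [tendsto_slice.eventually h2, hKθ] with y hy hy'
  simp only [Finset.range_one, Finset.sum_singleton, pow_zero, mul_one, Fin.cons_zero, pow_one,
    zero_mul, add_zero, Fin.tail_cons, Function.comp, shear, zero_add, hy'] at hy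
  simpa [ha'] using hy

end shift

section compare
variable {n : ℕ}

theorem tendsto_monomial_curve {F u : (Fin n → ℝ) → ℝ} {α : Fin n → ℕ} (hu : AnalyticAt ℝ u 0)
    (hF : F =ᶠ[𝓝 0] fun y => (∏ i, y i ^ α i) * u y) {N : Fin n → ℕ} (hN : ∀ i, 0 < N i) :
    Tendsto (fun t : ℝ => F (fun i => t ^ N i) / t ^ (∑ i, N i * α i)) (𝓝[≠] 0) (𝓝 (u 0)) := by
  have hc : Tendsto (fun t : ℝ => (fun i => t ^ N i : Fin n → ℝ)) (𝓝[≠] 0) (𝓝 0) := by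
    have : Continuous (fun t : ℝ => (fun i => t ^ N i : Fin n → ℝ)) := by fun_prop
    refine (this.tendsto' 0 0 ?_).mono_left nhdsWithin_le_nhds
    ext i
    simp [(hN i).ne']
  refine (hu.continuousAt.tendsto.comp hc).congr' ?_
  filter_upwards [hc.eventually hF, self_mem_nhdsWithin] with t ht h0
  have h0 : t ≠ 0 := h0
  have : ∏ i, (t ^ N i) ^ α i = t ^ (∑ i, N i * α i) := by
    simp only [← pow_mul, Finset.prod_pow_eq_pow_sum]
  rw [ht, this, Function.comp_apply]
  field_simp

theorem eq_of_tendsto_div_pow {g : ℝ → ℝ} {a b : ℕ} {x y : ℝ} (hx : x ≠ 0) (hy : y ≠ 0)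
    (ha : Tendsto (fun t => g t / t ^ a) (𝓝[≠] 0) (𝓝 x))
    (hb : Tendsto (fun t => g t / t ^ b) (𝓝[≠] 0) (𝓝 y)) : a = b := by
  have key : ∀ {a b : ℕ} {x y : ℝ}, x ≠ 0 → Tendsto (fun t => g t / t ^ a) (𝓝[≠] 0) (𝓝 x) →
      Tendsto (fun t => g t / t ^ b) (𝓝[≠] 0) (𝓝 y) → ¬ a < b := by
    intro a b x y hx ha hb hab
    have h1 : Tendsto (fun t : ℝ => t ^ (b - a)) (𝓝[≠] 0) (𝓝 0) := by
      have : Continuous fun t : ℝ => t ^ (b - a) := by fun_prop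
      exact (this.tendsto' 0 0 (by simp; omega)).mono_left nhdsWithin_le_nhds
    have h2 := h1.mul hb
    rw [zero_mul] at h2
    refine hx (tendsto_nhds_unique ha (h2.congr' ?_))
    filter_upwards [self_mem_nhdsWithin] with t h0
    have h0 : t ≠ 0 := h0
    have : t ^ b = t ^ (b - a) * t ^ a := by rw [← pow_add]; congr 1; omega
    rw [this]
    field_simp
  exact le_antisymm (not_lt.1 (key hy hb ha)) (not_lt.1 (key hx ha hb))

theorem exponents_of_sub {A B u w : (Fin n → ℝ) → ℝ} {α β γ : Fin n → ℕ}
    {z : (Fin n → ℝ) → ℝ} (hu : AnalyticAt ℝ u 0) (hu0 : u 0 ≠ 0) (hw : AnalyticAt ℝ w 0)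
    (hA : A =ᶠ[𝓝 0] fun y => (∏ i, y i ^ α i) * u y)
    (hB : B =ᶠ[𝓝 0] fun y => (∏ i, y i ^ β i) * w y) (hz : AnalyticAt ℝ z 0) (hz0 : z 0 ≠ 0)
    (hC : (fun y => A y - B y) =ᶠ[𝓝 0] fun y => (∏ i, y i ^ γ i) * z y)
    {N : Fin n → ℕ} (hN : ∀ i, 0 < N i) (hlt : ∑ i, N i * α i < ∑ i, N i * β i) :
    ∑ i, N i * γ i = ∑ i, N i * α i := by
  refine eq_of_tendsto_div_pow hz0 hu0 (tendsto_monomial_curve hz hC hN) ?_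
  have h1 := tendsto_monomial_curve hu hA hN
  have h2 := tendsto_monomial_curve hw hB hN
  set a := ∑ i, N i * α i
  set b := ∑ i, N i * β i
  have h3 : Tendsto (fun t : ℝ => t ^ (b - a)) (𝓝[≠] 0) (𝓝 0) := by
    have : Continuous fun t : ℝ => t ^ (b - a) := by fun_prop
    exact (this.tendsto' 0 0 (by simp; omega)).mono_left nhdsWithin_le_nhds
  have h4 := h1.sub (h3.mul h2)
  rw [zero_mul, sub_zero] at h4
  refine h4.congr' ?_
  filter_upwards [self_mem_nhdsWithin] with t h0
  have h0 : t ≠ 0 := h0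
  have : t ^ b = t ^ (b - a) * t ^ a := by rw [← pow_add]; congr 1; omega
  rw [this]
  field_simp

/-- If two normal crossings have a normal crossing difference, their exponents are comparable. -/
theorem exponents_comparable {A B u w : (Fin n → ℝ) → ℝ} {α β : Fin n → ℕ}
    (hu : AnalyticAt ℝ u 0) (hu0 : u 0 ≠ 0) (hw : AnalyticAt ℝ w 0) (hw0 : w 0 ≠ 0)
    (hA : A =ᶠ[𝓝 0] fun y => (∏ i, y i ^ α i) * u y)
    (hB : B =ᶠ[𝓝 0] fun y => (∏ i, y i ^ β i) * w y)
    (hAB : NormalCrossing (fun y => A y - B y)) : α ≤ β ∨ β ≤ α := by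
  classical
  by_contra hcon
  simp only [not_or, Pi.le_def, not_forall, not_le] at hcon
  obtain ⟨⟨l, hl⟩, ⟨k, hk⟩⟩ := hcon
  obtain ⟨γ, z, hz, hz0, hC⟩ := hAB
  have hC' : (fun y => B y - A y) =ᶠ[𝓝 0] fun y => (∏ i, y i ^ γ i) * (-z y) := by
    filter_upwards [hC] with y hy
    linarith
  have P1 := fun {N : Fin n → ℕ} (hN : ∀ i, 0 < N i) =>
    exponents_of_sub hu hu0 hw hA hB hz hz0 hC hN
  have P2 := fun {N : Fin n → ℕ} (hN : ∀ i, 0 < N i) =>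
    exponents_of_sub hw hw0 hu hB hA hz.neg (by simpa using hz0) hC' hN
  have hsum : ∀ (a b : ℕ) (δ : Fin n → ℕ),
      ∑ i, (1 + (if i = k then a else 0) + (if i = l then b else 0)) * δ i =
        ∑ i, δ i + a * δ k + b * δ l := by
    intro a b δ
    simp [add_mul, Finset.sum_add_distrib, ite_mul]
  have hN : ∀ (a b : ℕ) (i : Fin n),
      0 < 1 + (if i = k then a else 0) + (if i = l then b else 0) := fun a b i => by omega
  have Q1 := fun a b => P1 (hN a b)
  have Q2 := fun a b => P2 (hN a b)
  simp only [hsum] at Q1 Q2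
  generalize ∑ i, α i = sa at *
  generalize ∑ i, β i = sb at *
  generalize ∑ i, γ i = sc at *
  have e1 : ∀ s, sa < s → sc + s * γ k = sa + s * α k := by
    intro s hs
    have := Q1 s 0 (by nlinarith)
    simpa using this
  have e2 : ∀ s, sb < s → sc + s * γ l = sb + s * β l := by
    intro s hs
    have := Q2 0 s (by nlinarith)
    simpa using this
  have e3 := e1 (sa + 1) (by omega)
  have e4 := e1 (sa + 2) (by omega)
  have e5 := e2 (sb + 1) (by omega)
  have e6 := e2 (sb + 2) (by omega)
  have g1 : γ k = α k := by nlinarith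
  have g2 : γ l = β l := by nlinarith
  rw [g1] at e3
  rw [g2] at e5
  have s1 : sc = sa := by omega
  have s2 : sc = sb := by omega
  subst s1
  subst s2
  have := Q1 (2 * (α l - β l)) (β k - α k) (by
    obtain ⟨p, hp⟩ := Nat.exists_eq_add_of_lt hl
    obtain ⟨q, hq⟩ := Nat.exists_eq_add_of_lt hk
    rw [hp, hq]
    have r1 : β l + p + 1 - β l = p + 1 := by omega
    have r2 : α k + q + 1 - α k = q + 1 := by omega
    rw [r1, r2]
    nlinarith)
  rw [g1, g2] at this
  have h3 : (β k - α k) * β l = (β k - α k) * α l := by omega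
  have := Nat.eq_of_mul_eq_mul_left (by omega) h3
  omega

end compare

section powers
variable {m : ℕ}

theorem NormalCrossing.prod_coord (α : Fin m → ℕ) :
    NormalCrossing (fun y : Fin m → ℝ => ∏ i, y i ^ α i) :=
  ⟨α, fun _ => 1, analyticAt_const, one_ne_zero, by simp⟩

/-- Simultaneous even power substitutions in all coordinates. -/
theorem Resolution.powers {p : ℕ} (hp : 0 < p) :
    Resolution (fun (π : (Fin m → ℝ) → (Fin m → ℝ)) D =>
      (∃ σ : Fin m → ℝ, (∀ l, σ l ≠ 0) ∧ π = fun y l => σ l * y l ^ (2 * p)) ∧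
        NormalCrossing D) := by
  classical
  have key : ∀ s : Finset (Fin m), Resolution (fun (π : (Fin m → ℝ) → (Fin m → ℝ)) D =>
      (∃ σ : Fin m → ℝ, (∀ l, σ l ≠ 0) ∧
        π = fun y l => if l ∈ s then σ l * y l ^ (2 * p) else y l) ∧ NormalCrossing D) := by
    intro s
    induction s using Finset.induction_on with
    | empty =>
      refine Resolution.leaf _ ⟨⟨fun _ => 1, fun _ => one_ne_zero, by ext; simp⟩, ?_⟩
      exact normalCrossing_of_ne_zero analyticAt_const (by simp)
    | insert k s hk ih =>
      have hstep : ∀ σ : ℝ, σ ≠ 0 → Resolution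
          (fun (π : (Fin m → ℝ) → (Fin m → ℝ)) D =>
            (∃ τ : Fin m → ℝ, (∀ l, τ l ≠ 0) ∧
              powMap k p σ ∘ π = fun y l => if l ∈ insert k s then τ l * y l ^ (2 * p) else y l) ∧
              NormalCrossing (fun y => π y k ^ (2 * p - 1) * D y)) := by
        intro σ hσ
        refine ih.mono ?_
        rintro π D - - ⟨⟨τ, hτ, rfl⟩, hD⟩
        refine ⟨⟨Function.update τ k σ, fun l => ?_, ?_⟩, ?_⟩
        · by_cases h : l = k
          · subst h; simpa using hσ
          · simpa [h] using hτ l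
        · ext y l
          by_cases h : l = k
          · subst h; simp [powMap, hk]
          · simp [powMap, h]
        · simpa [hk] using ((normalCrossing_coord k).pow (2 * p - 1)).mul hD
      exact Resolution.pow _ k p hp (hstep 1 one_ne_zero) (hstep (-1) (by simp))
  simpa using key Finset.univ

end powers

section lift
variable {m : ℕ}

/-- The action of `π` on the last `m` coordinates. -/
def liftMap (π : (Fin m → ℝ) → (Fin m → ℝ)) (x : Fin (m + 1) → ℝ) : Fin (m + 1) → ℝ :=
  Fin.cons (x 0) (π (Fin.tail x))

@[simp] theorem tail_liftMap (π : (Fin m → ℝ) → (Fin m → ℝ)) (x : Fin (m + 1) → ℝ) :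
    Fin.tail (liftMap π x) = π (Fin.tail x) := rfl

@[simp] theorem liftMap_apply_zero (π : (Fin m → ℝ) → (Fin m → ℝ)) (x : Fin (m + 1) → ℝ) :
    liftMap π x 0 = x 0 := rfl

theorem liftMap_id : liftMap (id : (Fin m → ℝ) → (Fin m → ℝ)) = id :=
  funext fun x => Fin.cons_self_tail x

theorem liftMap_update (k : Fin m) (g : (Fin m → ℝ) → ℝ) :
    liftMap (fun y => Function.update y k (g y)) =
      fun x => Function.update x k.succ (g (Fin.tail x)) := by
  ext x i
  refine Fin.cases ?_ (fun j => ?_) i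
  · simp [liftMap, Function.update_of_ne (Fin.succ_ne_zero k).symm]
  · by_cases h : j = k
    · subst h; simp [liftMap]
    · have h' : j.succ ≠ k.succ := by simpa using h
      simp [liftMap, Function.update_of_ne h, Function.update_of_ne h', Fin.tail]

theorem analyticAt_liftMap {π : (Fin m → ℝ) → (Fin m → ℝ)} (h : AnalyticAt ℝ π 0) :
    AnalyticAt ℝ (liftMap π) 0 :=
  (analyticAt_coord 0 0).finCons (AnalyticAt.comp (g := π) (by simpa using h) (analyticAt_tail 0))

theorem liftMap_zero {π : (Fin m → ℝ) → (Fin m → ℝ)} (h : π 0 = 0) : liftMap π 0 = 0 := by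
  simp [liftMap, h]

theorem Resolution.lift {Q : ((Fin m → ℝ) → (Fin m → ℝ)) → ((Fin m → ℝ) → ℝ) → Prop}
    (h : Resolution Q) : ∀ {Q' : ((Fin (m + 1) → ℝ) → (Fin (m + 1) → ℝ)) →
      ((Fin (m + 1) → ℝ) → ℝ) → Prop},
    (∀ π D, Q π D → Q' (liftMap π) (fun y => D (Fin.tail y))) → Resolution Q' := by
  induction h with
  | leaf Q hQ =>
    intro Q' H
    refine Resolution.leaf _ ?_
    have := H _ _ hQ
    rw [liftMap_id] at this
    exact this
  | diffeo Q h k hh hk h0 k0 hkh hhk _ ih =>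
    intro Q' H
    refine Resolution.diffeo Q' (liftMap h) (liftMap k) (analyticAt_liftMap hh)
      (analyticAt_liftMap hk) (liftMap_zero h0) (liftMap_zero k0) ?_ ?_
      (ih fun π D hQ => H _ _ hQ)
    · filter_upwards [tendsto_tail.eventually hkh] with x hx
      simp only [liftMap, Fin.tail_cons, Fin.cons_zero, hx]
      exact Fin.cons_self_tail x
    · filter_upwards [tendsto_tail.eventually hhk] with x hx
      simp only [liftMap, Fin.tail_cons, Fin.cons_zero, hx]
      exact Fin.cons_self_tail x
  | pow Q k p hp _ _ ih1 ih2 =>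
    intro Q' H
    have e : ∀ σ, powMap k.succ p σ = liftMap (powMap k p σ) := fun σ =>
      (liftMap_update k fun y => σ * y k ^ (2 * p)).symm
    refine Resolution.pow Q' k.succ p hp (ih1 fun π D hQ => ?_) (ih2 fun π D hQ => ?_)
    · rw [e]; exact H _ _ hQ
    · rw [e]; exact H _ _ hQ
  | blow Q i k hik _ _ ih1 ih2 =>
    intro Q' H
    have e : ∀ (i k : Fin m) c, blowUp i.succ k.succ c = liftMap (blowUp i k c) := fun i k c =>
      (liftMap_update i fun y => y k * (c + y i)).symm
    refine Resolution.blow Q' i.succ k.succ (by simpa using hik) (ih1 fun π D hQ => ?_)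
      (fun c => ih2 c fun π D hQ => ?_)
    · rw [e]; exact H _ _ hQ
    · rw [e]; exact H _ _ hQ

theorem NormalCrossing.comp_tail {F : (Fin m → ℝ) → ℝ} (h : NormalCrossing F) :
    NormalCrossing (fun y : Fin (m + 1) → ℝ => F (Fin.tail y)) := by
  obtain ⟨α, u, hu, hu0, hF⟩ := h
  refine ⟨Fin.cons 0 α, fun y => u (Fin.tail y), comp_tail_analyticAt hu, by simpa using hu0, ?_⟩
  filter_upwards [tendsto_tail.eventually hF] with y hy
  rw [hy, Fin.prod_univ_succ]
  simp [Fin.tail]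

end lift

/-- Local monomialization of finitely many nonzero analytic germs in `n` variables. -/
def Monomialization (n : ℕ) : Prop :=
  ∀ (ι : Type) [Finite ι] (F : ι → (Fin n → ℝ) → ℝ), (∀ i, AnalyticAt ℝ (F i) 0) →
    (∀ i, ¬ F i =ᶠ[𝓝 0] 0) →
    Resolution (fun π D => (∀ i, NormalCrossing (F i ∘ π)) ∧ NormalCrossing D)

section weighted
variable {m : ℕ}

theorem analyticAt_powers (σ : Fin m → ℝ) (p : ℕ) (x : Fin m → ℝ) :
    AnalyticAt ℝ (fun (y : Fin m → ℝ) l => σ l * y l ^ (2 * p)) x := by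
  rw [analyticAt_pi_iff]
  exact fun l => analyticAt_const.mul ((analyticAt_coord l x).pow _)

theorem comp_powers {F u : (Fin m → ℝ) → ℝ} {α : Fin m → ℕ} {σ : Fin m → ℝ} {p : ℕ} (hp : 0 < p)
    (hσ : ∀ l, σ l ≠ 0) (hu : AnalyticAt ℝ u 0) (hu0 : u 0 ≠ 0)
    (hF : F =ᶠ[𝓝 0] fun y => (∏ i, y i ^ α i) * u y) :
    ∃ u' : (Fin m → ℝ) → ℝ, AnalyticAt ℝ u' 0 ∧ u' 0 ≠ 0 ∧
      F ∘ (fun y l => σ l * y l ^ (2 * p)) =ᶠ[𝓝 0] fun y => (∏ i, y i ^ (2 * p * α i)) * u' y := by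
  have h0 : (fun l => σ l * (0 : Fin m → ℝ) l ^ (2 * p)) = 0 := by
    ext l; simp; omega
  have ha := analyticAt_powers σ p 0
  refine ⟨fun y => (∏ i, σ i ^ α i) * u (fun l => σ l * y l ^ (2 * p)),
    analyticAt_const.mul (AnalyticAt.comp (g := u) (by rwa [h0]) ha), ?_, ?_⟩
  · beta_reduce
    rw [h0]
    exact mul_ne_zero (Finset.prod_ne_zero_iff.2 fun i _ => pow_ne_zero _ (hσ i)) hu0
  · refine (comp_congr hF ha.continuousAt h0).trans (.of_forall fun y => ?_)
    simp only [Function.comp, mul_pow, Finset.prod_mul_distrib, ← pow_mul]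
    ring

theorem NormalCrossing.comp_powers {F : (Fin m → ℝ) → ℝ} (h : NormalCrossing F) {σ : Fin m → ℝ}
    {p : ℕ} (hp : 0 < p) (hσ : ∀ l, σ l ≠ 0) :
    NormalCrossing (fun y => F (fun l => σ l * y l ^ (2 * p))) := by
  obtain ⟨α, u, hu, hu0, hF⟩ := h
  obtain ⟨u', hu', hu0', hF'⟩ := OscillatoryDecay.comp_powers hp hσ hu hu0 hF
  exact ⟨_, u', hu', hu0', hF'⟩

/-- Simultaneous weighted division: after a resolution, `c κ` is divisible by the `r κ`-th power of
a common monomial, with equality for one index. -/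
theorem Monomialization.weighted (hM : Monomialization m) {ι κ : Type} [Finite ι] [Fintype κ]
    (e : ι → (Fin m → ℝ) → ℝ) (he : ∀ i, NormalCrossing (e i))
    (c : κ → (Fin m → ℝ) → ℝ) (hc : ∀ j, AnalyticAt ℝ (c j) 0) (r : κ → ℕ) (hr : ∀ j, 0 < r j) :
    Resolution (fun π D => NormalCrossing D ∧ (∀ i, NormalCrossing (e i ∘ π)) ∧
      ((∀ j, c j ∘ π =ᶠ[𝓝 0] 0) ∨ ∃ (v : Fin m → ℕ) (w : κ → (Fin m → ℝ) → ℝ),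
        (∀ j, AnalyticAt ℝ (w j) 0) ∧ (∃ j, w j 0 ≠ 0) ∧
        ∀ j, c j ∘ π =ᶠ[𝓝 0] fun y => (∏ i, y i ^ v i) ^ r j * w j y)) := by
  classical
  set p : ℕ := ∏ j, r j with hp
  have hp0 : 0 < p := Finset.prod_pos fun j _ => hr j
  have hdvd : ∀ j, r j * (p / r j) = p := fun j =>
    Nat.mul_div_cancel' (Finset.dvd_prod_of_mem r (Finset.mem_univ j))
  have hq0 : ∀ j, 0 < p / r j := fun j => Nat.pos_of_ne_zero fun h => by
    have := hdvd j; rw [h] at this; omega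
  let γ : κ → (Fin m → ℝ) → ℝ := fun j y => c j y ^ (p / r j)
  let J := {j // ¬ c j =ᶠ[𝓝 0] 0}
  let K := {j : κ × κ // ¬ (fun y => γ j.1 y - γ j.2 y) =ᶠ[𝓝 0] 0}
  let F : ι ⊕ (J ⊕ K) → (Fin m → ℝ) → ℝ :=
    Sum.elim e (Sum.elim (fun j => c j) (fun j y => γ j.1.1 y - γ j.1.2 y))
  have hγ : ∀ j, AnalyticAt ℝ (γ j) 0 := fun j => (hc j).pow _
  have h1 := hM _ F (by
    rintro (i | j | j)
    · exact (he i).analyticAt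
    · exact hc j
    · exact (hγ _).sub (hγ _)) (by
    rintro (i | j | j)
    · exact (he i).not_eventually_zero
    · exact j.2
    · exact j.2)
  refine h1.bind ?_
  rintro π D hπ hπ0 ⟨hF, hD⟩
  refine (Resolution.powers hp0).mono ?_
  rintro _ D' - - ⟨⟨σ, hσ, rfl⟩, hD'⟩
  set τ : (Fin m → ℝ) → (Fin m → ℝ) := fun y l => σ l * y l ^ (2 * p) with hτ
  have hτ0 : τ 0 = 0 := by
    ext l; simp [τ]; omega
  have hτc : ContinuousAt τ 0 := (analyticAt_powers σ p 0).continuousAt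
  have hπτc : ContinuousAt (π ∘ τ) 0 :=
    ContinuousAt.comp (by rw [hτ0]; exact hπ.continuousAt) hτc
  have hπτ0 : (π ∘ τ) 0 = 0 := by simp [hτ0, hπ0]
  have hD2 : NormalCrossing fun y => D (τ y) := hD.comp_powers hp0 hσ
  refine ⟨hD2.mul hD', fun i => (hF (Sum.inl i)).comp_powers hp0 hσ, ?_⟩
  by_cases hz : ∀ j, c j =ᶠ[𝓝 0] 0
  · left
    exact fun j => comp_congr (hz j) hπτc hπτ0
  right
  push Not at hz
  obtain ⟨j₀, hj₀⟩ := hz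
  have hJ : ∀ j : J, ∃ (α : Fin m → ℕ) (u : (Fin m → ℝ) → ℝ), AnalyticAt ℝ u 0 ∧ u 0 ≠ 0 ∧
    c j ∘ π =ᶠ[𝓝 0] fun y => (∏ i, y i ^ α i) * u y := fun j => hF (Sum.inr (Sum.inl j))
  choose α u hu hu0 hcu using hJ
  have hγu : ∀ j : J, γ j ∘ π =ᶠ[𝓝 0]
      fun y => (∏ i, y i ^ (p / r j * α j i)) * (u j y) ^ (p / r j) := by
    intro j
    filter_upwards [hcu j] with y hy
    have : c j (π y) = (∏ i, y i ^ α j i) * u j y := hy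
    simp only [γ, Function.comp, this, mul_pow, ← Finset.prod_pow, ← pow_mul]
    congr 1
    exact Finset.prod_congr rfl fun i _ => by rw [mul_comm]
  let a : J → Fin m → ℕ := fun j i => p / r j * α j i
  have hcomp : ∀ j j' : J, a j ≤ a j' ∨ a j' ≤ a j := by
    intro j j'
    by_cases hjj : (fun y => γ j y - γ j' y) =ᶠ[𝓝 0] 0
    · by_contra hcon
      have hA := hγu j
      have hB := hγu j'
      have : γ j ∘ π =ᶠ[𝓝 0] γ j' ∘ π := by
        have : γ j =ᶠ[𝓝 0] γ j' := by
          filter_upwards [hjj] with y hy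
          exact sub_eq_zero.1 hy
        exact comp_congr this hπ.continuousAt hπ0
      have hAB := this.symm.trans hA
      obtain ⟨i, hi⟩ : ∃ i, a j i ≠ a j' i := by
        by_contra h
        push Not at h
        exact hcon (Or.inl (funext h).le)
      have hN1 : ∀ s : ℕ, ∑ l, (1 + if l = i then s else 0) * a j' l =
          ∑ l, (1 + if l = i then s else 0) * a j l := by
        intro s
        exact eq_of_tendsto_div_pow (pow_ne_zero _ (hu0 j')) (pow_ne_zero _ (hu0 j))
          (tendsto_monomial_curve (N := fun l => 1 + if l = i then s else 0)
            ((hu j').pow _) hB fun l => by omega)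
          (tendsto_monomial_curve ((hu j).pow _) hAB fun l => by omega)
      have g0 := hN1 0
      have g1 := hN1 1
      simp only [add_mul, Finset.sum_add_distrib, ite_mul, one_mul, zero_mul,
        Finset.sum_ite_eq', Finset.mem_univ, if_true, ite_self, Finset.sum_const_zero] at g0 g1
      omega
    · have : NormalCrossing (fun y => (γ j ∘ π) y - (γ j' ∘ π) y) :=
        hF (Sum.inr (Sum.inr ⟨(j, j'), hjj⟩))
      exact exponents_comparable ((hu j).pow _) (pow_ne_zero _ (hu0 j)) ((hu j').pow _)
        (pow_ne_zero _ (hu0 j')) (hγu j) (hγu j') this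
  have : Nonempty J := ⟨⟨j₀, hj₀⟩⟩
  obtain ⟨J₀, hJ₀⟩ := Finite.exists_min (fun j : J => ∑ i, a j i)
  have hmin : ∀ j, a J₀ ≤ a j := by
    intro j
    rcases hcomp J₀ j with h | h
    · exact h
    · have h2 : ∀ i ∈ Finset.univ, a j i = a J₀ i :=
        (Finset.sum_eq_sum_iff_of_le fun i _ => h i).1
          (le_antisymm (Finset.sum_le_sum fun i _ => h i) (hJ₀ j))
      exact fun i => (h2 i (Finset.mem_univ i)).ge
  have hu' : ∀ j : J, ∃ u' : (Fin m → ℝ) → ℝ, AnalyticAt ℝ u' 0 ∧ u' 0 ≠ 0 ∧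
      (c j ∘ π) ∘ τ =ᶠ[𝓝 0] fun y => (∏ i, y i ^ (2 * p * α j i)) * u' y := fun j =>
    OscillatoryDecay.comp_powers hp0 hσ (hu j) (hu0 j) (hcu j)
  choose u' hu'a hu'0 hcu' using hu'
  have hexp : ∀ (j : J) i, 2 * p * α j i =
      2 * a J₀ i * r j + (2 * p * α j i - 2 * a J₀ i * r j) := by
    intro j i
    have h1 := hmin j i
    have : 2 * a J₀ i * r j ≤ 2 * p * α j i := by
      calc 2 * a J₀ i * r j ≤ 2 * (p / r j * α j i) * r j := by gcongr
        _ = 2 * (r j * (p / r j)) * α j i := by ring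
        _ = _ := by rw [hdvd]
    omega
  refine ⟨fun i => 2 * a J₀ i, fun j => if h : c j =ᶠ[𝓝 0] 0 then 0 else
    fun y => (∏ i, y i ^ (2 * p * α ⟨j, h⟩ i - 2 * a J₀ i * r j)) * u' ⟨j, h⟩ y, ?_,
    ⟨J₀, ?_⟩, ?_⟩
  · intro j
    by_cases h : c j =ᶠ[𝓝 0] 0
    · simp only [h, dif_pos]; exact analyticAt_const
    · simp only [h, dif_neg, not_false_eq_true]
      exact (analyticAt_monomial _ 0).mul (hu'a _)
  · simp only [J₀.2, dif_neg, not_false_eq_true]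
    refine mul_ne_zero ?_ (hu'0 _)
    rw [Finset.prod_eq_one]
    · exact one_ne_zero
    · intro i _
      have : 2 * p * α J₀ i - 2 * a J₀ i * r J₀ = 0 := by
        have : 2 * a J₀ i * r J₀ = 2 * (r J₀ * (p / r J₀)) * α J₀ i := by
          simp only [a]; ring
        rw [this, hdvd, Nat.sub_self]
      simp [this]
  · intro j
    by_cases h : c j =ᶠ[𝓝 0] 0
    · simp only [h, dif_pos]
      refine (comp_congr h hπτc hπτ0).trans (.of_forall fun y => by simp)
    · simp only [h, dif_neg, not_false_eq_true]
      filter_upwards [hcu' ⟨j, h⟩] with y hy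
      have hy' : (c j ∘ π ∘ τ) y = (∏ i, y i ^ (2 * p * α ⟨j, h⟩ i)) * u' ⟨j, h⟩ y := hy
      rw [hy', ← mul_assoc, ← Finset.prod_pow, ← Finset.prod_mul_distrib]
      congr 1
      refine Finset.prod_congr rfl fun i _ => ?_
      rw [← pow_mul, ← pow_add, ← hexp ⟨j, h⟩ i]

end weighted

section monomialization
variable {m : ℕ}

theorem eventually_zero_or_of_mul {n : ℕ} {A B : (Fin n → ℝ) → ℝ} (hA : AnalyticAt ℝ A 0)
    (hB : AnalyticAt ℝ B 0) (h : (fun y => A y * B y) =ᶠ[𝓝 0] 0) :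
    A =ᶠ[𝓝 0] 0 ∨ B =ᶠ[𝓝 0] 0 := by
  obtain ⟨r, hr, H⟩ := Metric.eventually_nhds_iff_ball.1
    (hA.eventually_analyticAt.and (hB.eventually_analyticAt.and h))
  by_cases hx : ∃ x ∈ Metric.ball (0 : Fin n → ℝ) r, A x ≠ 0
  · obtain ⟨x, hx, hAx⟩ := hx
    right
    have h1 : B =ᶠ[𝓝 x] 0 := by
      filter_upwards [(H x hx).1.continuousAt.eventually_ne hAx, Metric.isOpen_ball.mem_nhds hx]
        with y hy hyb
      exact (mul_eq_zero.1 (H y hyb).2.2).resolve_left hy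
    have := AnalyticOnNhd.eqOn_zero_of_preconnected_of_eventuallyEq_zero
      (fun y hy => (H y hy).2.1) (convex_ball (0 : Fin n → ℝ) r).isPreconnected hx h1
    exact this.eventuallyEq_of_mem (Metric.ball_mem_nhds _ hr)
  · push Not at hx
    left
    filter_upwards [Metric.ball_mem_nhds _ hr] with y hy using hx y hy

/-- An axis along which none of finitely many nonzero germs vanishes identically. -/
theorem exists_direction {ι : Type} [Finite ι] (F : ι → (Fin (m + 1) → ℝ) → ℝ)
    (hF : ∀ i, AnalyticAt ℝ (F i) 0) (h0 : ∀ i, ¬ F i =ᶠ[𝓝 0] 0) :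
    ∃ v : Fin (m + 1) → ℝ, v 0 = 1 ∧ ∀ i, ¬ ∀ᶠ t in 𝓝 (0 : ℝ), F i (t • v) = 0 := by
  classical
  have := Fintype.ofFinite ι
  have hprod : ∀ s : Finset ι, AnalyticAt ℝ (fun x => ∏ i ∈ s, F i x) 0 ∧
      ¬ (fun x => ∏ i ∈ s, F i x) =ᶠ[𝓝 0] 0 := by
    intro s
    induction s using Finset.induction_on with
    | empty =>
      simp only [Finset.prod_empty]
      exact ⟨analyticAt_const, fun h => one_ne_zero h.self_of_nhds⟩
    | insert a s ha ih =>
      simp only [Finset.prod_insert ha]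
      exact ⟨(hF a).mul ih.1, fun h => (eventually_zero_or_of_mul (hF a) ih.1 h).elim (h0 a) ih.2⟩
  obtain ⟨hPa, hP⟩ := hprod Finset.univ
  have hQ : ¬ (fun x : Fin (m + 1) → ℝ => x 0 * ∏ i, F i x) =ᶠ[𝓝 0] 0 := fun h =>
    (eventually_zero_or_of_mul (analyticAt_coord 0 0) hPa h).elim
      (normalCrossing_coord 0).not_eventually_zero hP
  obtain ⟨r, hr, H⟩ := Metric.eventually_nhds_iff_ball.1
    (eventually_all.2 fun i => (hF i).eventually_analyticAt)
  have hfreq : ∃ᶠ x : Fin (m + 1) → ℝ in 𝓝 0, x 0 * ∏ i, F i x ≠ 0 :=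
    fun h => hQ (h.mono fun x hx => not_ne_iff.1 hx)
  obtain ⟨x, hx, hxr⟩ := (hfreq.and_eventually (Metric.ball_mem_nhds _ hr)).exists
  have hx0 : x 0 ≠ 0 := left_ne_zero_of_mul hx
  have hxF : ∀ i, F i x ≠ 0 := fun i =>
    Finset.prod_ne_zero_iff.1 (right_ne_zero_of_mul hx) i (Finset.mem_univ i)
  refine ⟨(x 0)⁻¹ • x, by simp [hx0], fun i hi => hxF i ?_⟩
  set U : Set ℝ := (fun t : ℝ => t • ((x 0)⁻¹ • x)) ⁻¹' Metric.ball 0 r with hU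
  have hUc : Convex ℝ U := by
    have := (convex_ball (0 : Fin (m + 1) → ℝ) r).linear_preimage
      (LinearMap.toSpanSingleton ℝ (Fin (m + 1) → ℝ) ((x 0)⁻¹ • x))
    exact this
  have hlin : ∀ t : ℝ, AnalyticAt ℝ (fun t : ℝ => t • ((x 0)⁻¹ • x)) t := fun t =>
    analyticAt_id.smul analyticAt_const
  have hx1 : (x 0) • ((x 0)⁻¹ • x) = x := by rw [smul_smul, mul_inv_cancel₀ hx0, one_smul]
  have := AnalyticOnNhd.eqOn_zero_of_preconnected_of_eventuallyEq_zero
    (f := fun t : ℝ => F i (t • ((x 0)⁻¹ • x))) (U := U) (z₀ := 0)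
    (fun t ht => AnalyticAt.comp (g := F i) (H _ ht i) (hlin t)) hUc.isPreconnected
    (by simp [hU, hr]) hi
  have h2 := this (x := x 0) (by rw [hU, Set.mem_preimage, hx1]; exact hxr)
  simpa only [hx1, Pi.zero_apply] using h2

theorem Resolution.linear {n : ℕ} {Q : ((Fin n → ℝ) → (Fin n → ℝ)) → ((Fin n → ℝ) → ℝ) → Prop}
    (L : (Fin n → ℝ) ≃L[ℝ] (Fin n → ℝ)) (h : Resolution (fun π D => Q (L ∘ π) D)) :
    Resolution Q :=
  Resolution.diffeo Q L L.symm ((L : (Fin n → ℝ) →L[ℝ] (Fin n → ℝ)).analyticAt 0)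
    ((L.symm : (Fin n → ℝ) →L[ℝ] (Fin n → ℝ)).analyticAt 0) (map_zero L) (map_zero L.symm)
    (.of_forall fun x => L.symm_apply_apply x) (.of_forall fun x => L.apply_symm_apply x) h

/-- A normal crossing in the last variables times a function regular in the first one. -/
def Reduced (d : ℕ) (F : (Fin (m + 1) → ℝ) → ℝ) : Prop :=
  ∃ e G, NormalCrossing e ∧ Regular d G ∧ F =ᶠ[𝓝 0] fun x => e (Fin.tail x) * G x

theorem Reduced.normalCrossing {F : (Fin (m + 1) → ℝ) → ℝ} (h : Reduced 0 F) :
    NormalCrossing F := by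
  obtain ⟨e, G, he, ⟨c, H, hG, hH, -⟩, hF⟩ := h
  refine (he.comp_tail.mul (normalCrossing_of_ne_zero hG.analyticAt ?_)).congr hF
  rw [hG.2.2.self_of_nhds]
  simpa using hH

/-- A normal crossing in the last variables times a weighted homogeneous expansion. -/
def Weighted (v : Fin m → ℕ) (d : ℕ) (w : ℕ → (Fin m → ℝ) → ℝ) (F : (Fin (m + 1) → ℝ) → ℝ) : Prop :=
  ∃ e H, NormalCrossing e ∧ AnalyticAt ℝ H 0 ∧ H 0 ≠ 0 ∧ (∀ j, AnalyticAt ℝ (w j) 0) ∧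
    F =ᶠ[𝓝 0] fun x => e (Fin.tail x) *
      (∑ j ∈ Finset.range d, (∏ i, Fin.tail x i ^ v i) ^ (d - j) * w j (Fin.tail x) * x 0 ^ j +
        x 0 ^ d * H x)

variable {v : Fin m → ℕ} {d : ℕ} {w : ℕ → (Fin m → ℝ) → ℝ} {F : (Fin (m + 1) → ℝ) → ℝ}

/-- The axis polynomial decides regularity. -/
theorem exists_regular_le {G : (Fin (m + 1) → ℝ) → ℝ} (hG : AnalyticAt ℝ G 0) {q : Polynomial ℝ}
    {h : ℝ → ℝ} (hh : ContinuousAt h 0) (hh0 : h 0 ≠ 0)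
    (hax : ∀ᶠ t in 𝓝 (0 : ℝ), G (Fin.cons t 0) = q.eval t + t ^ d * h t)
    (hq : q.natDegree < d ∨ q = 0) :
    ∃ d' ≤ d, Regular d' G ∧ (q ≠ 0 → d' < d) := by
  by_cases hq0 : q = 0
  · refine ⟨d, le_rfl, regular_of_axis d hG hh hh0 ?_, fun h => absurd hq0 h⟩
    filter_upwards [hax.filter_mono nhdsWithin_le_nhds] with t ht
    simpa [hq0] using ht
  · obtain ⟨d', hd', hr⟩ := regular_of_coeff_ne_zero hG hh hax (hq.resolve_right hq0)
      (Polynomial.leadingCoeff_ne_zero.2 hq0)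
    have := hq.resolve_right hq0
    exact ⟨d', by omega, hr, fun _ => by omega⟩

theorem Weighted.analyticAt_factor {H : (Fin (m + 1) → ℝ) → ℝ} (hH : AnalyticAt ℝ H 0)
    (hw : ∀ j, AnalyticAt ℝ (w j) 0) (P : (Fin (m + 1) → ℝ) → ℝ) (hP : AnalyticAt ℝ P 0) :
    AnalyticAt ℝ (fun x : Fin (m + 1) → ℝ => ∑ j ∈ Finset.range d,
      (∏ i, Fin.tail x i ^ v i) ^ (d - j) * w j (Fin.tail x) * P x ^ j + P x ^ d * H x) 0 := by
  refine AnalyticAt.add ?_ ((hP.pow d).mul hH)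
  refine Finset.analyticAt_fun_sum _ fun j _ => ?_
  exact (((comp_tail_analyticAt (analyticAt_monomial v 0)).pow _).mul
    (comp_tail_analyticAt (hw j))).mul (hP.pow j)

theorem Weighted.reduced (h : Weighted 0 d w F) :
    ∃ d' ≤ d, Reduced d' F ∧ ((∃ j < d, w j 0 ≠ 0) → d' < d) := by
  classical
  obtain ⟨e, H, he, hH, hH0, hw, hF⟩ := h
  have hGa := Weighted.analyticAt_factor (d := d) (v := 0) hH hw _ (analyticAt_coord 0 0)
  set q : Polynomial ℝ := ∑ j ∈ Finset.range d, Polynomial.C (w j 0) * Polynomial.X ^ j with hq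
  have hcoeff : ∀ j, q.coeff j = if j < d then w j 0 else 0 := by
    intro j
    simp [hq, Polynomial.coeff_C_mul, Polynomial.coeff_X_pow]
  obtain ⟨d', hd', hr, hlt⟩ := exists_regular_le (d := d) (q := q) hGa
    (h := fun t => H (Fin.cons t 0)) (continuousAt_axis hH) (by simpa using hH0)
    (.of_forall fun t => by simp [hq, Polynomial.eval_finsetSum]) (by
      by_cases h0 : q = 0
      · exact Or.inr h0
      · left
        by_contra hcon
        have h1 := hcoeff q.natDegree
        rw [if_neg hcon] at h1
        exact Polynomial.leadingCoeff_ne_zero.2 h0 h1)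
  refine ⟨d', hd', ⟨e, _, he, hr, hF⟩, ?_⟩
  rintro ⟨j, hj, hwj⟩
  refine hlt fun h0 => hwj ?_
  have := hcoeff j
  rw [if_pos hj, h0] at this
  simpa using this.symm

theorem tail_blowUp (k : Fin m) (c : ℝ) (y : Fin (m + 1) → ℝ) :
    Fin.tail (blowUp 0 k.succ c y) = Fin.tail y := by
  ext l
  simp [blowUp, Fin.tail]

theorem blowUp_apply_self {n : ℕ} (i k : Fin n) (c : ℝ) (y : Fin n → ℝ) :
    blowUp i k c y i = y k * (c + y i) := by simp [blowUp]

/-- The form of a weighted function in the chart `x₀ = y_k (c + y₀)`. -/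
theorem Weighted.comp_blowUp (h : Weighted v d w F) (k : Fin m) (hk : 0 < v k) (c : ℝ) :
    ∃ e H, NormalCrossing e ∧ AnalyticAt ℝ H 0 ∧ H 0 ≠ 0 ∧ (∀ t : ℝ, H (Fin.cons t 0) = H 0) ∧
    (∀ j, AnalyticAt ℝ (w j) 0) ∧
    F ∘ blowUp 0 k.succ c =ᶠ[𝓝 0] fun x => e (Fin.tail x) *
      (∑ j ∈ Finset.range d, (∏ i, Fin.tail x i ^ (Function.update v k (v k - 1)) i) ^ (d - j) *
        w j (Fin.tail x) * (c + x 0) ^ j + (c + x 0) ^ d * H x) := by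
  obtain ⟨e, H, he, hH, hH0, hw, hF⟩ := h
  have hb := analyticAt_blowUp 0 k.succ c (0 : Fin (m + 1) → ℝ)
  have hb1 : ∀ t : ℝ, blowUp 0 k.succ c (Fin.cons t 0 : Fin (m + 1) → ℝ) = 0 := by
    intro t
    ext l
    refine Fin.cases ?_ (fun l => ?_) l <;> simp [blowUp]
  have hb0 : blowUp 0 k.succ c (0 : Fin (m + 1) → ℝ) = 0 := by
    simpa only [show (Fin.cons 0 0 : Fin (m + 1) → ℝ) = 0 from cons_zero_zero] using hb1 0
  refine ⟨fun y => e y * y k ^ d, H ∘ blowUp 0 k.succ c,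
    he.mul ((normalCrossing_coord k).pow d), AnalyticAt.comp (by rwa [hb0]) hb,
    by simpa [hb0] using hH0, fun t => by simp [hb1, hb0], hw, ?_⟩
  refine (comp_congr hF hb.continuousAt hb0).trans (.of_forall fun x => ?_)
  simp only [Function.comp, tail_blowUp, blowUp_apply_self]
  have hmon : ∏ i, Fin.tail x i ^ v i =
      Fin.tail x k * ∏ i, Fin.tail x i ^ (Function.update v k (v k - 1)) i := by
    classical
    rw [← Finset.mul_prod_erase _ _ (Finset.mem_univ k),
      ← Finset.mul_prod_erase _ (fun i => Fin.tail x i ^ (Function.update v k (v k - 1)) i)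
        (Finset.mem_univ k), ← mul_assoc, Function.update_self, ← pow_succ',
      Nat.sub_add_cancel hk]
    congr 1
    exact Finset.prod_congr rfl fun i hi => by
      rw [Function.update_of_ne (Finset.ne_of_mem_erase hi)]
  rw [hmon, show x k.succ = Fin.tail x k from rfl]
  refine (congrArg (e (Fin.tail x) * ·) ?_).trans (mul_assoc _ _ _).symm
  refine Eq.trans ?_ (mul_add _ _ _).symm
  rw [Finset.mul_sum]
  congr 1
  · refine Finset.sum_congr rfl fun j hj => ?_
    have : Fin.tail x k ^ d = Fin.tail x k ^ (d - j) * Fin.tail x k ^ j := by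
      rw [← pow_add]; congr 1; have := Finset.mem_range.1 hj; omega
    rw [this, mul_pow _ (c + x 0)]; ring
  · rw [mul_pow]; ring

theorem Weighted.comp_blowUp_zero (h : Weighted v d w F) (k : Fin m) (hk : 0 < v k) :
    Weighted (Function.update v k (v k - 1)) d w (F ∘ blowUp 0 k.succ 0) := by
  obtain ⟨e, H, he, hH, hH0, -, hw, hF⟩ := h.comp_blowUp k hk 0
  refine ⟨e, H, he, hH, hH0, hw, ?_⟩
  simpa only [zero_add] using hF

theorem Weighted.reduced_comp_blowUp (h : Weighted v d w F) (k : Fin m) (hk : 0 < v k) {c : ℝ}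
    (hc : c ≠ 0) : ∃ d' ≤ d, Reduced d' (F ∘ blowUp 0 k.succ c) ∧
      (0 < d → w (d - 1) 0 = 0 → d' < d) := by
  classical
  obtain ⟨e, H, he, hH, hH0, hHc, hw, hF⟩ := h.comp_blowUp k hk c
  have hGa := Weighted.analyticAt_factor (d := d) (v := Function.update v k (v k - 1)) hH hw _
    (analyticAt_const.add (analyticAt_coord 0 0) :
      AnalyticAt ℝ (fun x : Fin (m + 1) → ℝ => c + x 0) 0)
  set M : ℝ := ∏ i, (0 : Fin m → ℝ) i ^ (Function.update v k (v k - 1)) i with hM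
  set p : Polynomial ℝ := ∑ j ∈ Finset.range d,
    Polynomial.C (M ^ (d - j) * w j 0) * (Polynomial.C c + Polynomial.X) ^ j +
      Polynomial.C (H 0) * ((Polynomial.C c + Polynomial.X) ^ d) with hp
  have hcX : ∀ j l : ℕ, ((Polynomial.C c + Polynomial.X) ^ j).coeff l =
      c ^ (j - l) * (j.choose l : ℝ) := by
    intro j l
    rw [add_comm, Polynomial.coeff_X_add_C_pow]
  have hd : p.coeff d = H 0 := by
    rw [hp, Polynomial.coeff_add, Polynomial.finsetSum_coeff, Finset.sum_eq_zero, zero_add,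
      Polynomial.coeff_C_mul, hcX]
    · simp
    · intro j hj
      rw [Polynomial.coeff_C_mul, hcX, Nat.choose_eq_zero_of_lt (Finset.mem_range.1 hj)]
      simp
  have hax : ∀ᶠ t in 𝓝 (0 : ℝ), (fun x : Fin (m + 1) → ℝ => ∑ j ∈ Finset.range d,
      (∏ i, Fin.tail x i ^ (Function.update v k (v k - 1)) i) ^ (d - j) * w j (Fin.tail x) *
        (c + x 0) ^ j + (c + x 0) ^ d * H x) (Fin.cons t 0) = p.eval t + t ^ (d + 1) * 0 := by
    refine .of_forall fun t => ?_
    simp only [Fin.tail_cons, Fin.cons_zero, hHc, hp, Polynomial.eval_add,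
      Polynomial.eval_finsetSum, Polynomial.eval_mul, Polynomial.eval_pow, Polynomial.eval_C,
      Polynomial.eval_X, ← hM]
    ring
  by_cases hlow : 0 < d ∧ w (d - 1) 0 = 0
  · have h1 : p.coeff (d - 1) = d * c * H 0 := by
      obtain ⟨d₁, rfl⟩ : ∃ d₁, d = d₁ + 1 := ⟨d - 1, by omega⟩
      have hw0 := hlow.2
      simp only [Nat.add_sub_cancel] at hw0 ⊢
      rw [hp, Polynomial.coeff_add, Polynomial.finsetSum_coeff, Finset.sum_eq_zero, zero_add,
        Polynomial.coeff_C_mul, hcX]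
      · simp; ring
      · intro j hj
        rw [Polynomial.coeff_C_mul, hcX]
        rcases (Nat.lt_succ_iff.1 (Finset.mem_range.1 hj)).lt_or_eq with h | h
        · rw [Nat.choose_eq_zero_of_lt h]; simp
        · subst h; simp [hw0]
    obtain ⟨d', hd', hr⟩ := regular_of_coeff_ne_zero hGa (h := fun _ => 0) continuousAt_const hax
      (j := d - 1) (by omega) (by
        rw [h1]
        exact mul_ne_zero (mul_ne_zero (by exact_mod_cast hlow.1.ne') hc) hH0)
    exact ⟨d', by omega, ⟨e, _, he, hr, hF⟩, fun _ _ => by omega⟩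
  · obtain ⟨d', hd', hr⟩ := regular_of_coeff_ne_zero hGa (h := fun _ => 0) continuousAt_const hax
      (j := d) (by omega) (by rwa [hd])
    exact ⟨d', hd', ⟨e, _, he, hr, hF⟩, fun h1 h2 => absurd ⟨h1, h2⟩ hlow⟩

/-- In the chart `x_k = y₀ y_k` a weighted function is a normal crossing. -/
theorem Weighted.normalCrossing_comp_blowUp (h : Weighted v d w F) (k : Fin m) (hk : 0 < v k) :
    NormalCrossing (F ∘ blowUp k.succ 0 0) := by
  obtain ⟨e, H, he, hH, hH0, hw, hF⟩ := h
  have hb := analyticAt_blowUp k.succ 0 0 (0 : Fin (m + 1) → ℝ)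
  have hb0 : blowUp k.succ 0 0 (0 : Fin (m + 1) → ℝ) = 0 := by
    ext l; simp [blowUp]
  set B := blowUp k.succ (0 : Fin (m + 1)) 0 with hB
  have hmon : ∀ x, ∏ i, Fin.tail (B x) i ^ v i = x 0 ^ v k * ∏ i, Fin.tail x i ^ v i := by
    intro x
    classical
    have : ∀ i, Fin.tail (B x) i ^ v i = Fin.tail x i ^ v i * if i = k then x 0 ^ v k else 1 := by
      intro i
      by_cases hi : i = k
      · subst hi; simp [hB, blowUp, Fin.tail, mul_pow, mul_comm]
      · have : i.succ ≠ k.succ := by simpa using hi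
        simp [hB, blowUp, Fin.tail, hi]
    simp only [this, Finset.prod_mul_distrib, Finset.prod_ite_eq', Finset.mem_univ, if_true]
    ring
  have hB00 : ∀ x, B x 0 = x 0 := fun x => by
    simp [hB, blowUp, Function.update_of_ne (Fin.succ_ne_zero k).symm]
  have hwB : ∀ j, AnalyticAt ℝ (fun x => w j (Fin.tail (B x))) 0 := fun j =>
    AnalyticAt.comp (g := fun x : Fin (m + 1) → ℝ => w j (Fin.tail x))
      (by rw [hb0]; exact comp_tail_analyticAt (hw j)) hb
  have hHB : AnalyticAt ℝ (H ∘ B) 0 := AnalyticAt.comp (by rwa [hb0]) hb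
  have hunit : AnalyticAt ℝ (fun x : Fin (m + 1) → ℝ => ∑ j ∈ Finset.range d,
      x 0 ^ ((v k - 1) * (d - j)) * (∏ i, Fin.tail x i ^ v i) ^ (d - j) * w j (Fin.tail (B x)) +
        (H ∘ B) x) 0 := by
    refine AnalyticAt.add (Finset.analyticAt_fun_sum _ fun j _ => ?_) hHB
    exact (((analyticAt_coord 0 0).pow _).mul
      ((comp_tail_analyticAt (analyticAt_monomial v 0)).pow _)).mul (hwB j)
  have hM0 : ∏ i, Fin.tail (0 : Fin (m + 1) → ℝ) i ^ v i = 0 :=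
    Finset.prod_eq_zero (Finset.mem_univ k) (by simp [Fin.tail, hk.ne'])
  refine (((he.comp_tail.comp_blowUp k.succ 0).mul ((normalCrossing_coord 0).pow d)).mul
    (normalCrossing_of_ne_zero hunit ?_)).congr ?_
  · rw [Finset.sum_eq_zero]
    · simpa [hb0] using hH0
    · intro j hj
      have : d - j ≠ 0 := by have := Finset.mem_range.1 hj; omega
      rw [hM0]; simp [this]
  · refine (comp_congr hF hb.continuousAt hb0).trans (.of_forall fun x => ?_)
    simp only [Function.comp, hB00, hmon]
    rw [mul_assoc]
    congr 1
    rw [mul_add, Finset.mul_sum]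
    congr 1
    refine Finset.sum_congr rfl fun j hj => ?_
    have h1 : x 0 ^ d = x 0 ^ (d - j) * x 0 ^ j := by
      rw [← pow_add]; congr 1; have := Finset.mem_range.1 hj; omega
    have h2 : (x 0 ^ v k) ^ (d - j) = x 0 ^ (d - j) * x 0 ^ ((v k - 1) * (d - j)) := by
      rw [← pow_mul, ← pow_add]; congr 1
      obtain ⟨a, ha⟩ : ∃ a, v k = a + 1 := ⟨v k - 1, by omega⟩
      rw [ha, Nat.add_sub_cancel]; ring
    rw [mul_pow, h1, h2]; ring

end monomialization

section monomialization
variable {m : ℕ}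

theorem Resolution.exists_lift {Q : ((Fin m → ℝ) → (Fin m → ℝ)) → ((Fin m → ℝ) → ℝ) → Prop}
    (h : Resolution Q) : Resolution (fun Φ Δ => ∃ π D, Φ = liftMap π ∧
      (Δ = fun y => D (Fin.tail y)) ∧ AnalyticAt ℝ π 0 ∧ π 0 = 0 ∧ Q π D) :=
  (h.mono (Q' := fun π D => AnalyticAt ℝ π 0 ∧ π 0 = 0 ∧ Q π D)
    fun _ _ h1 h2 h3 => ⟨h1, h2, h3⟩).lift fun π D h => ⟨π, D, rfl, rfl, h⟩

theorem Resolution.weighted (S : ℕ)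
    (IH : ∀ (ι : Type) [Fintype ι] (F : ι → (Fin (m + 1) → ℝ) → ℝ) (d : ι → ℕ),
      (∀ i, Reduced (d i) (F i)) → ∑ i, d i < S →
      Resolution (fun π D => (∀ i, NormalCrossing (F i ∘ π)) ∧ NormalCrossing D)) :
    ∀ (N : ℕ) (v : Fin m → ℕ), ∑ i, v i = N →
      ∀ (ι : Type) [Fintype ι] (F : ι → (Fin (m + 1) → ℝ) → ℝ) (d : ι → ℕ)
        (w : ι → ℕ → (Fin m → ℝ) → ℝ), (∀ i, Weighted v (d i) (w i) (F i)) → ∑ i, d i ≤ S →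
      (∃ i, ∃ j < d i, w i j 0 ≠ 0) → (∃ i, 0 < d i ∧ w i (d i - 1) 0 = 0) →
      Resolution (fun π D => (∀ i, NormalCrossing (F i ∘ π)) ∧ NormalCrossing D) := by
  classical
  intro N
  induction N with
  | zero =>
    intro v hv ι _ F d w hF hd ⟨i₀, j₀, hj₀, hw₀⟩ _
    have hv0 : v = 0 := funext fun i => (Finset.sum_eq_zero_iff.1 hv) i (Finset.mem_univ i)
    subst hv0
    choose d' hd' hr hlt using fun i => (hF i).reduced
    exact IH ι F d' hr ((Finset.sum_lt_sum (fun i _ => hd' i)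
      ⟨i₀, Finset.mem_univ _, hlt i₀ ⟨j₀, hj₀, hw₀⟩⟩).trans_le hd)
  | succ N ihN =>
    intro v hv ι _ F d w hF hd hw₀ ⟨i₁, hi₁, hwi₁⟩
    obtain ⟨k, hk⟩ : ∃ k, 0 < v k := by
      by_contra h
      push Not at h
      rw [Finset.sum_eq_zero fun i _ => Nat.le_zero.1 (h i)] at hv
      omega
    refine Resolution.blow _ 0 k.succ (Fin.succ_ne_zero k).symm ?_ fun c => ?_
    · refine Resolution.leaf _ ⟨fun i => (hF i).normalCrossing_comp_blowUp k hk, ?_⟩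
      exact (normalCrossing_coord 0).mul (normalCrossing_of_ne_zero analyticAt_const one_ne_zero)
    · have key : Resolution (fun π D =>
          (∀ i, NormalCrossing ((Option.elim i (fun y : Fin (m + 1) → ℝ => y k.succ)
            fun i => F i ∘ blowUp 0 k.succ c) ∘ π)) ∧ NormalCrossing D) := by
        by_cases hc : c = 0
        · subst hc
          have hsum : ∑ i, Function.update v k (v k - 1) i = N := by
            have h1 := Finset.add_sum_erase _ v (Finset.mem_univ k)
            have h2 : ∑ i ∈ Finset.univ.erase k, Function.update v k (v k - 1) i =
                ∑ i ∈ Finset.univ.erase k, v i := Finset.sum_congr rfl fun i hi => by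
              rw [Function.update_of_ne (Finset.ne_of_mem_erase hi)]
            rw [← Finset.add_sum_erase _ _ (Finset.mem_univ k), Function.update_self, h2]
            omega
          refine ihN _ hsum (Option ι) (fun i => Option.elim i (fun y : Fin (m + 1) → ℝ => y k.succ)
            fun i => F i ∘ blowUp 0 k.succ 0) (fun i => i.elim 0 d)
            (fun i => i.elim (fun _ _ => 0) w) ?_ ?_ ?_ ?_
          · rintro (_ | i)
            · exact ⟨fun y => y k, 1, normalCrossing_coord k, analyticAt_const, one_ne_zero,
                fun j => analyticAt_const, .of_forall fun y => by simp [Fin.tail]⟩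
            · exact (hF i).comp_blowUp_zero k hk
          · simpa [Fintype.sum_option] using hd
          · obtain ⟨i, j, h⟩ := hw₀
            exact ⟨some i, j, h⟩
          · exact ⟨some i₁, hi₁, hwi₁⟩
        · choose d' hd' hr hlt using fun i => (hF i).reduced_comp_blowUp k hk hc
          refine IH (Option ι) (fun i => Option.elim i (fun y : Fin (m + 1) → ℝ => y k.succ)
            fun i => F i ∘ blowUp 0 k.succ c) (fun i => i.elim 0 d') ?_ ?_
          · rintro (_ | i)
            · refine ⟨fun y => y k, 1, normalCrossing_coord k, ?_,
                .of_forall fun y => by simp [Fin.tail]⟩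
              exact ⟨fun _ _ => 0, 1, ⟨fun _ => analyticAt_const, analyticAt_const,
                .of_forall fun y => by simp⟩, one_ne_zero, fun _ _ => rfl⟩
            · exact hr i
          · rw [Fintype.sum_option]
            simpa using (Finset.sum_lt_sum (fun i _ => hd' i)
              ⟨i₁, Finset.mem_univ _, hlt i₁ hi₁ hwi₁⟩).trans_le hd
      refine key.mono fun π D hπ hπ0 h => ⟨fun i => h.1 (some i), (h.1 none).mul h.2⟩

theorem Resolution.of_reduced (hM : Monomialization m) : ∀ (S : ℕ) (ι : Type) [Fintype ι]
    (F : ι → (Fin (m + 1) → ℝ) → ℝ) (d : ι → ℕ), (∀ i, Reduced (d i) (F i)) → ∑ i, d i = S →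
    Resolution (fun π D => (∀ i, NormalCrossing (F i ∘ π)) ∧ NormalCrossing D) := by
  classical
  intro S
  induction S using Nat.strong_induction_on with
  | _ S IH =>
  intro ι _ F d hF hd
  by_cases hz : ∀ i, d i = 0
  · exact Resolution.leaf _ ⟨fun i => ((hz i ▸ hF i : Reduced 0 (F i))).normalCrossing,
      normalCrossing_of_ne_zero analyticAt_const one_ne_zero⟩
  push Not at hz
  obtain ⟨i₁, hi₁⟩ := hz
  choose e G he hG hFe using hF
  obtain ⟨θ, hθ, hθ0, c₁, H₁, hE₁, hH₁, hc₁, hcz⟩ := Regular.exists_shear (d := d i₁ - 1)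
    (G := G i₁) (by rw [Nat.sub_add_cancel (Nat.pos_of_ne_zero hi₁)]; exact hG i₁)
  rw [Nat.sub_add_cancel (Nat.pos_of_ne_zero hi₁)] at hE₁ hc₁
  have hex : ∀ i, ∃ c H, Expansion (d i) (G i ∘ OscillatoryDecay.shear θ) c H ∧ H 0 ≠ 0 ∧
      (i = i₁ → c (d i - 1) =ᶠ[𝓝 0] 0) := by
    intro i
    by_cases h : i = i₁
    · subst h
      exact ⟨c₁, H₁, hE₁, hH₁, fun _ => hcz⟩
    · obtain ⟨c, H, h1, h2, -⟩ := (hG i).comp_shear hθ hθ0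
      exact ⟨c, H, h1, h2, fun h' => absurd h' h⟩
  choose c H hE hH0 hcz using hex
  have hFs : ∀ i, F i ∘ OscillatoryDecay.shear θ =ᶠ[𝓝 0] fun x => e i (Fin.tail x) *
      (∑ j ∈ Finset.range (d i), c i j (Fin.tail x) * x 0 ^ j + x 0 ^ d i * H i x) := by
    intro i
    filter_upwards [(tendsto_shear hθ hθ0).eventually (hFe i), (hE i).2.2] with x h1 h2
    rw [← h2]
    exact h1
  refine Resolution.shear hθ hθ0 ?_
  have hW := hM.weighted e he (fun p : Σ i, Fin (d i) => c p.1 p.2) (fun p => (hE p.1).1 p.2)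
    (fun p => d p.1 - p.2) (fun p => Nat.sub_pos_of_lt p.2.2)
  refine hW.exists_lift.bind ?_
  rintro _ _ hπ' hπ'0 ⟨π, D, rfl, rfl, hπ, hπ0, hD, heπ, hcase⟩
  have hFπ : ∀ i, F i ∘ OscillatoryDecay.shear θ ∘ liftMap π =ᶠ[𝓝 0] fun x =>
      (e i ∘ π) (Fin.tail x) *
      (∑ j ∈ Finset.range (d i), (c i j ∘ π) (Fin.tail x) * x 0 ^ j +
        x 0 ^ d i * (H i ∘ liftMap π) x) :=
    fun i => comp_congr (hFs i) hπ'.continuousAt hπ'0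
  have hHa : ∀ i, AnalyticAt ℝ (H i ∘ liftMap π) 0 := fun i =>
    AnalyticAt.comp (by rw [hπ'0]; exact (hE i).2.1) hπ'
  have hH0' : ∀ i, (H i ∘ liftMap π) 0 ≠ 0 := fun i => by
    simpa [hπ'0] using hH0 i
  have key : Resolution (fun π' D' =>
      (∀ i, NormalCrossing ((Option.elim i (fun y : Fin (m + 1) → ℝ => D (Fin.tail y))
        fun i => F i ∘ OscillatoryDecay.shear θ ∘ liftMap π) ∘ π')) ∧ NormalCrossing D') := by
    rcases hcase with hzero | ⟨v, w, hw, ⟨⟨i₀, j₀⟩, hw₀⟩, hcw⟩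
    · refine Resolution.leaf _ ⟨?_, normalCrossing_of_ne_zero analyticAt_const one_ne_zero⟩
      rintro (_ | i)
      · exact hD.comp_tail
      · refine (((heπ i).comp_tail).mul (((normalCrossing_coord 0).pow (d i)).mul
          (normalCrossing_of_ne_zero (hHa i) (hH0' i)))).congr ?_
        have hz : ∀ᶠ x : Fin (m + 1) → ℝ in 𝓝 0, ∀ j : Fin (d i), (c i j ∘ π) (Fin.tail x) = 0 :=
          eventually_all.2 fun j => tendsto_tail.eventually (hzero ⟨i, j⟩)
        filter_upwards [hFπ i, hz] with x h1 h2
        have h1' : ((F i ∘ OscillatoryDecay.shear θ ∘ liftMap π) ∘ id) x = _ := h1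
        refine h1'.trans ?_
        rw [Finset.sum_eq_zero, zero_add]
        intro j hj
        rw [h2 ⟨j, Finset.mem_range.1 hj⟩, zero_mul]
    · let w' : ι → ℕ → (Fin m → ℝ) → ℝ := fun i j => if h : j < d i then
        if c i j ∘ π =ᶠ[𝓝 0] 0 then 0 else w ⟨i, ⟨j, h⟩⟩ else 0
      have hw'a : ∀ i j, AnalyticAt ℝ (w' i j) 0 := by
        intro i j
        simp only [w']
        split_ifs
        · exact analyticAt_const
        · exact hw _
        · exact analyticAt_const
      have hw'e : ∀ i j, j < d i → c i j ∘ π =ᶠ[𝓝 0]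
          fun y => (∏ l, y l ^ v l) ^ (d i - j) * w' i j y := by
        intro i j hj
        simp only [w', dif_pos hj]
        split_ifs with h
        · exact h.trans (.of_forall fun y => by simp)
        · exact hcw ⟨i, ⟨j, hj⟩⟩
      refine Resolution.weighted S (fun ι _ F d hF hd => IH _ hd ι F d hF rfl) _ v rfl (Option ι)
        (fun i => Option.elim i (fun y : Fin (m + 1) → ℝ => D (Fin.tail y))
          fun i => F i ∘ OscillatoryDecay.shear θ ∘ liftMap π) (fun i => i.elim 0 d)
        (fun i => i.elim (fun _ _ => 0) w') ?_ ?_ ?_ ?_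
      · rintro (_ | i)
        · exact ⟨D, 1, hD, analyticAt_const, one_ne_zero, fun j => analyticAt_const,
            .of_forall fun y => by simp⟩
        · refine ⟨_, _, heπ i, hHa i, hH0' i, hw'a i, ?_⟩
          have hz : ∀ᶠ x : Fin (m + 1) → ℝ in 𝓝 0, ∀ j : Fin (d i), (c i j ∘ π) (Fin.tail x) =
              (∏ l, Fin.tail x l ^ v l) ^ (d i - j) * w' i j (Fin.tail x) :=
            eventually_all.2 fun j => tendsto_tail.eventually (hw'e i j j.2)
          filter_upwards [hFπ i, hz] with x h1 h2
          refine h1.trans ?_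
          congr 2
          exact Finset.sum_congr rfl fun j hj => by rw [h2 ⟨j, Finset.mem_range.1 hj⟩]; rfl
      · simpa [Fintype.sum_option] using hd.le
      · refine ⟨some i₀, j₀, j₀.2, ?_⟩
        have hnz : ¬ c i₀ j₀ ∘ π =ᶠ[𝓝 0] 0 := by
          intro h
          refine NormalCrossing.not_eventually_zero ?_ ((hcw ⟨i₀, j₀⟩).symm.trans h)
          exact ((NormalCrossing.prod_coord v).pow _).mul (normalCrossing_of_ne_zero (hw _) hw₀)
        simpa [w', hnz] using hw₀
      · refine ⟨some i₁, Nat.pos_of_ne_zero hi₁, ?_⟩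
        have hz : c i₁ (d i₁ - 1) ∘ π =ᶠ[𝓝 0] 0 := comp_congr (hcz i₁ rfl) hπ.continuousAt hπ0
        show w' i₁ (d i₁ - 1) 0 = 0
        simp only [w']
        split_ifs <;> rfl
  exact key.mono fun π' D' _ _ h => ⟨fun i => h.1 (some i), (h.1 none).mul h.2⟩

theorem monomialization : ∀ n, Monomialization n := by
  intro n
  induction n with
  | zero =>
    intro ι _ F hF hF0
    refine Resolution.leaf _ ⟨fun i => normalCrossing_of_ne_zero (hF i) fun h => hF0 i ?_,
      normalCrossing_of_ne_zero analyticAt_const one_ne_zero⟩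
    exact .of_forall fun y => by rw [Subsingleton.elim y 0]; exact h
  | succ m ih =>
    intro ι _ F hF hF0
    have := Fintype.ofFinite ι
    obtain ⟨v, hv0, hv⟩ := exists_direction F hF hF0
    let θ : (Fin (m + 1) → ℝ) → (Fin (m + 1) → ℝ) := fun x => x + x 0 • (v - Pi.single 0 1)
    let L : (Fin (m + 1) → ℝ) ≃ₗ[ℝ] (Fin (m + 1) → ℝ) :=
      { toFun := fun x => x + x 0 • (v - Pi.single 0 1)
        invFun := fun x => x - x 0 • (v - Pi.single 0 1)
        map_add' := fun x y => by simp only [Pi.add_apply, add_smul]; abel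
        map_smul' := fun a x => by simp [smul_add, smul_smul]
        left_inv := fun x => by simp [hv0]
        right_inv := fun x => by simp [hv0] }
    have hL : ∀ t : ℝ, L (Fin.cons t 0) = t • v := by
      intro t
      show (Fin.cons t 0 : Fin (m + 1) → ℝ) + (Fin.cons t 0 : Fin (m + 1) → ℝ) 0 •
        (v - Pi.single 0 1) = t • v
      ext i
      refine Fin.cases ?_ (fun i => ?_) i <;> simp [hv0]
    let L' := L.toContinuousLinearEquiv
    have hL' : ∀ x, L' x = L x := fun _ => rfl
    refine Resolution.linear L' ?_
    have hG : ∀ i, AnalyticAt ℝ (F i ∘ L') 0 := fun i =>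
      AnalyticAt.comp (by rw [map_zero]; exact hF i)
        ((L' : (Fin (m + 1) → ℝ) →L[ℝ] (Fin (m + 1) → ℝ)).analyticAt 0)
    have hreg : ∀ i, ∃ d, Regular d (F i ∘ L') := fun i =>
      exists_regular (hG i) fun h => hv i (h.mono fun t ht => by
        rw [← hL t]; exact ht)
    choose d hd using hreg
    refine (Resolution.of_reduced ih _ ι (fun i => F i ∘ L') d (fun i => ⟨1, _,
      normalCrossing_of_ne_zero analyticAt_const one_ne_zero, hd i,
      .of_forall fun x => by simp⟩) rfl)

end monomialization

section chain
variable {n : ℕ} {a b c X : (Fin n → ℝ) → ℝ}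

/-- `b` is the product of `a` and an analytic function vanishing at the origin. -/
def Precedes (a b : (Fin n → ℝ) → ℝ) : Prop :=
  ∃ h, AnalyticAt ℝ h 0 ∧ h 0 = 0 ∧ b =ᶠ[𝓝 0] fun y => a y * h y

theorem Precedes.comp (h : Precedes a b) {π : (Fin n → ℝ) → (Fin n → ℝ)} (hπ : AnalyticAt ℝ π 0)
    (h0 : π 0 = 0) : Precedes (a ∘ π) (b ∘ π) := by
  obtain ⟨h, hh, hh0, hab⟩ := h
  exact ⟨h ∘ π, AnalyticAt.comp (by rwa [h0]) hπ, by simp [h0, hh0],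
    comp_congr hab hπ.continuousAt h0⟩

theorem Precedes.trans (hab : Precedes a b) (hbc : Precedes b c) : Precedes a c := by
  obtain ⟨h, hh, hh0, h1⟩ := hab
  obtain ⟨k, hk, hk0, h2⟩ := hbc
  refine ⟨fun y => h y * k y, hh.mul hk, by simp [hh0], ?_⟩
  filter_upwards [h1, h2] with y e1 e2
  rw [e2, e1, mul_assoc]

theorem Precedes.sub_const_mul (hX : Precedes a X) (hb : Precedes a b) (r : ℝ) :
    Precedes a (fun y => X y - r * b y) := by
  obtain ⟨h, hh, hh0, h1⟩ := hX
  obtain ⟨k, hk, hk0, h2⟩ := hb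
  refine ⟨fun y => h y - r * k y, hh.sub (analyticAt_const.mul hk), by simp [hh0, hk0], ?_⟩
  filter_upwards [h1, h2] with y e1 e2
  rw [e1, e2]; ring

/-- Normal crossings vanishing at the origin, each preceding the later ones. -/
def Chain (L : List ((Fin n → ℝ) → ℝ)) : Prop :=
  L.Pairwise Precedes ∧ ∀ a ∈ L, NormalCrossing a ∧ a 0 = 0

theorem Chain.comp {L : List ((Fin n → ℝ) → ℝ)} (hL : Chain L) {π : (Fin n → ℝ) → (Fin n → ℝ)}
    (hπ : AnalyticAt ℝ π 0) (h0 : π 0 = 0) (hN : ∀ a ∈ L, NormalCrossing (a ∘ π)) :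
    Chain (L.map (· ∘ π)) := by
  refine ⟨hL.1.map _ fun a b h => h.comp hπ h0, ?_⟩
  intro a ha
  obtain ⟨b, hb, rfl⟩ := List.mem_map.1 ha
  exact ⟨hN b hb, by simp [h0, (hL.2 b hb).2]⟩

theorem resolution_list (L : List ((Fin n → ℝ) → ℝ))
    (hL : ∀ a ∈ L, AnalyticAt ℝ a 0 ∧ ¬ a =ᶠ[𝓝 0] 0) :
    Resolution (fun π D => (∀ a ∈ L, NormalCrossing (a ∘ π)) ∧ NormalCrossing D) := by
  have : Finite {a // a ∈ L} := L.finite_toSet.to_subtype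
  exact (monomialization n {a // a ∈ L} (fun a => a.1) (fun a => (hL a a.2).1)
    fun a => (hL a a.2).2).mono fun π D _ _ h => ⟨fun a ha => h.1 ⟨a, ha⟩, h.2⟩

/-- `L'` is a chain extending the pullback of `L` whose span contains the pullback of `X`. -/
def Extends (L : List ((Fin n → ℝ) → ℝ)) (X : (Fin n → ℝ) → ℝ) (π : (Fin n → ℝ) → (Fin n → ℝ))
    (L' : List ((Fin n → ℝ) → ℝ)) : Prop :=
  Chain L' ∧ L'.length ≤ L.length + 1 ∧ (∀ a ∈ L, a ∘ π ∈ L') ∧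
    ∃ Y ∈ Submodule.span ℝ {a | a ∈ L'}, X ∘ π =ᶠ[𝓝 0] Y

theorem exists_quotient {A B u w : (Fin n → ℝ) → ℝ} {α β : Fin n → ℕ} (hu : AnalyticAt ℝ u 0)
    (hw : AnalyticAt ℝ w 0) (hw0 : w 0 ≠ 0) (hA : A =ᶠ[𝓝 0] fun y => (∏ i, y i ^ α i) * u y)
    (hB : B =ᶠ[𝓝 0] fun y => (∏ i, y i ^ β i) * w y) (hle : β ≤ α) :
    ∃ h, AnalyticAt ℝ h 0 ∧ (α ≠ β → h 0 = 0) ∧ A =ᶠ[𝓝 0] fun y => B y * h y := by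
  refine ⟨fun y => (∏ i, y i ^ (α i - β i)) * (u y / w y),
    (analyticAt_monomial _ 0).mul (hu.div hw hw0), fun hne => ?_, ?_⟩
  · obtain ⟨i, hi⟩ := Function.ne_iff.1 hne
    have h1 : β i ≤ α i := hle i
    have h2 : α i - β i ≠ 0 := by omega
    show (∏ i, (0 : Fin n → ℝ) i ^ (α i - β i)) * _ = 0
    rw [Finset.prod_eq_zero (Finset.mem_univ i) (by simp [h2]), zero_mul]
  · filter_upwards [hA, hB, hw.continuousAt.eventually_ne hw0] with y h1 h2 h3
    have h4 : ∏ i, y i ^ α i = (∏ i, y i ^ β i) * ∏ i, y i ^ (α i - β i) := by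
      rw [← Finset.prod_mul_distrib]
      exact Finset.prod_congr rfl fun i _ => by rw [← pow_add, Nat.add_sub_cancel' (hle i)]
    rw [h1, h2, h4]
    field_simp

theorem Chain.append {L₁ L₂ : List ((Fin n → ℝ) → ℝ)} (h : Chain (L₁ ++ L₂))
    (hX : NormalCrossing X) (hX0 : X 0 = 0) (h1 : ∀ a ∈ L₁, Precedes a X)
    (h2 : ∀ a ∈ L₂, Precedes X a) : Chain (L₁ ++ X :: L₂) := by
  obtain ⟨hp, hN⟩ := h
  rw [List.pairwise_append] at hp
  refine ⟨List.pairwise_append.2 ⟨hp.1, List.pairwise_cons.2 ⟨h2, hp.2.1⟩, ?_⟩, ?_⟩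
  · intro a ha b hb
    rcases List.mem_cons.1 hb with rfl | hb
    exacts [h1 a ha, hp.2.2 a ha b hb]
  · intro a ha
    rcases List.mem_append.1 ha with ha | ha
    · exact hN a (List.mem_append_left _ ha)
    rcases List.mem_cons.1 ha with rfl | ha
    exacts [⟨hX, hX0⟩, hN a (List.mem_append_right _ ha)]

theorem resolution_extends (N : ℕ) :
    ∀ (M L₂ : List ((Fin n → ℝ) → ℝ)), L₂.length = N → ∀ (L₁ : List ((Fin n → ℝ) → ℝ))
    (X : (Fin n → ℝ) → ℝ), Chain (L₁ ++ L₂) → AnalyticAt ℝ X 0 → X 0 = 0 →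
    (∀ a ∈ L₁, Precedes a X) → (∀ a ∈ M, NormalCrossing a) →
    Resolution (fun π D => (∀ a ∈ M, NormalCrossing (a ∘ π)) ∧ NormalCrossing D ∧
      ∃ L', Extends (L₁ ++ L₂) X π L') := by
  have leaf : ∀ (M L : List ((Fin n → ℝ) → ℝ)) (X Y : (Fin n → ℝ) → ℝ), Chain L →
      Y ∈ Submodule.span ℝ {a | a ∈ L} → X =ᶠ[𝓝 0] Y → (∀ a ∈ M, NormalCrossing a) →
      Resolution (fun π D => (∀ a ∈ M, NormalCrossing (a ∘ π)) ∧ NormalCrossing D ∧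
        ∃ L', Extends L X π L') := fun M L X Y hL hY hX hM =>
    Resolution.leaf _ ⟨hM, normalCrossing_of_ne_zero analyticAt_const one_ne_zero, L, hL,
      Nat.le_succ _, fun a ha => ha, Y, hY, hX⟩
  induction N with
  | zero =>
    intro M L₂ hlen L₁ X hL hX hX0 hpre hM
    obtain rfl := List.length_eq_zero_iff.1 hlen
    by_cases hz : X =ᶠ[𝓝 0] 0
    · exact leaf M _ X 0 hL (Submodule.zero_mem _) hz hM
    rw [List.append_nil] at hL ⊢
    refine (resolution_list (X :: (L₁ ++ M)) ?_).mono ?_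
    · intro a ha
      rcases List.mem_cons.1 ha with rfl | ha
      · exact ⟨hX, hz⟩
      rcases List.mem_append.1 ha with ha | ha
      · exact ⟨(hL.2 a ha).1.analyticAt, (hL.2 a ha).1.not_eventually_zero⟩
      · exact ⟨(hM a ha).analyticAt, (hM a ha).not_eventually_zero⟩
    · rintro π D hπ hπ0 ⟨hN, hD⟩
      have hc := hL.comp hπ hπ0 fun a ha => hN a (by simp [ha])
      refine ⟨fun a ha => hN a (by simp [ha]), hD, L₁.map (· ∘ π) ++ [X ∘ π], ?_,
        by simp, fun a ha => by simp; exact Or.inl ⟨a, ha, rfl⟩, X ∘ π,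
        Submodule.subset_span (by simp), .rfl⟩
      refine Chain.append (by simpa using hc) (hN X (by simp)) (by simp [hπ0, hX0]) ?_ (by simp)
      intro a ha
      obtain ⟨a', ha', rfl⟩ := List.mem_map.1 ha
      exact (hpre a' ha').comp hπ hπ0
  | succ N ih =>
    intro M L₂ hlen L₁ X hL hX hX0 hpre hM
    obtain ⟨b, L₂, rfl⟩ := List.exists_cons_of_length_eq_add_one hlen
    have hbm : b ∈ L₁ ++ b :: L₂ := by simp
    by_cases hz : X =ᶠ[𝓝 0] 0
    · exact leaf M _ X 0 hL (Submodule.zero_mem _) hz hM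
    by_cases hzb : (fun y => X y - b y) =ᶠ[𝓝 0] 0
    · refine leaf M _ X b hL (Submodule.subset_span hbm) ?_ hM
      filter_upwards [hzb] with y hy using sub_eq_zero.1 hy
    have hba := (hL.2 b hbm).1.analyticAt
    refine (resolution_list (X :: (fun y => X y - b y) :: ((L₁ ++ b :: L₂) ++ M)) ?_).bind ?_
    · intro a ha
      rcases List.mem_cons.1 ha with rfl | ha
      · exact ⟨hX, hz⟩
      rcases List.mem_cons.1 ha with rfl | ha
      · exact ⟨hX.sub hba, hzb⟩
      rcases List.mem_append.1 ha with ha | ha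
      · exact ⟨(hL.2 a ha).1.analyticAt, (hL.2 a ha).1.not_eventually_zero⟩
      · exact ⟨(hM a ha).analyticAt, (hM a ha).not_eventually_zero⟩
    rintro π D hπ hπ0 ⟨hN, hD⟩
    have hc := hL.comp hπ hπ0 fun a ha => hN a
      (List.mem_cons_of_mem _ (List.mem_cons_of_mem _ (List.mem_append_left _ ha)))
    have hMπ : ∀ a ∈ M, NormalCrossing (a ∘ π) := fun a ha => hN a
      (List.mem_cons_of_mem _ (List.mem_cons_of_mem _ (List.mem_append_right _ ha)))
    have hXN := hN X (by simp)
    obtain ⟨α, u, hu, hu0, hXu⟩ := hXN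
    obtain ⟨β, w, hw, hw0, hbw⟩ := hN b (by simp)
    have hsub : NormalCrossing (fun y => (X ∘ π) y - (b ∘ π) y) :=
      hN (fun y => X y - b y) (by simp)
    have hcmp := exponents_comparable hu hu0 hw hw0 hXu hbw hsub
    have hL₁b : ∀ a ∈ L₁, Precedes a b := fun a ha =>
      (List.pairwise_append.1 hL.1).2.2 a ha b (by simp)
    have hbL₂ : ∀ a ∈ L₂, Precedes b a := fun a ha =>
      (List.pairwise_cons.1 (List.pairwise_append.1 hL.1).2.1).1 a ha
    by_cases hle : β ≤ α
    · obtain ⟨h, hh, -, hXb⟩ := exists_quotient hu hw hw0 hXu hbw hle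
      have hXa : AnalyticAt ℝ (X ∘ π) 0 := AnalyticAt.comp (by rwa [hπ0]) hπ
      have hbπ : AnalyticAt ℝ (b ∘ π) 0 := AnalyticAt.comp (by rwa [hπ0]) hπ
      have hb0 := (hL.2 b hbm).2
      have hlist : L₁.map (· ∘ π) ++ [b ∘ π] ++ L₂.map (· ∘ π) = (L₁ ++ b :: L₂).map (· ∘ π) := by
        simp
      have hrec := ih (D :: M.map (· ∘ π)) (L₂.map (· ∘ π)) (by simpa using hlen)
        (L₁.map (· ∘ π) ++ [b ∘ π]) (fun y => (X ∘ π) y - h 0 * (b ∘ π) y)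
        (by rw [hlist]; exact hc) (hXa.sub (analyticAt_const.mul hbπ)) (by simp [hπ0, hX0, hb0])
        (by
          intro a ha
          rcases List.mem_append.1 ha with ha | ha
          · obtain ⟨a', ha', rfl⟩ := List.mem_map.1 ha
            exact ((hpre a' ha').comp hπ hπ0).sub_const_mul ((hL₁b a' ha').comp hπ hπ0) _
          · rw [List.mem_singleton.1 ha]
            refine ⟨fun y => h y - h 0, hh.sub analyticAt_const, by simp, ?_⟩
            filter_upwards [hXb] with y hy
            rw [hy]; ring)
        (by
          intro a ha
          rcases List.mem_cons.1 ha with rfl | ha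
          · exact hD
          · obtain ⟨a', ha', rfl⟩ := List.mem_map.1 ha
            exact hMπ a' ha')
      rw [hlist] at hrec
      refine hrec.mono ?_
      rintro π' D' hπ' hπ'0 ⟨hM', hD', L', hcL, hlen, hmem, Y, hY, hXY⟩
      have hbL : (b ∘ π) ∘ π' ∈ L' := hmem _ (List.mem_map.2 ⟨b, hbm, rfl⟩)
      refine ⟨fun a ha => hM' _ (List.mem_cons_of_mem _ (List.mem_map.2 ⟨a, ha, rfl⟩)),
        (hM' D (by simp)).mul hD', L', hcL, by simpa using hlen,
        fun a ha => hmem _ (List.mem_map.2 ⟨a, ha, rfl⟩), Y + h 0 • ((b ∘ π) ∘ π'),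
        Submodule.add_mem _ hY (Submodule.smul_mem _ _ (Submodule.subset_span hbL)), ?_⟩
      filter_upwards [hXY] with y hy
      simp only [Function.comp_apply, Pi.add_apply, Pi.smul_apply, smul_eq_mul] at hy ⊢
      rw [← hy]; ring
    · have hle' := hcmp.resolve_right hle
      obtain ⟨h, hh, hh0, hbX⟩ := exists_quotient hw hu hu0 hbw hXu hle'
      have hXb : Precedes (X ∘ π) (b ∘ π) := ⟨h, hh, hh0 fun h => hle h.le, hbX⟩
      refine Resolution.leaf _
        ⟨hMπ, hD.mul (normalCrossing_of_ne_zero analyticAt_const one_ne_zero),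
        L₁.map (· ∘ π) ++ X ∘ π :: (b :: L₂).map (· ∘ π), ?_, by simp; omega, ?_, X ∘ π,
        Submodule.subset_span (by simp), .rfl⟩
      · refine Chain.append (by simpa using hc) (hN X (by simp)) (by simp [hπ0, hX0]) ?_ ?_
        · intro a ha
          obtain ⟨a', ha', rfl⟩ := List.mem_map.1 ha
          exact (hpre a' ha').comp hπ hπ0
        · intro a ha
          obtain ⟨a', ha', rfl⟩ := List.mem_map.1 ha
          rcases List.mem_cons.1 ha' with rfl | ha'
          · exact hXb
          · exact hXb.trans ((hbL₂ a' ha').comp hπ hπ0)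
      · intro a ha
        have : a ∘ π ∈ (L₁ ++ b :: L₂).map (· ∘ π) := List.mem_map.2 ⟨a, ha, rfl⟩
        rw [List.map_append, List.mem_append] at this
        simp only [List.mem_append, List.mem_cons]
        exact this.imp id Or.inr

/-- Along a suitable resolution, `f` and the increments of finitely many analytic functions lie in
the span of a short chain. -/
theorem exists_chain {f : (Fin n → ℝ) → ℝ} (hf : AnalyticAt ℝ f 0) (hf0 : f 0 = 0)
    (hfz : ¬ f =ᶠ[𝓝 0] 0) (Xs : List ((Fin n → ℝ) → ℝ)) (hX : ∀ X ∈ Xs, AnalyticAt ℝ X 0) :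
    Resolution (fun π D => NormalCrossing D ∧ ∃ L, Chain L ∧ L.length ≤ Xs.length + 1 ∧
      f ∘ π ∈ L ∧ ∀ X ∈ Xs, ∃ Y ∈ Submodule.span ℝ {a | a ∈ L},
        X ∘ π =ᶠ[𝓝 0] fun y => X 0 + Y y) := by
  induction Xs with
  | nil =>
    refine (resolution_list [f] (by simpa using ⟨hf, hfz⟩)).mono ?_
    rintro π D hπ hπ0 ⟨hN, hD⟩
    exact ⟨hD, [f ∘ π], ⟨by simp, by simpa [hπ0, hf0] using hN⟩, by simp, by simp, by simp⟩
  | cons X Xs ih =>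
    refine (ih fun Y hY => hX Y (List.mem_cons_of_mem _ hY)).bind ?_
    rintro π D hπ hπ0 ⟨hD, L, hL, hlen, hfL, hXs⟩
    have hXa : AnalyticAt ℝ (X ∘ π) 0 := AnalyticAt.comp (by rw [hπ0]; exact hX X (by simp)) hπ
    refine (resolution_extends L.length [D] L rfl [] (fun y => (X ∘ π) y - X 0) hL
      (hXa.sub analyticAt_const) (by simp [hπ0]) (by simp) (by simpa using hD)).mono ?_
    rintro π' D' hπ' hπ'0 ⟨hM', hD', L', hcL, hlen', hmem, Y, hY, hXY⟩
    refine ⟨(hM' D (by simp)).mul hD', L', hcL, hlen'.trans (by simpa using hlen),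
      hmem _ hfL, ?_⟩
    intro Z hZ
    rcases List.mem_cons.1 hZ with rfl | hZ
    · refine ⟨Y, hY, ?_⟩
      filter_upwards [hXY] with y hy
      rw [← hy]; simp
    · obtain ⟨W, hW, hZW⟩ := hXs Z hZ
      refine ⟨W ∘ π', ?_, comp_congr hZW hπ'.continuousAt hπ'0⟩
      have : W ∘ π' ∈ (Submodule.span ℝ {a | a ∈ L}).map (LinearMap.funLeft ℝ ℝ π') :=
        Submodule.mem_map_of_mem hW
      rw [Submodule.map_span] at this
      refine Submodule.span_mono ?_ this
      rintro _ ⟨a, ha, rfl⟩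
      exact hmem a ha

end chain

section vanDerCorput

/-- A function with derivative at least `ν` is small only near one point. -/
theorem exists_split_of_pos {h h' : ℝ → ℝ} {p q ν : ℝ} (hpq : p ≤ q)
    (hd : ∀ t ∈ Set.Icc p q, HasDerivAt h (h' t) t) (hh' : ∀ t ∈ Set.Icc p q, ν ≤ h' t) :
    ∃ m ∈ Set.Icc p q, (∀ t ∈ Set.Ioc m q, ν * (t - m) ≤ h t) ∧
      ∀ t ∈ Set.Ico p m, h t ≤ -(ν * (m - t)) := by
  have hc : ContinuousOn h (Set.Icc p q) := fun t ht => (hd t ht).continuousAt.continuousWithinAt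
  have hmvt : ∀ x ∈ Set.Icc p q, ∀ y ∈ Set.Icc p q, x ≤ y → ν * (y - x) ≤ h y - h x := by
    refine (convex_Icc p q).mul_sub_le_image_sub_of_le_deriv hc
      (fun t ht => (hd t (interior_subset ht)).differentiableAt.differentiableWithinAt) ?_
    intro t ht
    rw [(hd t (interior_subset ht)).deriv]
    exact hh' t (interior_subset ht)
  have hp : p ∈ Set.Icc p q := ⟨le_rfl, hpq⟩
  have hq : q ∈ Set.Icc p q := ⟨hpq, le_rfl⟩
  have key : ∃ m ∈ Set.Icc p q, (m < q → 0 ≤ h m) ∧ (p < m → h m ≤ 0) := by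
    by_cases h1 : 0 ≤ h p
    · exact ⟨p, hp, fun _ => h1, fun h => absurd h (lt_irrefl _)⟩
    by_cases h2 : h q ≤ 0
    · exact ⟨q, hq, fun h => absurd h (lt_irrefl _), fun _ => h2⟩
    obtain ⟨m, hm, hm0⟩ := intermediate_value_Icc hpq hc
      (show (0 : ℝ) ∈ Set.Icc (h p) (h q) from ⟨by linarith, by linarith⟩)
    exact ⟨m, hm, fun _ => hm0.ge, fun _ => hm0.le⟩
  obtain ⟨m, hm, h1, h2⟩ := key
  refine ⟨m, hm, fun t ht => ?_, fun t ht => ?_⟩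
  · have := hmvt m hm t ⟨hm.1.trans ht.1.le, ht.2⟩ ht.1.le
    linarith [h1 (ht.1.trans_le ht.2)]
  · have := hmvt t ⟨ht.1, ht.2.le.trans hm.2⟩ m hm ht.2.le
    linarith [h2 (ht.1.trans_lt ht.2)]

theorem sign_of_abs_ge {h : ℝ → ℝ} {p q ν : ℝ} (hν : 0 < ν)
    (hc : ContinuousOn h (Set.Icc p q)) (hh : ∀ t ∈ Set.Icc p q, ν ≤ |h t|) :
    (∀ t ∈ Set.Icc p q, ν ≤ h t) ∨ ∀ t ∈ Set.Icc p q, h t ≤ -ν := by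
  by_contra! hcon
  obtain ⟨⟨x, hx, hx1⟩, y, hy, hy1⟩ := hcon
  have hx2 : h x ≤ -ν := by
    rcases le_abs'.1 (hh x hx) with h | h <;> linarith
  have hy2 : ν ≤ h y := by
    rcases le_abs'.1 (hh y hy) with h | h <;> linarith
  obtain ⟨z, hz, hz0⟩ := isPreconnected_Icc.intermediate_value hx hy hc
    (show (0 : ℝ) ∈ Set.Icc (h x) (h y) from ⟨by linarith, by linarith⟩)
  have := hh z hz
  rw [hz0, abs_zero] at this
  linarith

theorem exists_split {h h' : ℝ → ℝ} {p q ν : ℝ} (hν : 0 < ν) (hpq : p ≤ q)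
    (hd : ∀ t ∈ Set.Icc p q, HasDerivAt h (h' t) t) (hc' : ContinuousOn h' (Set.Icc p q))
    (hh' : ∀ t ∈ Set.Icc p q, ν ≤ |h' t|) :
    ∃ m ∈ Set.Icc p q, (∀ t ∈ Set.Ioc m q, ν * (t - m) ≤ |h t|) ∧
      ∀ t ∈ Set.Ico p m, ν * (m - t) ≤ |h t| := by
  rcases sign_of_abs_ge hν hc' hh' with hs | hs
  · obtain ⟨m, hm, h1, h2⟩ := exists_split_of_pos hpq hd hs
    exact ⟨m, hm, fun t ht => (h1 t ht).trans (le_abs_self _),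
      fun t ht => (le_neg_of_le_neg (h2 t ht)).trans (neg_le_abs _)⟩
  · obtain ⟨m, hm, h1, h2⟩ := exists_split_of_pos (h := fun t => - h t) hpq
      (fun t ht => (hd t ht).neg) fun t ht => le_neg_of_le_neg (hs t ht)
    exact ⟨m, hm, fun t ht => (h1 t ht).trans (neg_le_abs _),
      fun t ht => (le_neg_of_le_neg (h2 t ht)).trans (by rw [neg_neg]; exact le_abs_self _)⟩

/-- One step of the van der Corput induction, for a subadditive interval function. -/
theorem interval_step {Λ : ℝ → ℝ → ℝ} {h h' : ℝ → ℝ} {p q ν δ b : ℝ} (hν : 0 < ν) (hδ : 0 < δ)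
    (hpq : p ≤ q) (hadd : ∀ x y z, p ≤ x → x ≤ y → y ≤ z → z ≤ q → Λ x z ≤ Λ x y + Λ y z)
    (hlen : ∀ x y, p ≤ x → x ≤ y → y ≤ q → Λ x y ≤ y - x)
    (hd : ∀ t ∈ Set.Icc p q, HasDerivAt h (h' t) t) (hc' : ContinuousOn h' (Set.Icc p q))
    (hh' : ∀ t ∈ Set.Icc p q, ν ≤ |h' t|) (hb : 0 ≤ b)
    (hΛ : ∀ x y, p ≤ x → x ≤ y → y ≤ q → (∀ t ∈ Set.Icc x y, ν * δ ≤ |h t|) → Λ x y ≤ b) :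
    Λ p q ≤ 2 * δ + 2 * b := by
  obtain ⟨m, hm, h1, h2⟩ := exists_split hν hpq hd hc' hh'
  have hleft : Λ p m ≤ δ + b := by
    by_cases hx : m - δ < p
    · have := hlen p m le_rfl hm.1 hm.2; linarith
    · push Not at hx
      have e1 := hΛ p (m - δ) le_rfl hx (by linarith [hm.2]) fun t ht =>
        le_trans (by nlinarith [ht.2]) (h2 t ⟨ht.1, by linarith [ht.2]⟩)
      have e2 := hlen (m - δ) m hx (by linarith) hm.2
      have e3 := hadd p (m - δ) m le_rfl hx (by linarith) hm.2
      linarith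
  have hright : Λ m q ≤ δ + b := by
    by_cases hx : q < m + δ
    · have := hlen m q hm.1 hm.2 le_rfl; linarith
    · push Not at hx
      have e1 := hΛ (m + δ) q (by linarith [hm.1]) hx le_rfl fun t ht =>
        le_trans (by nlinarith [ht.1]) (h1 t ⟨by linarith [ht.1], ht.2⟩)
      have e2 := hlen m (m + δ) hm.1 (by linarith) hx
      have e3 := hadd m (m + δ) q hm.1 (by linarith) hx le_rfl
      linarith
  linarith [hadd p m q le_rfl hm.1 hm.2 le_rfl]

/-- The van der Corput induction, for a subadditive interval function. -/
theorem interval_induction {Λ : ℝ → ℝ → ℝ} {φ : ℕ → ℝ → ℝ} {δ b : ℝ} (hδ : 0 < δ) (hb : 0 ≤ b)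
    (j : ℕ) : ∀ (p q ν : ℝ), 0 < ν → p ≤ q →
    (∀ x y z, p ≤ x → x ≤ y → y ≤ z → z ≤ q → Λ x z ≤ Λ x y + Λ y z) →
    (∀ x y, p ≤ x → x ≤ y → y ≤ q → Λ x y ≤ y - x) →
    (∀ i, ∀ t ∈ Set.Icc p q, HasDerivAt (φ i) (φ (i + 1) t) t) →
    (∀ t ∈ Set.Icc p q, ν ≤ |φ (j + 2) t|) →
    (∀ x y, p ≤ x → x ≤ y → y ≤ q → (∀ t ∈ Set.Icc x y, ν * δ ^ (j + 1) ≤ |φ 1 t|) →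
      (∀ t ∈ Set.Icc x y, ν * δ ^ j ≤ |φ 2 t|) → Λ x y ≤ b) →
    Λ p q ≤ 4 ^ (j + 1) * (δ + b) := by
  induction j with
  | zero =>
    intro p q ν hν hpq hadd hlen hd hh hΛ
    have := interval_step hν hδ hpq hadd hlen (hd 1)
      (fun t ht => (hd 2 t ht).continuousAt.continuousWithinAt) hh hb
      (fun x y hx hxy hy ht => hΛ x y hx hxy hy (by simpa using ht)
        fun t ht' => by simpa using hh t ⟨hx.trans ht'.1, ht'.2.trans hy⟩)
    simp only [zero_add, pow_one]
    linarith
  | succ j ih =>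
    intro p q ν hν hpq hadd hlen hd hh hΛ
    have hb' : 0 ≤ 4 ^ (j + 1) * (δ + b) := by positivity
    have h4 : (1 : ℝ) ≤ 4 ^ (j + 1) := one_le_pow₀ (by norm_num)
    have := interval_step hν hδ hpq hadd hlen (hd (j + 2))
      (fun t ht => (hd (j + 3) t ht).continuousAt.continuousWithinAt) hh hb'
      (fun x y hx hxy hy ht => ih x y (ν * δ) (by positivity) hxy
        (fun x' y' z' h1 h2 h3 h4 => hadd x' y' z' (hx.trans h1) h2 h3 (h4.trans hy))
        (fun x' y' h1 h2 h3 => hlen x' y' (hx.trans h1) h2 (h3.trans hy))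
        (fun i t ht => hd i t ⟨hx.trans ht.1, ht.2.trans hy⟩) ht
        fun x' y' h1 h2 h3 h4 h5 => hΛ x' y' (hx.trans h1) h2 (h3.trans hy)
          (fun t ht => by rw [pow_succ' δ (j + 1), ← mul_assoc]; exact h4 t ht)
          (fun t ht => by rw [pow_succ' δ j, ← mul_assoc]; exact h5 t ht))
    rw [pow_succ]
    nlinarith

theorem norm_integral_le_of_le_abs_deriv {φ : ℕ → ℝ → ℝ} {B B' : ℝ → ℝ} {p q ν : ℝ} (hν : 0 < ν)
    (hpq : p ≤ q) (hpq1 : q - p ≤ 1)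
    (hd : ∀ i, ∀ t ∈ Set.Icc p q, HasDerivAt (φ i) (φ (i + 1) t) t)
    (hB : ∀ t ∈ Set.Icc p q, HasDerivAt B (B' t) t) (hBc : ContinuousOn B' (Set.Icc p q))
    (hB1 : ∀ t ∈ Set.Icc p q, |B t| ≤ 1) (hB2 : ∀ t ∈ Set.Icc p q, |B' t| ≤ 1)
    (hφ : ∀ t ∈ Set.Icc p q, ν ≤ |φ 1 t|) :
    ‖∫ t in p..q, (B t : ℂ) * cexp (I * φ 0 t)‖ ≤ 3 / ν + ∫ t in p..q, |φ 2 t| / φ 1 t ^ 2 := by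
  have hφc : ∀ i, ContinuousOn (φ i) (Set.Icc p q) := fun i t ht =>
    (hd i t ht).continuousAt.continuousWithinAt
  have hBcont : ContinuousOn B (Set.Icc p q) := fun t ht =>
    (hB t ht).continuousAt.continuousWithinAt
  have h0 : ∀ t ∈ Set.Icc p q, φ 1 t ≠ 0 := fun t ht h => by
    have := hφ t ht
    rw [h, abs_zero] at this; linarith
  set G' : ℝ → ℝ := fun t => (B' t * φ 1 t - B t * φ 2 t) / φ 1 t ^ 2 with hG'
  have hG : ∀ t ∈ Set.Icc p q, HasDerivAt (fun t => B t / φ 1 t) (G' t) t := fun t ht =>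
    (hB t ht).div (hd 1 t ht) (h0 t ht)
  have hG'c : ContinuousOn G' (Set.Icc p q) :=
    ((hBc.mul (hφc 1)).sub (hBcont.mul (hφc 2))).div ((hφc 1).pow 2) fun t ht =>
      pow_ne_zero 2 (h0 t ht)
  have hE : ∀ t ∈ Set.Icc p q, HasDerivAt (fun t => -I * cexp (I * φ 0 t))
      ((φ 1 t : ℂ) * cexp (I * φ 0 t)) t := by
    intro t ht
    have := (((hd 0 t ht).ofReal_comp.const_mul I).cexp).const_mul (-I)
    refine this.congr_deriv ?_
    linear_combination (-(φ 1 t : ℂ) * cexp (I * φ 0 t)) * I_mul_I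
  have hEc : ContinuousOn (fun t => cexp (I * φ 0 t)) (Set.Icc p q) := by
    have := hφc 0
    fun_prop
  rw [← Set.uIcc_of_le hpq] at hG hE hG'c hEc h0 hφc
  have hnorm : ∀ t, ‖cexp (I * φ 0 t)‖ = 1 := fun t => by
    rw [mul_comm]; exact norm_exp_ofReal_mul_I _
  have hibp := intervalIntegral.integral_mul_deriv_eq_deriv_mul
    (u := fun t => ((B t / φ 1 t : ℝ) : ℂ)) (u' := fun t => (G' t : ℂ))
    (v := fun t => -I * cexp (I * φ 0 t)) (v' := fun t => (φ 1 t : ℂ) * cexp (I * φ 0 t))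
    (fun t ht => (hG t ht).ofReal_comp) hE
    (Complex.continuous_ofReal.comp_continuousOn hG'c).intervalIntegrable
    ((Complex.continuous_ofReal.comp_continuousOn (hφc 1)).mul hEc).intervalIntegrable
  have hint : ∫ t in p..q, (B t : ℂ) * cexp (I * φ 0 t) =
      ∫ t in p..q, ((B t / φ 1 t : ℝ) : ℂ) * ((φ 1 t : ℂ) * cexp (I * φ 0 t)) := by
    refine intervalIntegral.integral_congr fun t ht => ?_
    have : (φ 1 t : ℂ) ≠ 0 := by exact_mod_cast h0 t ht
    push_cast
    field_simp
  have hend : ∀ t ∈ Set.Icc p q, ‖((B t / φ 1 t : ℝ) : ℂ) * (-I * cexp (I * φ 0 t))‖ ≤ 1 / ν := by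
    intro t ht
    rw [norm_mul, norm_mul, hnorm, norm_neg, norm_I, mul_one, mul_one, norm_real, Real.norm_eq_abs,
      abs_div]
    exact div_le_div₀ zero_le_one (hB1 t ht) hν (hφ t ht)
  have hrest : ‖∫ t in p..q, (G' t : ℂ) * (-I * cexp (I * φ 0 t))‖ ≤
      ∫ t in p..q, (1 / ν + |φ 2 t| / φ 1 t ^ 2) := by
    refine intervalIntegral.norm_integral_le_of_norm_le hpq (ae_of_all _ fun t ht => ?_) ?_
    · have ht' : t ∈ Set.Icc p q := ⟨ht.1.le, ht.2⟩
      have h1 : φ 1 t ≠ 0 := h0 t (by rwa [Set.uIcc_of_le hpq])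
      rw [norm_mul, norm_mul, hnorm, norm_neg, norm_I, mul_one, mul_one, norm_real,
        Real.norm_eq_abs]
      have : G' t = B' t / φ 1 t - B t * (φ 2 t / φ 1 t ^ 2) := by
        simp only [hG']; field_simp
      rw [this]
      refine (abs_sub _ _).trans (add_le_add ?_ ?_)
      · rw [abs_div]; exact div_le_div₀ zero_le_one (hB2 t ht') hν (hφ t ht')
      · rw [abs_mul, abs_div, abs_of_nonneg (sq_nonneg (φ 1 t))]
        exact mul_le_of_le_one_left (by positivity) (hB1 t ht')
    · refine (ContinuousOn.add continuousOn_const ((hφc 2).abs.div ((hφc 1).pow 2)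
        fun t ht => pow_ne_zero 2 (h0 t ht))).intervalIntegrable
  rw [hint, hibp]
  refine (norm_sub_le _ _).trans ?_
  have h1 := norm_sub_le (((B q / φ 1 q : ℝ) : ℂ) * (-I * cexp (I * φ 0 q)))
    (((B p / φ 1 p : ℝ) : ℂ) * (-I * cexp (I * φ 0 p)))
  have h2 := hend q ⟨hpq, le_rfl⟩
  have h3 := hend p ⟨le_rfl, hpq⟩
  have h6 : IntervalIntegrable (fun t => |φ 2 t| / φ 1 t ^ 2) volume p q :=
    ((hφc 2).abs.div ((hφc 1).pow 2) fun t ht => pow_ne_zero 2 (h0 t ht)).intervalIntegrable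
  rw [intervalIntegral.integral_add intervalIntegrable_const h6,
    intervalIntegral.integral_const, smul_eq_mul] at hrest
  have h4 : (q - p) * (1 / ν) ≤ 1 / ν := mul_le_of_le_one_left (by positivity) hpq1
  have h5 : 3 / ν = 1 / ν + 1 / ν + 1 / ν := by ring
  linarith

theorem integral_abs_div_sq_le {g g' : ℝ → ℝ} {p q ν μ : ℝ} (hν : 0 < ν) (hμ : 0 < μ) (hpq : p ≤ q)
    (hd : ∀ t ∈ Set.Icc p q, HasDerivAt g (g' t) t) (hc : ContinuousOn g' (Set.Icc p q))
    (hg : ∀ t ∈ Set.Icc p q, ν ≤ |g t|) (hg' : ∀ t ∈ Set.Icc p q, μ ≤ |g' t|) :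
    ∫ t in p..q, |g' t| / g t ^ 2 ≤ 2 / ν := by
  have h0 : ∀ t ∈ Set.Icc p q, g t ≠ 0 := fun t ht h => by
    have := hg t ht
    rw [h, abs_zero] at this; linarith
  have hgc : ContinuousOn g (Set.Icc p q) := fun t ht => (hd t ht).continuousAt.continuousWithinAt
  have hinv : ∀ t ∈ Set.Icc p q, |(g t)⁻¹| ≤ 1 / ν := fun t ht => by
    rw [abs_inv, ← one_div]; exact one_div_le_one_div_of_le hν (hg t ht)
  have hftc : ∫ t in p..q, -g' t / g t ^ 2 = (g q)⁻¹ - (g p)⁻¹ := by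
    refine intervalIntegral.integral_eq_sub_of_hasDerivAt (f := fun t => (g t)⁻¹)
      (fun t ht => ?_) ?_
    · rw [Set.uIcc_of_le hpq] at ht
      exact (hd t ht).fun_inv (h0 t ht)
    · refine ContinuousOn.intervalIntegrable ?_
      rw [Set.uIcc_of_le hpq]
      exact hc.neg.div (hgc.pow 2) fun t ht => pow_ne_zero 2 (h0 t ht)
  have hq := abs_le.1 (hinv q ⟨hpq, le_rfl⟩)
  have hp := abs_le.1 (hinv p ⟨le_rfl, hpq⟩)
  have h2 : 2 / ν = 1 / ν + 1 / ν := by ring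
  rcases sign_of_abs_ge hμ hc hg' with hs | hs
  · have : ∫ t in p..q, |g' t| / g t ^ 2 = -∫ t in p..q, -g' t / g t ^ 2 := by
      rw [← intervalIntegral.integral_neg]
      refine intervalIntegral.integral_congr fun t ht => ?_
      rw [Set.uIcc_of_le hpq] at ht
      rw [abs_of_nonneg (hμ.le.trans (hs t ht))]; ring
    rw [this, hftc]; linarith [hq.1, hp.2]
  · have : ∫ t in p..q, |g' t| / g t ^ 2 = ∫ t in p..q, -g' t / g t ^ 2 := by
      refine intervalIntegral.integral_congr fun t ht => ?_
      rw [Set.uIcc_of_le hpq] at ht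
      rw [abs_of_nonpos (by linarith [hs t ht])]
    rw [this, hftc]; linarith [hq.2, hp.1]

/-- A van der Corput estimate, uniform over all phases at least one of whose first `R` derivatives
is large at each point. -/
theorem van_der_corput {R : ℕ} (hR : 1 ≤ R) {c C : ℝ} (hc : 0 < c) (hC : 0 ≤ C) :
    ∃ K, 0 ≤ K ∧ ∀ (φ : ℕ → ℝ → ℝ) (B B' : ℝ → ℝ) (l : ℝ), 1 ≤ l →
      (∀ i, ∀ t ∈ Set.Icc (0 : ℝ) 1, HasDerivAt (φ i) (φ (i + 1) t) t) →
      (∀ t ∈ Set.Icc (0 : ℝ) 1, HasDerivAt B (B' t) t) → ContinuousOn B' (Set.Icc 0 1) →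
      (∀ t ∈ Set.Icc (0 : ℝ) 1, |B t| ≤ 1) → (∀ t ∈ Set.Icc (0 : ℝ) 1, |B' t| ≤ 1) →
      (∀ i ≤ R, ∀ t ∈ Set.Icc (0 : ℝ) 1, |φ (i + 1) t| ≤ C * l) →
      (∀ t ∈ Set.Icc (0 : ℝ) 1, ∃ i < R, c * l ≤ |φ (i + 1) t|) →
      ‖∫ t in (0 : ℝ)..1, (B t : ℂ) * cexp (I * φ 0 t)‖ ≤ K * l ^ (-(1 / R : ℝ)) := by
  obtain ⟨M, hM⟩ := exists_nat_gt (2 * C / c)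
  have hM0 : (0 : ℝ) < M := lt_of_le_of_lt (by positivity) hM
  set K₀ : ℝ := 4 ^ R * (1 + 10 / c) + (6 / c + 4 * C / c ^ 2) with hK₀
  refine ⟨M * K₀, by positivity, ?_⟩
  intro φ B B' l hl hd hB hBc hB1 hB2 hup hlow
  have hl0 : 0 < l := by linarith
  have hR0 : (R : ℝ) ≠ 0 := by positivity
  set δ : ℝ := l ^ (-(1 / R : ℝ)) with hδ
  have hδ0 : 0 < δ := Real.rpow_pos_of_pos hl0 _
  have hδ1 : δ ≤ 1 := Real.rpow_le_one_of_one_le_of_nonpos hl (by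
    rw [neg_nonpos]; positivity)
  have hδR : δ ^ R * l = 1 := by
    rw [hδ, ← Real.rpow_natCast, ← Real.rpow_mul hl0.le, neg_mul, one_div, inv_mul_cancel₀ hR0,
      Real.rpow_neg_one, inv_mul_cancel₀ hl0.ne']
  have hφc : ∀ i, ContinuousOn (φ i) (Set.Icc 0 1) := fun i t ht =>
    (hd i t ht).continuousAt.continuousWithinAt
  have hBcont : ContinuousOn B (Set.Icc 0 1) := fun t ht =>
    (hB t ht).continuousAt.continuousWithinAt
  have hcont : ContinuousOn (fun t => (B t : ℂ) * cexp (I * φ 0 t)) (Set.Icc 0 1) := by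
    have := hφc 0
    fun_prop
  have hii : ∀ x y, 0 ≤ x → x ≤ y → y ≤ 1 →
      IntervalIntegrable (fun t => (B t : ℂ) * cexp (I * φ 0 t)) volume x y := by
    intro x y hx hxy hy
    refine (hcont.mono ?_).intervalIntegrable
    rw [Set.uIcc_of_le hxy]
    exact Set.Icc_subset_Icc hx hy
  set Λ : ℝ → ℝ → ℝ := fun x y => ‖∫ t in x..y, (B t : ℂ) * cexp (I * φ 0 t)‖ with hΛ
  have hadd : ∀ x y z, 0 ≤ x → x ≤ y → y ≤ z → z ≤ 1 → Λ x z ≤ Λ x y + Λ y z := by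
    intro x y z hx hxy hyz hz
    simp only [hΛ]
    rw [← intervalIntegral.integral_add_adjacent_intervals (hii x y hx hxy (hyz.trans hz))
      (hii y z (hx.trans hxy) hyz hz)]
    exact norm_add_le _ _
  have hlen : ∀ x y, 0 ≤ x → x ≤ y → y ≤ 1 → Λ x y ≤ y - x := by
    intro x y hx hxy hy
    have := intervalIntegral.norm_integral_le_of_norm_le_const (a := x) (b := y) (C := 1)
      (f := fun t => (B t : ℂ) * cexp (I * φ 0 t)) (fun t ht => by
        rw [Set.uIoc_of_le hxy] at ht
        rw [norm_mul, mul_comm I, norm_exp_ofReal_mul_I, mul_one, norm_real]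
        exact hB1 t ⟨hx.trans ht.1.le, ht.2.trans hy⟩)
    rwa [one_mul, abs_of_nonneg (by linarith)] at this
  have hibp : ∀ x y ν, 0 < ν → 0 ≤ x → x ≤ y → y ≤ 1 → (∀ t ∈ Set.Icc x y, ν ≤ |φ 1 t|) →
      Λ x y ≤ 3 / ν + ∫ t in x..y, |φ 2 t| / φ 1 t ^ 2 := by
    intro x y ν hν hx hxy hy hφ
    have hs : Set.Icc x y ⊆ Set.Icc 0 1 := Set.Icc_subset_Icc hx hy
    exact norm_integral_le_of_le_abs_deriv hν hxy (by linarith) (fun i t ht => hd i t (hs ht))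
      (fun t ht => hB t (hs ht)) (hBc.mono hs) (fun t ht => hB1 t (hs ht))
      (fun t ht => hB2 t (hs ht)) hφ
  have hpiece : ∀ p q : ℝ, 0 ≤ p → p ≤ q → q ≤ 1 → q - p ≤ 1 / M → Λ p q ≤ K₀ * δ := by
    intro p q hp hpq hq hpqM
    have hs : Set.Icc p q ⊆ Set.Icc 0 1 := Set.Icc_subset_Icc hp hq
    obtain ⟨j, hj, hjp⟩ := hlow p ⟨hp, hpq.trans hq⟩
    set ν := c * l / 2 with hν
    have hν0 : 0 < ν := by positivity
    have hbig : ∀ t ∈ Set.Icc p q, ν ≤ |φ (j + 1) t| := by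
      intro t ht
      have h1 := Convex.norm_image_sub_le_of_norm_hasDerivWithin_le (f := φ (j + 1))
        (f' := φ (j + 2)) (C := C * l) (fun x hx => (hd (j + 1) x (hs hx)).hasDerivWithinAt)
        (fun x hx => hup (j + 1) hj x (hs hx)) (convex_Icc p q) ⟨le_rfl, hpq⟩ ht
      rw [Real.norm_eq_abs, Real.norm_eq_abs, abs_of_nonneg (by linarith [ht.1] : 0 ≤ t - p)] at h1
      have h2 : C * l * (t - p) ≤ ν := by
        have h3 : t - p ≤ 1 / M := by linarith [ht.2]
        have h4 : C * (1 / M) ≤ c / 2 := by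
          rw [mul_one_div, div_le_iff₀ hM0]
          rw [div_lt_iff₀ hc] at hM
          linarith
        calc C * l * (t - p) ≤ C * l * (1 / M) := by gcongr
          _ = (C * (1 / M)) * l := by ring
          _ ≤ c / 2 * l := by gcongr
          _ = ν := by rw [hν]; ring
      have h5 := abs_sub_abs_le_abs_sub (φ (j + 1) p) (φ (j + 1) t)
      rw [abs_sub_comm] at h5
      have : c * l = ν + ν := by rw [hν]; ring
      linarith
    have hinv : 1 / l = δ ^ R := by
      rw [eq_comm, eq_div_iff hl0.ne', hδR]
    have hpow : ∀ k, k + 1 ≤ R → δ ^ R ≤ δ ^ (k + 1) := fun k hk =>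
      pow_le_pow_of_le_one hδ0.le hδ1 hk
    have hA : 0 ≤ 4 ^ R * (1 + 10 / c) := by positivity
    have hA' : 0 ≤ 6 / c + 4 * C / c ^ 2 := by positivity
    rcases j with _ | i
    · have h1 := hibp p q ν hν0 hp hpq hq hbig
      have h2 : ∫ t in p..q, |φ 2 t| / φ 1 t ^ 2 ≤ C * l / ν ^ 2 := by
        have h3 := intervalIntegral.norm_integral_le_of_norm_le_const (a := p) (b := q)
          (C := C * l / ν ^ 2) (f := fun t => |φ 2 t| / φ 1 t ^ 2) (fun t ht => by
            rw [Set.uIoc_of_le hpq] at ht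
            have ht' : t ∈ Set.Icc p q := ⟨ht.1.le, ht.2⟩
            rw [norm_div, norm_pow, Real.norm_eq_abs, Real.norm_eq_abs, abs_abs]
            exact div_le_div₀ (by positivity) (hup 1 hR t (hs ht')) (by positivity)
              (pow_le_pow_left₀ hν0.le (hbig t ht') 2))
        refine (le_abs_self _).trans (h3.trans (mul_le_of_le_one_right (by positivity) ?_))
        rw [abs_of_nonneg] <;> linarith
      have h4 : 3 / ν + C * l / ν ^ 2 = (6 / c + 4 * C / c ^ 2) * (1 / l) := by
        rw [hν]; field_simp; ring
      rw [hinv] at h4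
      have h5 : δ ^ R ≤ δ := by simpa using hpow 0 hR
      have h6 := mul_le_mul_of_nonneg_left h5 hA'
      rw [hK₀, add_mul]
      have := mul_nonneg hA hδ0.le
      linarith
    · set b := 5 / (ν * δ ^ (i + 1)) with hb
      have hb0 : 0 ≤ b := by positivity
      have h1 := interval_induction (Λ := Λ) hδ0 hb0 i p q ν hν0 hpq
        (fun x y z h1 h2 h3 h4 => hadd x y z (hp.trans h1) h2 h3 (h4.trans hq))
        (fun x y h1 h2 h3 => hlen x y (hp.trans h1) h2 (h3.trans hq))
        (fun i t ht => hd i t (hs ht)) hbig (by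
          intro x y hx hxy hy h1 h2
          have hs' : Set.Icc x y ⊆ Set.Icc 0 1 := Set.Icc_subset_Icc (hp.trans hx) (hy.trans hq)
          have e1 := hibp x y (ν * δ ^ (i + 1)) (by positivity) (hp.trans hx) hxy (hy.trans hq) h1
          have e2 := integral_abs_div_sq_le (by positivity) (by positivity) hxy
            (fun t ht => hd 1 t (hs' ht)) ((hφc 2).mono hs') h1 h2
          have e3 : b = 3 / (ν * δ ^ (i + 1)) + 2 / (ν * δ ^ (i + 1)) := by rw [hb]; ring
          rw [e3]; linarith)
      have h2 : b ≤ 10 / c * δ := by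
        have : b = 10 / c * ((1 / l) / δ ^ (i + 1)) := by rw [hb, hν]; field_simp; norm_num
        rw [this, hinv]
        have h3 : δ ^ R / δ ^ (i + 1) ≤ δ := by
          rw [div_le_iff₀ (by positivity), ← pow_succ']
          exact hpow (i + 1) hj
        gcongr
      have h3 : (4 : ℝ) ^ (i + 1) ≤ 4 ^ R := pow_le_pow_right₀ (by norm_num) hj.le
      have h4 : (4 : ℝ) ^ (i + 1) * (δ + b) ≤ 4 ^ R * (1 + 10 / c) * δ := by
        calc (4 : ℝ) ^ (i + 1) * (δ + b) ≤ 4 ^ R * (δ + 10 / c * δ) := by gcongr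
          _ = _ := by ring
      rw [hK₀, add_mul]
      have := mul_nonneg hA' hδ0.le
      linarith
  have hsum := intervalIntegral.sum_integral_adjacent_intervals (μ := volume)
    (f := fun t => (B t : ℂ) * cexp (I * φ 0 t)) (a := fun k : ℕ => (k : ℝ) / M) (n := M)
    (fun k hk => hii _ _ (by positivity) (by gcongr; simp)
      (by rw [div_le_one hM0]; exact_mod_cast hk))
  simp only [Nat.cast_zero, zero_div, div_self hM0.ne'] at hsum
  rw [← hsum]
  refine (norm_sum_le _ _).trans ((Finset.sum_le_card_nsmul _ _ (K₀ * δ) ?_).trans ?_)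
  · intro k hk
    refine hpiece _ _ (by positivity) (by gcongr; simp) ?_ ?_
    · rw [div_le_one hM0]; exact_mod_cast Finset.mem_range.1 hk
    · push_cast; rw [add_div]; linarith
  · rw [Finset.card_range, nsmul_eq_mul, mul_assoc]

end vanDerCorput

section dilation
variable {n : ℕ}

/-- The functions arising as successive `τ`-derivatives of `exp (β τ) * u (exp τ • y)`. -/
noncomputable def eulerTower (β : ℝ) (u : (Fin n → ℝ) → ℝ) : ℕ → (Fin n → ℝ) → ℝ
  | 0 => u
  | j + 1 => fun y => β * eulerTower β u j y + fderiv ℝ (eulerTower β u j) y y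

theorem analyticOnNhd_eulerTower {u : (Fin n → ℝ) → ℝ} {s : Set (Fin n → ℝ)}
    (hu : AnalyticOnNhd ℝ u s) (β : ℝ) (j : ℕ) : AnalyticOnNhd ℝ (eulerTower β u j) s := by
  induction j with
  | zero => exact hu
  | succ j ih =>
    intro y hy
    exact (analyticAt_const.mul (ih y hy)).add
      (((ContinuousLinearMap.id ℝ ((Fin n → ℝ) →L[ℝ] ℝ)).analyticAt_bilinear (_, y)).comp₂
        (ih.fderiv y hy) analyticAt_id)

theorem eulerTower_zero (β : ℝ) (u : (Fin n → ℝ) → ℝ) (j : ℕ) :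
    eulerTower β u j 0 = β ^ j * u 0 := by
  induction j with
  | zero => simp [eulerTower]
  | succ j ih => simp [eulerTower, ih, pow_succ']; ring

theorem hasDerivAt_exp_smul {w : (Fin n → ℝ) → ℝ} {y : Fin n → ℝ} {τ : ℝ} (β : ℝ)
    (hw : DifferentiableAt ℝ w (Real.exp τ • y)) :
    HasDerivAt (fun τ => Real.exp (β * τ) * w (Real.exp τ • y))
      (Real.exp (β * τ) * (β * w (Real.exp τ • y) +
        fderiv ℝ w (Real.exp τ • y) (Real.exp τ • y))) τ := by
  have h1 : HasDerivAt (fun τ : ℝ => Real.exp τ • y) (Real.exp τ • y) τ :=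
    (Real.hasDerivAt_exp τ).smul_const y
  have h2 := hw.hasFDerivAt.comp_hasDerivAt τ h1
  have h3 : HasDerivAt (fun τ : ℝ => Real.exp (β * τ)) (Real.exp (β * τ) * β) τ := by
    simpa using ((hasDerivAt_id τ).const_mul β).exp
  refine (h3.mul h2).congr_deriv ?_
  rw [Function.comp_apply]
  ring

theorem hasDerivAt_eulerTower {u : (Fin n → ℝ) → ℝ} {s : Set (Fin n → ℝ)}
    (hu : AnalyticOnNhd ℝ u s) (β : ℝ) (j : ℕ) {y : Fin n → ℝ} {τ : ℝ} (hy : Real.exp τ • y ∈ s) :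
    HasDerivAt (fun τ => Real.exp (β * τ) * eulerTower β u j (Real.exp τ • y))
      (Real.exp (β * τ) * eulerTower β u (j + 1) (Real.exp τ • y)) τ :=
  hasDerivAt_exp_smul β (analyticOnNhd_eulerTower hu β j _ hy).differentiableAt

/-- Lower bound for the derivatives of a combination of distinct exponentials. -/
theorem exists_vandermonde_bound {R : ℕ} (hR : 1 ≤ R) {β w : Fin R → ℝ}
    (hβ : Function.Injective β) (hβ0 : ∀ l, β l ≠ 0) (hw : ∀ l, w l ≠ 0) :
    ∃ c > 0, ∀ b : Fin R → ℝ, ∃ i < R, c * ‖b‖ ≤ |∑ l, b l * (β l ^ (i + 1) * w l)| := by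
  let A : (Fin R → ℝ) →ₗ[ℝ] (Fin R → ℝ) :=
    { toFun := fun b i => ∑ l, b l * (β l ^ ((i : ℕ) + 1) * w l)
      map_add' := fun b b' => by
        ext i; simp [add_mul, Finset.sum_add_distrib]
      map_smul' := fun r b => by
        ext i; simp [Finset.mul_sum, mul_assoc] }
  have hker : LinearMap.ker A = ⊥ := by
    refine LinearMap.ker_eq_bot'.2 fun b hb => ?_
    have h1 : (fun l => b l * (β l * w l)) = 0 := by
      refine Matrix.eq_zero_of_forall_pow_sum_mul_pow_eq_zero hβ fun i => ?_
      have := congrFun hb i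
      simp only [A, LinearMap.coe_mk, AddHom.coe_mk, Pi.zero_apply] at this
      rw [← this]
      exact Finset.sum_congr rfl fun l _ => by ring
    ext l
    have := congrFun h1 l
    simpa [hβ0 l, hw l] using this
  obtain ⟨K, hK, hA⟩ := A.exists_antilipschitzWith hker
  have hK0 : (0 : ℝ) < K := hK
  refine ⟨(K : ℝ)⁻¹ / 2, by positivity, fun b => ?_⟩
  by_cases hb : b = 0
  · exact ⟨0, hR, by simp [hb]⟩
  by_contra! hcon
  have hbpos : 0 < ‖b‖ := norm_pos_iff.2 hb
  have h1 : ‖A b‖ ≤ (K : ℝ)⁻¹ / 2 * ‖b‖ := by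
    refine (pi_norm_le_iff_of_nonneg (by positivity)).2 fun i => ?_
    exact (hcon i i.2).le
  have h2 := hA.le_mul_dist b 0
  rw [map_zero, dist_zero_right, dist_zero_right] at h2
  have h3 : (K : ℝ) * ‖A b‖ ≤ ‖b‖ / 2 := by
    calc (K : ℝ) * ‖A b‖ ≤ K * ((K : ℝ)⁻¹ / 2 * ‖b‖) := by gcongr
      _ = ‖b‖ / 2 := by field_simp
  linarith

theorem exp_le_three {τ : ℝ} (hτ : τ ≤ 1) : Real.exp τ ≤ 3 :=
  (Real.exp_le_exp.2 hτ).trans (by linarith [Real.exp_one_lt_d9])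

/-- Uniform decay of oscillatory integrals along dilation orbits. -/
theorem exists_dilation_estimate {R : ℕ} (hR : 1 ≤ R) {β : Fin R → ℝ}
    (hβ : Function.Injective β) (hβ0 : ∀ l, 0 < β l) {u : Fin R → (Fin n → ℝ) → ℝ}
    (hu : ∀ l, AnalyticAt ℝ (u l) 0) (hu0 : ∀ l, u l 0 ≠ 0) :
    ∃ ρ > 0, ∃ K, 0 ≤ K ∧ ∀ y : Fin n → ℝ, ‖y‖ < ρ → ∀ a : Fin R → ℝ, 1 ≤ ‖a‖ →
      ∀ B B' : ℝ → ℝ, (∀ t ∈ Set.Icc (0 : ℝ) 1, HasDerivAt B (B' t) t) →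
      ContinuousOn B' (Set.Icc 0 1) → (∀ t ∈ Set.Icc (0 : ℝ) 1, |B t| ≤ 1) →
      (∀ t ∈ Set.Icc (0 : ℝ) 1, |B' t| ≤ 1) →
      ‖∫ t in (0 : ℝ)..1, (B t : ℂ) * cexp (I * ((∑ l, a l *
        (Real.exp (β l * t) * u l (Real.exp t • y)) : ℝ) : ℂ))‖ ≤ K * ‖a‖ ^ (-(1 / R : ℝ)) := by
  obtain ⟨c, hc, hvan⟩ := exists_vandermonde_bound hR hβ (fun l => (hβ0 l).ne') hu0
  have hR0 : (0 : ℝ) < R := by exact_mod_cast hR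
  set ε := c / (2 * R) with hε
  have hε0 : 0 < ε := by positivity
  obtain ⟨r, hr, hball⟩ : ∃ r > 0, ∀ y : Fin n → ℝ, ‖y‖ < r → (∀ l, AnalyticAt ℝ (u l) y) ∧
      ∀ l, ∀ j ∈ Finset.range (R + 2), |eulerTower (β l) (u l) j y - β l ^ j * u l 0| < ε := by
    have h1 : ∀ᶠ y in 𝓝 (0 : Fin n → ℝ), (∀ l, AnalyticAt ℝ (u l) y) ∧
        ∀ l, ∀ j ∈ Finset.range (R + 2),
          |eulerTower (β l) (u l) j y - β l ^ j * u l 0| < ε := by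
      refine (eventually_all.2 fun l => (hu l).eventually_analyticAt).and
        (eventually_all.2 fun l => (Finset.eventually_all _).2 fun j _ => ?_)
      obtain ⟨s, hs, hus⟩ := (hu l).exists_mem_nhds_analyticOnNhd
      have h2 := (analyticOnNhd_eulerTower hus (β l) j 0 (mem_of_mem_nhds hs)).continuousAt
      have h3 := h2.sub (continuousAt_const (y := β l ^ j * u l 0))
      have h4 := h3.abs.tendsto
      simp only [Pi.sub_apply, eulerTower_zero, sub_self, abs_zero] at h4
      exact h4.eventually (gt_mem_nhds hε0)
    obtain ⟨r, hr, h⟩ := Metric.eventually_nhds_iff.1 h1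
    exact ⟨r, hr, fun y hy => h (by rwa [dist_zero_right])⟩
  set C : ℝ := ∑ l, ∑ j ∈ Finset.range (R + 2), Real.exp (β l) * (|β l ^ j * u l 0| + ε) with hC
  have hC0 : 0 ≤ C := Finset.sum_nonneg fun l _ => Finset.sum_nonneg fun j _ => by positivity
  have hCle : ∀ l, ∀ j ∈ Finset.range (R + 2), Real.exp (β l) * (|β l ^ j * u l 0| + ε) ≤ C := by
    intro l j hj
    refine le_trans ?_ (Finset.single_le_sum (f := fun l => ∑ j ∈ Finset.range (R + 2),
      Real.exp (β l) * (|β l ^ j * u l 0| + ε))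
      (fun l _ => Finset.sum_nonneg fun j _ => by positivity) (Finset.mem_univ l))
    exact Finset.single_le_sum (f := fun j => Real.exp (β l) * (|β l ^ j * u l 0| + ε))
      (fun j _ => by positivity) hj
  obtain ⟨K, hK, hvdc⟩ := van_der_corput hR (c := c / 2) (C := R * C) (by positivity)
    (by positivity)
  refine ⟨r / 3, by positivity, K, hK, ?_⟩
  intro y hy a ha B B' hB hBc hB1 hB2
  have hexp : ∀ t ∈ Set.Icc (0 : ℝ) 1, ‖Real.exp t • y‖ < r := by
    intro t ht
    rw [norm_smul, Real.norm_eq_abs, Real.abs_exp]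
    have := exp_le_three ht.2
    nlinarith [norm_nonneg y]
  have hs : ∀ l, AnalyticOnNhd ℝ (u l) (Metric.ball 0 r) := fun l y hy =>
    (hball y (by simpa using hy)).1 l
  refine hvdc (fun j t => ∑ l, a l * (Real.exp (β l * t) *
    eulerTower (β l) (u l) j (Real.exp t • y))) B B' ‖a‖ ha ?_ hB hBc hB1 hB2 ?_ ?_
  · intro j t ht
    exact HasDerivAt.fun_sum fun l _ => (hasDerivAt_eulerTower (hs l) (β l) j
      (by simpa using hexp t ht)).const_mul (a l)
  · intro j hj t ht
    refine (Finset.abs_sum_le_sum_abs _ _).trans ?_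
    refine (Finset.sum_le_card_nsmul _ _ (C * ‖a‖) fun l _ => ?_).trans (by
      rw [Finset.card_univ, Fintype.card_fin, nsmul_eq_mul, mul_assoc])
    have hj' : j + 1 ∈ Finset.range (R + 2) := Finset.mem_range.2 (by omega)
    rw [abs_mul, abs_mul, Real.abs_exp, mul_comm]
    refine mul_le_mul ?_ (norm_le_pi_norm a l) (abs_nonneg _) hC0
    refine le_trans ?_ (hCle l (j + 1) hj')
    gcongr
    · have := hβ0 l
      nlinarith [ht.2]
    · have h1 := (hball _ (hexp t ht)).2 l (j + 1) hj'
      have h2 := abs_sub_abs_le_abs_sub (eulerTower (β l) (u l) (j + 1) (Real.exp t • y))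
        (β l ^ (j + 1) * u l 0)
      linarith
  · intro t ht
    set b : Fin R → ℝ := fun l => a l * Real.exp (β l * t) with hb
    have hab : ‖a‖ ≤ ‖b‖ := by
      refine (pi_norm_le_iff_of_nonneg (norm_nonneg _)).2 fun l => le_trans ?_ (norm_le_pi_norm b l)
      rw [hb, norm_mul]
      refine le_mul_of_one_le_right (norm_nonneg _) ?_
      rw [Real.norm_eq_abs, Real.abs_exp]
      exact Real.one_le_exp (mul_nonneg (hβ0 l).le ht.1)
    obtain ⟨i, hi, hib⟩ := hvan b
    refine ⟨i, hi, ?_⟩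
    have hi' : i + 1 ∈ Finset.range (R + 2) := Finset.mem_range.2 (by omega)
    have h1 : |(∑ l, a l * (Real.exp (β l * t) * eulerTower (β l) (u l) (i + 1)
        (Real.exp t • y))) - ∑ l, b l * (β l ^ (i + 1) * u l 0)| ≤ c / 2 * ‖b‖ := by
      rw [← Finset.sum_sub_distrib]
      refine (Finset.abs_sum_le_sum_abs _ _).trans ?_
      refine (Finset.sum_le_card_nsmul _ _ (‖b‖ * ε) fun l _ => ?_).trans (le_of_eq ?_)
      · rw [← mul_assoc, ← mul_sub, abs_mul]
        exact mul_le_mul (norm_le_pi_norm b l) ((hball _ (hexp t ht)).2 l (i + 1) hi').le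
          (abs_nonneg _) (norm_nonneg _)
      · rw [Finset.card_univ, Fintype.card_fin, nsmul_eq_mul, hε]
        field_simp
    have h2 := abs_sub_abs_le_abs_sub (∑ l, b l * (β l ^ (i + 1) * u l 0))
      (∑ l, a l * (Real.exp (β l * t) * eulerTower (β l) (u l) (i + 1) (Real.exp t • y)))
    rw [abs_sub_comm] at h2
    have h3 : c / 2 * ‖a‖ ≤ c / 2 * ‖b‖ := by gcongr
    linarith

end dilation

section leaf
variable {n N : ℕ}

/-- Decay of order `s` of the local oscillatory integrals with phase `f` plus a small combination
of the `X i` and density `|D|`, provided that `|f| ^ (-s)` is locally integrable. -/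
def LocalDecay (s : ℝ) (f : (Fin n → ℝ) → ℝ) (X : Fin N → (Fin n → ℝ) → ℝ)
    (D : (Fin n → ℝ) → ℝ) : Prop :=
  (∃ V ∈ 𝓝 (0 : Fin n → ℝ), ∫⁻ y in V, ENNReal.ofReal (|f y| ^ (-s) * |D y|) ≠ ⊤) →
  ∃ V ∈ 𝓝 (0 : Fin n → ℝ), ∃ δ > 0, ∀ χ : (Fin n → ℝ) → ℝ, ContDiff ℝ 1 χ →
    HasCompactSupport χ → tsupport χ ⊆ V → ∃ C, ∀ η : Fin N → ℝ, (∀ i, |η i| < δ) →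
      ∀ l : ℝ, 1 ≤ |l| →
        ‖∫ y, ((χ y * |D y| : ℝ) : ℂ) * cexp (I * ((l * (f y + ∑ i, η i * X i y) : ℝ) : ℂ))‖ ≤
          C * |l| ^ (-s)

theorem volume_coord_eq_zero (i : Fin n) : volume {y : Fin n → ℝ | y i = 0} = 0 :=
  Measure.pi_hyperplane _ i 0

theorem ae_coord_ne_zero : ∀ᵐ y : Fin n → ℝ, ∀ i, y i ≠ 0 :=
  ae_all_iff.2 fun i => measure_eq_zero_iff_ae_notMem.1 (volume_coord_eq_zero i)

/-- Averaging an integral over the dilations `exp τ`, `0 ≤ τ ≤ 1`. -/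
theorem integral_eq_dilation_average {G : (Fin n → ℝ) → ℂ} (hG : Continuous G)
    (hc : HasCompactSupport G) :
    ∫ y, G y = ∫ y : Fin n → ℝ, ∫ t in (0 : ℝ)..1, (Real.exp (n * t) : ℂ) * G (Real.exp t • y) := by
  have h1 : ∀ t : ℝ, (∫ y : Fin n → ℝ, (Real.exp (n * t) : ℂ) * G (Real.exp t • y)) = ∫ y, G y := by
    intro t
    rw [integral_const_mul, Measure.integral_comp_smul, Module.finrank_fin_fun,
      abs_of_pos (by positivity), ← Real.exp_nat_mul, ← Real.exp_neg, Complex.real_smul,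
      ← mul_assoc,
      ← Complex.ofReal_mul, ← Real.exp_add]
    simp
  have h2 : ∫ y, G y = ∫ t in (0 : ℝ)..1,
      ∫ y : Fin n → ℝ, (Real.exp (n * t) : ℂ) * G (Real.exp t • y) := by
    simp_rw [h1]; simp
  rw [h2, intervalIntegral.integral_of_le zero_le_one, integral_integral_swap]
  · simp_rw [intervalIntegral.integral_of_le zero_le_one]
  · obtain ⟨r, hr⟩ := hc.isCompact.isBounded.subset_closedBall (0 : Fin n → ℝ)
    set F : ℝ × (Fin n → ℝ) → ℂ := fun p => (Real.exp (n * p.1) : ℂ) * G (Real.exp p.1 • p.2)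
    have hF : Continuous F := by fun_prop
    have hprod : (volume.restrict (Set.Ioc (0 : ℝ) 1)).prod (volume : Measure (Fin n → ℝ)) =
        (volume.prod volume).restrict (Set.Ioc (0 : ℝ) 1 ×ˢ Set.univ) := by
      rw [← Measure.prod_restrict, Measure.restrict_univ]
    show Integrable F _
    rw [hprod]
    have hK : IntegrableOn F (Set.Icc (0 : ℝ) 1 ×ˢ Metric.closedBall (0 : Fin n → ℝ) r)
        (volume.prod volume) :=
      hF.continuousOn.integrableOn_compact (isCompact_Icc.prod (isCompact_closedBall 0 r))
    refine hK.of_forall_sdiff_eq_zero (measurableSet_Ioc.prod MeasurableSet.univ) ?_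
    rintro ⟨t, y⟩ ⟨⟨ht, -⟩, hn⟩
    have : G (Real.exp t • y) = 0 := by
      by_contra h
      have h3 : Real.exp t • y ∈ Metric.closedBall (0 : Fin n → ℝ) r :=
        hr (subset_tsupport _ h)
      refine hn ⟨⟨ht.1.le, ht.2⟩, ?_⟩
      rw [mem_closedBall_zero_iff] at h3 ⊢
      refine le_trans ?_ h3
      rw [norm_smul, Real.norm_eq_abs, Real.abs_exp]
      exact le_mul_of_one_le_left (norm_nonneg _) (Real.one_le_exp ht.1.le)
    simp [F, this]

theorem prod_exp_smul (t : ℝ) (y : Fin n → ℝ) (γ : Fin n → ℕ) :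
    ∏ i, (Real.exp t • y) i ^ γ i = Real.exp ((∑ i, γ i : ℕ) * t) * ∏ i, y i ^ γ i := by
  have : Real.exp ((∑ i, γ i : ℕ) * t) = ∏ i, Real.exp t ^ γ i := by
    rw [Finset.prod_pow_eq_pow_sum, ← Real.exp_nat_mul]
  rw [this, ← Finset.prod_mul_distrib]
  exact Finset.prod_congr rfl fun i _ => by rw [Pi.smul_apply, smul_eq_mul, mul_pow]

theorem phase_eq {R : ℕ} (l₀ : Fin R) (M : Fin N → Fin R → ℝ) (x₀ η : Fin N → ℝ) (Z : Fin R → ℝ) :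
    Z l₀ + ∑ i, η i * (x₀ i + ∑ l, M i l * Z l) =
      ∑ i, η i * x₀ i + ∑ l, ((if l = l₀ then 1 else 0) + ∑ i, η i * M i l) * Z l := by
  simp only [mul_add, add_mul, Finset.sum_add_distrib, Finset.mul_sum, Finset.sum_mul, ite_mul,
    one_mul, zero_mul, Finset.sum_ite_eq', Finset.mem_univ, if_true]
  rw [Finset.sum_comm (f := fun l i => η i * M i l * Z l)]
  simp only [mul_assoc]
  ring

theorem NormalCrossing.exists_abs_eq {D : (Fin n → ℝ) → ℝ} (hD : NormalCrossing D) :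
    ∃ (γ : Fin n → ℕ) (v : (Fin n → ℝ) → ℝ), AnalyticAt ℝ v 0 ∧ 0 < v 0 ∧
      ∀ᶠ y in 𝓝 0, |D y| = |∏ i, y i ^ γ i| * v y := by
  obtain ⟨γ, w, hw, hw0, hDw⟩ := hD
  rcases lt_or_gt_of_ne hw0 with h | h
  · refine ⟨γ, fun y => -w y, hw.neg, neg_pos.2 h, ?_⟩
    filter_upwards [hDw, hw.continuousAt.eventually (gt_mem_nhds h)] with y h1 h2
    rw [h1, abs_mul, abs_of_neg h2]
  · refine ⟨γ, w, hw, h, ?_⟩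
    filter_upwards [hDw, hw.continuousAt.eventually (lt_mem_nhds h)] with y h1 h2
    rw [h1, abs_mul, abs_of_pos h2]

theorem contDiff_smul_of_tsupport {E F : Type*} [NormedAddCommGroup E] [NormedSpace ℝ E]
    [NormedAddCommGroup F] [NormedSpace ℝ F] {χ : E → ℝ} {v : E → F} (hχ : ContDiff ℝ 1 χ)
    (hv : ∀ y ∈ tsupport χ, ContDiffAt ℝ 1 v y) : ContDiff ℝ 1 (fun y => χ y • v y) := by
  rw [contDiff_iff_contDiffAt]
  intro y
  by_cases hy : y ∈ tsupport χ
  · exact hχ.contDiffAt.smul (hv y hy)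
  · refine (contDiffAt_const (c := (0 : F))).congr_of_eventuallyEq ?_
    filter_upwards [(isClosed_tsupport χ).isOpen_compl.mem_nhds hy] with z hz
    rw [image_eq_zero_of_notMem_tsupport hz, zero_smul]

theorem continuous_mul_of_tsupport {E : Type*} [TopologicalSpace E]
    {χ : E → ℝ} {v : E → ℂ} (hχ : Continuous χ) (hv : ∀ y ∈ tsupport χ, ContinuousAt v y) :
    Continuous (fun y => (χ y : ℂ) * v y) := by
  rw [continuous_iff_continuousAt]
  intro y
  by_cases hy : y ∈ tsupport χ
  · exact (continuous_ofReal.comp hχ).continuousAt.mul (hv y hy)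
  · refine (continuousAt_const (y := (0 : ℂ))).congr ?_
    filter_upwards [(isClosed_tsupport χ).isOpen_compl.mem_nhds hy] with z hz
    rw [image_eq_zero_of_notMem_tsupport hz, ofReal_zero, zero_mul]

set_option maxHeartbeats 1000000 in
theorem localDecay_of_monomials {R : ℕ} (hR : 1 ≤ R) {s : ℝ} (hs0 : 0 < s) (hsR : s ≤ 1 / R)
    {α : Fin R → Fin n → ℕ} (hα : Function.Injective fun l => ∑ i, α l i)
    (hα0 : ∀ l, 0 < ∑ i, α l i) {u : Fin R → (Fin n → ℝ) → ℝ} (hu : ∀ l, AnalyticAt ℝ (u l) 0)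
    (hu0 : ∀ l, u l 0 ≠ 0) {f D : (Fin n → ℝ) → ℝ} {X : Fin N → (Fin n → ℝ) → ℝ} (l₀ : Fin R)
    (hf : f =ᶠ[𝓝 0] fun y => (∏ i, y i ^ α l₀ i) * u l₀ y) (M : Fin N → Fin R → ℝ)
    (x₀ : Fin N → ℝ)
    (hX : ∀ j, X j =ᶠ[𝓝 0] fun y => x₀ j + ∑ l, M j l * ((∏ i, y i ^ α l i) * u l y))
    (hD : NormalCrossing D) : LocalDecay s f X D := by
  rintro ⟨V₀, hV₀, hfin⟩
  set β : Fin R → ℝ := fun l => ((∑ i, α l i : ℕ) : ℝ) with hβ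
  obtain ⟨ρ, hρ, K, hK, hest⟩ := exists_dilation_estimate hR (β := β)
    (fun l l' h => hα (Nat.cast_injective h)) (fun l => Nat.cast_pos.2 (hα0 l)) hu hu0
  obtain ⟨γ, v, hv, hv0, hDv⟩ := hD.exists_abs_eq
  set U : ℝ := |u l₀ 0| + 1 with hU
  have hU0 : 0 < U := by positivity
  obtain ⟨r₀, hr₀, hball⟩ : ∃ r₀ > 0, ∀ y : Fin n → ℝ, ‖y‖ < r₀ →
      (f y = (∏ i, y i ^ α l₀ i) * u l₀ y) ∧
      (∀ j, X j y = x₀ j + ∑ l, M j l * ((∏ i, y i ^ α l i) * u l y)) ∧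
      (|D y| = |∏ i, y i ^ γ i| * v y) ∧ v 0 / 2 < v y ∧ |u l₀ y| < U ∧ AnalyticAt ℝ v y ∧
      (∀ l, AnalyticAt ℝ (u l) y) ∧ y ∈ V₀ ∧ u l₀ y ≠ 0 := by
    have h1 := hv.continuousAt.eventually (lt_mem_nhds (half_lt_self hv0))
    have h2 := (hu l₀).continuousAt.abs.eventually (gt_mem_nhds (lt_add_one |u l₀ 0|))
    have h3 := hf.and ((eventually_all.2 hX).and (hDv.and (h1.and (h2.and
      (hv.eventually_analyticAt.and ((eventually_all.2 fun l =>
        (hu l).eventually_analyticAt).and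
        (Filter.Eventually.and hV₀ ((hu l₀).continuousAt.eventually_ne (hu0 l₀)))))))))
    obtain ⟨r, hr, h⟩ := Metric.eventually_nhds_iff.1 h3
    exact ⟨r, hr, fun y hy => h (by rwa [dist_zero_right])⟩
  set r := min (r₀ / 3) ρ with hr
  have hr0 : 0 < r := by positivity
  have hrr₀ : r ≤ r₀ / 3 := min_le_left _ _
  refine ⟨Metric.ball 0 r, Metric.ball_mem_nhds 0 hr0, 1 / (2 * (1 + ∑ j, |M j l₀|)),
    by positivity, ?_⟩
  intro χ hχ hχc hχr
  have hsmall : ∀ y ∈ tsupport χ, ‖y‖ < r₀ := fun y hy => by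
    have := mem_ball_zero_iff.1 (hχr hy); linarith
  set κ : ℝ := n + (∑ i, γ i : ℕ) with hκ
  set w : (Fin n → ℝ) → ℝ := fun y => χ y * v y with hw
  have hwd : ContDiff ℝ 1 w :=
    contDiff_smul_of_tsupport hχ fun y hy => (hball y (hsmall y hy)).2.2.2.2.2.1.contDiffAt
  have hwc : HasCompactSupport w := hχc.mul_right
  set w₁ : (Fin n → ℝ) → ℝ := fun y => κ * w y + fderiv ℝ w y y with hw₁
  have hw₁cont : Continuous w₁ :=
    (continuous_const.mul hwd.continuous).add
      ((hwd.continuous_fderiv one_ne_zero).clm_apply continuous_id)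
  have hw₁c : HasCompactSupport w₁ := by
    refine (hwc.mul_left (f := fun _ => κ)).add ?_
    refine hwc.mono' ?_
    intro y hy
    by_contra h
    refine hy ?_
    have h1 : w =ᶠ[𝓝 y] fun _ => 0 := by
      filter_upwards [(isClosed_tsupport w).isOpen_compl.mem_nhds h] with z hz
      exact image_eq_zero_of_notMem_tsupport hz
    simp [h1.fderiv_eq]
  obtain ⟨C₁, hC₁⟩ := hwd.continuous.bounded_above_of_compact_support hwc
  obtain ⟨C₂, hC₂⟩ := hw₁cont.bounded_above_of_compact_support hw₁c
  have hC₁0 : 0 ≤ C₁ := (norm_nonneg _).trans (hC₁ 0)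
  have hC₂0 : 0 ≤ C₂ := (norm_nonneg _).trans (hC₂ 0)
  set b : ℝ := Real.exp κ * (C₁ + C₂) + 1 with hb
  have hb0 : 0 < b := by positivity
  set C' : ℝ := b * (K + 1) * (2 * U) ^ s * (2 / v 0) with hC'
  have hC'0 : 0 ≤ C' := by positivity
  refine ⟨C' * (∫⁻ y in V₀, ENNReal.ofReal (|f y| ^ (-s) * |D y|)).toReal, ?_⟩
  intro η hη l hl
  have hl0 : 0 < |l| := by linarith
  set G : (Fin n → ℝ) → ℂ := fun y =>
    ((χ y * |D y| : ℝ) : ℂ) * cexp (I * ((l * (f y + ∑ i, η i * X i y) : ℝ) : ℂ)) with hG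
  have hpt : ∀ᵐ y : Fin n → ℝ, ‖∫ t in (0 : ℝ)..1, (Real.exp (n * t) : ℂ) * G (Real.exp t • y)‖ ≤
      (Metric.ball 0 r).indicator (fun y => C' * |l| ^ (-s) * (|f y| ^ (-s) * |D y|)) y := by
    filter_upwards [ae_coord_ne_zero] with y hy0
    by_cases hyr : y ∈ Metric.ball (0 : Fin n → ℝ) r
    swap
    · have hz : Set.EqOn (fun t : ℝ => (Real.exp (n * t) : ℂ) * G (Real.exp t • y)) (fun _ => 0)
          (Set.uIcc 0 1) := by
        intro t ht
        rw [Set.uIcc_of_le zero_le_one] at ht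
        have : χ (Real.exp t • y) = 0 := by
          by_contra h
          refine hyr ?_
          have h3 := hχr (subset_tsupport χ h)
          rw [mem_ball_zero_iff] at h3 ⊢
          refine lt_of_le_of_lt ?_ h3
          rw [norm_smul, Real.norm_eq_abs, Real.abs_exp]
          exact le_mul_of_one_le_left (norm_nonneg _) (Real.one_le_exp ht.1)
        simp [hG, this]
      rw [intervalIntegral.integral_congr hz, Set.indicator_of_notMem hyr]
      simp
    rw [Set.indicator_of_mem hyr]
    have hyr' := mem_ball_zero_iff.1 hyr
    have hyρ : ‖y‖ < ρ := hyr'.trans_le (min_le_right _ _)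
    have hz : ∀ t ∈ Set.Icc (0 : ℝ) 1, ‖Real.exp t • y‖ < r₀ := by
      intro t ht
      rw [norm_smul, Real.norm_eq_abs, Real.abs_exp]
      nlinarith [exp_le_three ht.2, norm_nonneg y]
    set m : Fin R → ℝ := fun l' => ∏ i, y i ^ α l' i with hm
    set p : ℝ := |∏ i, y i ^ γ i| with hp
    have hp0 : 0 ≤ p := abs_nonneg _
    set c : Fin R → ℝ := fun l' => (if l' = l₀ then 1 else 0) + ∑ i, η i * M i l' with hc
    set a : Fin R → ℝ := fun l' => l * c l' * m l' with ha
    set B : ℝ → ℝ := fun t => b⁻¹ * (Real.exp (κ * t) * w (Real.exp t • y)) with hB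
    set B' : ℝ → ℝ := fun t => b⁻¹ * (Real.exp (κ * t) * w₁ (Real.exp t • y)) with hB'
    have hκ0 : 0 ≤ κ := by positivity
    have hbound : ∀ t ∈ Set.Icc (0 : ℝ) 1, ∀ h C, |h| ≤ C → C ≤ C₁ + C₂ →
        |b⁻¹ * (Real.exp (κ * t) * h)| ≤ 1 := by
      intro t ht h C hC hC12
      rw [abs_mul, abs_mul, Real.abs_exp, abs_of_pos (inv_pos.2 hb0), inv_mul_le_one₀ hb0]
      have h1 : Real.exp (κ * t) ≤ Real.exp κ :=
        Real.exp_le_exp.2 (mul_le_of_le_one_right hκ0 ht.2)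
      calc _ ≤ Real.exp κ * (C₁ + C₂) :=
            mul_le_mul h1 (hC.trans hC12) (abs_nonneg _) (Real.exp_pos _).le
        _ ≤ b := by rw [hb]; linarith
    have hBb : ∀ t ∈ Set.Icc (0 : ℝ) 1, |B t| ≤ 1 := fun t ht =>
      hbound t ht _ C₁ (hC₁ _) (by linarith)
    have hBb' : ∀ t ∈ Set.Icc (0 : ℝ) 1, |B' t| ≤ 1 := fun t ht =>
      hbound t ht _ C₂ (hC₂ _) (by linarith)
    have hBd : ∀ t ∈ Set.Icc (0 : ℝ) 1, HasDerivAt B (B' t) t := fun t _ =>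
      (hasDerivAt_exp_smul κ (hwd.differentiable one_ne_zero _)).const_mul b⁻¹
    have hBc : ContinuousOn B' (Set.Icc 0 1) := by
      refine Continuous.continuousOn ?_
      have : Continuous fun t : ℝ => Real.exp t • y := by fun_prop
      exact continuous_const.mul ((by fun_prop : Continuous fun t : ℝ => Real.exp (κ * t)).mul
        (hw₁cont.comp this))
    set Φ : ℝ → ℂ := fun t => (B t : ℂ) * cexp (I * ((∑ l', a l' *
        (Real.exp (β l' * t) * u l' (Real.exp t • y)) : ℝ) : ℂ)) with hΦ
    have hkey : Set.EqOn (fun t : ℝ => (Real.exp (n * t) : ℂ) * G (Real.exp t • y))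
        (fun t => (((p * b : ℝ) : ℂ) * cexp (I * ((l * ∑ i, η i * x₀ i : ℝ) : ℂ))) * Φ t)
        (Set.uIcc 0 1) := by
      intro t ht
      rw [Set.uIcc_of_le zero_le_one] at ht
      obtain ⟨e1, e2, e3, -⟩ := hball _ (hz t ht)
      have h1 : l * (f (Real.exp t • y) + ∑ i, η i * X i (Real.exp t • y)) =
          l * ∑ i, η i * x₀ i +
          ∑ l', a l' * (Real.exp (β l' * t) * u l' (Real.exp t • y)) := by
        rw [e1]
        simp_rw [e2]
        rw [phase_eq l₀ M x₀ η
          (fun l' => (∏ i, (Real.exp t • y) i ^ α l' i) * u l' (Real.exp t • y)), mul_add]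
        congr 1
        rw [Finset.mul_sum]
        refine Finset.sum_congr rfl fun l' _ => ?_
        rw [prod_exp_smul]
        simp only [ha, hc, hm, hβ]
        ring
      have h2 : Real.exp (n * t) * (χ (Real.exp t • y) * |D (Real.exp t • y)|) = p * b * B t := by
        rw [e3, prod_exp_smul, abs_mul, Real.abs_exp]
        simp only [hB, hw, hκ, add_mul, Real.exp_add, ← hp]
        rw [mul_assoc p b, mul_inv_cancel_left₀ hb0.ne']
        ring
      simp only [hG, hΦ]
      rw [h1, ofReal_add, mul_add, Complex.exp_add, ← mul_assoc, ← ofReal_mul, h2]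
      push_cast
      ring
    rw [intervalIntegral.integral_congr hkey, intervalIntegral.integral_const_mul, norm_mul,
      norm_mul, norm_exp_I_mul_ofReal, mul_one, Complex.norm_real, Real.norm_eq_abs,
      abs_of_nonneg (by positivity)]
    have hc0 : 1 / 2 ≤ |c l₀| := by
      have h1 : |∑ i, η i * M i l₀| ≤ 1 / 2 := by
        have hS : 0 < 1 + ∑ j, |M j l₀| := by positivity
        calc _ ≤ ∑ i, |η i * M i l₀| := Finset.abs_sum_le_sum_abs _ _
          _ ≤ ∑ i, 1 / (2 * (1 + ∑ j, |M j l₀|)) * |M i l₀| := by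
              refine Finset.sum_le_sum fun i _ => ?_
              rw [abs_mul]
              exact mul_le_mul_of_nonneg_right (hη i).le (abs_nonneg _)
          _ ≤ 1 / 2 := by
              rw [← Finset.mul_sum, div_mul_eq_mul_div, one_mul,
                div_le_iff₀ (by positivity)]
              linarith
      have h2 : c l₀ = 1 + ∑ i, η i * M i l₀ := by simp [hc]
      rw [h2]
      have := neg_abs_le (∑ i, η i * M i l₀)
      exact le_trans (by linarith) (le_abs_self _)
    obtain ⟨e1, -, e3, e4, e5, -, -, -, e6⟩ := hball y (by linarith)
    have hm0 : ∀ l', m l' ≠ 0 := fun l' =>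
      Finset.prod_ne_zero_iff.2 fun i _ => pow_ne_zero _ (hy0 i)
    have hfle : |f y| ≤ |m l₀| * U := by
      rw [e1, abs_mul]
      exact mul_le_mul_of_nonneg_left e5.le (abs_nonneg _)
    have hal : |l| * |m l₀| / 2 ≤ |a l₀| := by
      rw [ha, abs_mul, abs_mul]
      nlinarith [mul_nonneg hl0.le (abs_nonneg (m l₀))]
    have hal0 : 0 < |a l₀| := lt_of_lt_of_le (by have := abs_pos.2 (hm0 l₀); positivity) hal
    have hanorm : |a l₀| ≤ ‖a‖ := norm_le_pi_norm a l₀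
    have hΦle : ‖∫ t in (0 : ℝ)..1, Φ t‖ ≤ (K + 1) * |a l₀| ^ (-s) := by
      have hmono : ‖a‖ ^ (-s) ≤ |a l₀| ^ (-s) :=
        Real.rpow_le_rpow_of_nonpos hal0 hanorm (by linarith)
      rcases le_or_gt 1 ‖a‖ with h1 | h1
      · calc _ ≤ K * ‖a‖ ^ (-(1 / R : ℝ)) := hest y hyρ a h1 B B' hBd hBc hBb hBb'
          _ ≤ K * ‖a‖ ^ (-s) := by
              gcongr
          _ ≤ (K + 1) * |a l₀| ^ (-s) := by
              gcongr
              linarith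
      · have h2 : ‖∫ t in (0 : ℝ)..1, Φ t‖ ≤ 1 * |(1 : ℝ) - 0| := by
          refine intervalIntegral.norm_integral_le_of_norm_le_const fun t ht => ?_
          rw [Set.uIoc_of_le zero_le_one] at ht
          rw [norm_mul, norm_exp_I_mul_ofReal, mul_one, Complex.norm_real]
          exact hBb t ⟨ht.1.le, ht.2⟩
        have h3 : 1 ≤ |a l₀| ^ (-s) :=
          Real.one_le_rpow_of_pos_of_le_one_of_nonpos hal0 (hanorm.trans h1.le) (by linarith)
        have h4 : 0 ≤ K * |a l₀| ^ (-s) := by positivity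
        norm_num at h2
        linarith
    have hpD : p ≤ |D y| * (2 / v 0) := by
      rw [e3, mul_assoc]
      refine le_mul_of_one_le_right hp0 ?_
      rw [mul_div_assoc', le_div_iff₀ hv0]
      linarith
    have hal2 : |a l₀| ^ (-s) ≤ |l| ^ (-s) * |f y| ^ (-s) * (2 * U) ^ s := by
      have hfy : 0 < |f y| := by
        rw [abs_pos, e1]
        exact mul_ne_zero (hm0 l₀) e6
      have h1 : |l| * |f y| * (2 * U)⁻¹ ≤ |a l₀| := by
        refine le_trans ?_ hal
        rw [← div_eq_mul_inv, div_le_div_iff₀ (by positivity) two_pos]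
        nlinarith [mul_le_mul_of_nonneg_left hfle hl0.le]
      refine (Real.rpow_le_rpow_of_nonpos (by positivity) h1 (by linarith)).trans (le_of_eq ?_)
      rw [Real.mul_rpow (by positivity) (by positivity), Real.mul_rpow (by positivity)
        (by positivity), Real.inv_rpow (by positivity), Real.rpow_neg (x := 2 * U) (by positivity),
        inv_inv]
    calc p * b * ‖∫ t in (0 : ℝ)..1, Φ t‖ ≤ (|D y| * (2 / v 0)) * b *
          ((K + 1) * (|l| ^ (-s) * |f y| ^ (-s) * (2 * U) ^ s)) := by
          gcongr
          exact hΦle.trans (by gcongr)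
      _ = _ := by rw [hC']; ring
  have hGcont : Continuous G := by
    refine continuous_mul_of_tsupport (χ := χ) (v := fun y => ((|D y| : ℝ) : ℂ) *
      cexp (I * ((l * (f y + ∑ i, η i * X i y) : ℝ) : ℂ))) hχ.continuous (fun y hy => ?_) |>.congr
      fun y => by simp only [hG]; push_cast; ring
    have hnear : ∀ᶠ z in 𝓝 y, ‖z‖ < r₀ :=
      (isOpen_lt continuous_norm continuous_const).mem_nhds (hsmall y hy)
    obtain ⟨-, -, -, -, -, hva, hua, -⟩ := hball y (hsmall y hy)
    have hmon : ∀ δ : Fin n → ℕ, ContinuousAt (fun z : Fin n → ℝ => ∏ i, z i ^ δ i) y := fun δ =>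
      (by fun_prop : Continuous fun z : Fin n → ℝ => ∏ i, z i ^ δ i).continuousAt
    have hDc : ContinuousAt (fun z => |D z|) y :=
      ((hmon γ).abs.mul hva.continuousAt).congr
        (hnear.mono fun z hz => (hball z hz).2.2.1.symm)
    have hfc : ContinuousAt f y := ((hmon (α l₀)).mul (hua l₀).continuousAt).congr
      (hnear.mono fun z hz => (hball z hz).1.symm)
    have hXc : ∀ j, ContinuousAt (X j) y := fun j => by
      refine ContinuousAt.congr ?_ (hnear.mono fun z hz => ((hball z hz).2.1 j).symm)
      exact continuousAt_const.add (tendsto_finsetSum _ fun l' _ => continuousAt_const.mul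
        ((hmon (α l')).mul (hua l').continuousAt))
    have hph : ContinuousAt (fun y => l * (f y + ∑ i, η i * X i y)) y :=
      continuousAt_const.mul (hfc.add (tendsto_finsetSum _ fun i _ =>
        continuousAt_const.mul (hXc i)))
    exact (continuous_ofReal.continuousAt.comp hDc).mul
      (Complex.continuous_exp.continuousAt.comp (continuousAt_const.mul
        (continuous_ofReal.continuousAt.comp hph)))
  have hGc : HasCompactSupport G := by
    refine hχc.mono fun y hy h => hy ?_
    simp [hG, h]
  rw [integral_eq_dilation_average hGcont hGc]
  refine (norm_integral_le_lintegral_norm _).trans ?_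
  have hfin' : ENNReal.ofReal (C' * |l| ^ (-s)) *
      ∫⁻ y in V₀, ENNReal.ofReal (|f y| ^ (-s) * |D y|) ≠ ⊤ :=
    ENNReal.mul_ne_top ENNReal.ofReal_ne_top hfin
  have hle : ∫⁻ y, ENNReal.ofReal ‖∫ t in (0 : ℝ)..1, (Real.exp (n * t) : ℂ) *
      G (Real.exp t • y)‖ ≤ ENNReal.ofReal (C' * |l| ^ (-s)) *
      ∫⁻ y in V₀, ENNReal.ofReal (|f y| ^ (-s) * |D y|) := by
    calc _ ≤ ∫⁻ y, (Metric.ball 0 r).indicator (fun y => ENNReal.ofReal (C' * |l| ^ (-s)) *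
          ENNReal.ofReal (|f y| ^ (-s) * |D y|)) y := by
          refine lintegral_mono_ae ?_
          filter_upwards [hpt] with y hy
          refine (ENNReal.ofReal_le_ofReal hy).trans ?_
          by_cases h : y ∈ Metric.ball (0 : Fin n → ℝ) r
          · rw [Set.indicator_of_mem h, Set.indicator_of_mem h, ENNReal.ofReal_mul (by positivity)]
          · rw [Set.indicator_of_notMem h]; simp
      _ = ENNReal.ofReal (C' * |l| ^ (-s)) * ∫⁻ y in Metric.ball 0 r,
            ENNReal.ofReal (|f y| ^ (-s) * |D y|) := by
          rw [lintegral_indicator measurableSet_ball,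
            lintegral_const_mul' _ _ ENNReal.ofReal_ne_top]
      _ ≤ _ := by
          gcongr
          intro y hy
          exact (hball y (by have := mem_ball_zero_iff.1 hy; linarith)).2.2.2.2.2.2.2.1
  refine (ENNReal.toReal_mono hfin' hle).trans (le_of_eq ?_)
  rw [ENNReal.toReal_mul, ENNReal.toReal_ofReal (by positivity)]
  ring

end leaf

section chain
variable {n N : ℕ}

theorem degree_lt_of_precedes {a b u v : (Fin n → ℝ) → ℝ} {α β : Fin n → ℕ}
    (hu : AnalyticAt ℝ u 0) (hv : AnalyticAt ℝ v 0) (hv0 : v 0 ≠ 0)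
    (ha : a =ᶠ[𝓝 0] fun y => (∏ i, y i ^ α i) * u y)
    (hb : b =ᶠ[𝓝 0] fun y => (∏ i, y i ^ β i) * v y) (hab : Precedes a b) :
    ∑ i, α i < ∑ i, β i := by
  obtain ⟨h, hh, hh0, hbh⟩ := hab
  by_contra! hle
  have h1 := tendsto_monomial_curve hu ha (N := fun _ => 1) (fun _ => one_pos)
  have h2 := tendsto_monomial_curve hv hb (N := fun _ => 1) (fun _ => one_pos)
  simp only [one_mul, pow_one] at h1 h2
  have hc : Tendsto (fun t : ℝ => (fun _ => t : Fin n → ℝ)) (𝓝[≠] 0) (𝓝 0) :=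
    (continuous_pi fun _ => continuous_id).continuousAt.tendsto.mono_left nhdsWithin_le_nhds
  have h3 : Tendsto (fun t : ℝ => h fun _ => t) (𝓝[≠] 0) (𝓝 0) := by
    have := hh.continuousAt.tendsto.comp hc
    rwa [hh0] at this
  have h4 : Tendsto (fun t : ℝ => t ^ (∑ i, α i - ∑ i, β i)) (𝓝[≠] (0 : ℝ))
      (𝓝 (0 ^ (∑ i, α i - ∑ i, β i))) :=
    ((continuous_pow _).tendsto 0).mono_left nhdsWithin_le_nhds
  have h5 := (h1.mul h3).mul h4
  refine hv0 (tendsto_nhds_unique h2 (h5.congr' ?_) |>.trans (by simp))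
  filter_upwards [hc.eventually hbh, self_mem_nhdsWithin] with t ht ht0
  have ht0 : t ≠ 0 := ht0
  rw [ht, ← Nat.sub_add_cancel hle, Nat.add_sub_cancel, pow_add]
  field_simp

/-- The decay estimate at a leaf of the resolution: the members of a chain are monomials of
pairwise distinct degrees times units. -/
theorem localDecay_of_chain {s : ℝ} (hs0 : 0 < s) {L : List ((Fin n → ℝ) → ℝ)} (hL : Chain L)
    (hsL : s * L.length ≤ 1) {f D : (Fin n → ℝ) → ℝ} {X : Fin N → (Fin n → ℝ) → ℝ} (hf : f ∈ L)
    (hX : ∀ j, ∃ c : ℝ, ∃ Y ∈ Submodule.span ℝ {a | a ∈ L}, X j =ᶠ[𝓝 0] fun y => c + Y y)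
    (hD : NormalCrossing D) : LocalDecay s f X D := by
  obtain ⟨hpw, hnc⟩ := hL
  have hmem : ∀ l : Fin L.length, L.get l ∈ L := fun l => L.get_mem l
  choose α u hu hu0 hαu using fun l => (hnc _ (hmem l)).1
  have hmono : StrictMono fun l => ∑ i, α l i := fun l l' hll =>
    degree_lt_of_precedes (hu l) (hu l') (hu0 l') (hαu l) (hαu l')
      (List.pairwise_iff_get.1 hpw l l' hll)
  obtain ⟨l₀, hl₀⟩ := List.get_of_mem hf
  have hlen : 1 ≤ L.length := Nat.succ_le_of_lt (l₀.pos)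
  have hlen0 : (0 : ℝ) < L.length := by exact_mod_cast hlen
  choose c Y hY hXY using hX
  have hrange : {a | a ∈ L} = Set.range L.get := by
    ext a
    simp [List.mem_iff_get]
  simp_rw [hrange, Submodule.mem_span_range_iff_exists_fun] at hY
  choose M hM using hY
  refine localDecay_of_monomials hlen hs0 ((le_div_iff₀ hlen0).2 hsL) hmono.injective ?_ hu hu0 l₀
    (hl₀ ▸ hαu l₀) M c ?_ hD
  · intro l
    rw [Nat.pos_iff_ne_zero]
    intro h
    have h0 := (hnc _ (hmem l)).2
    rw [(hαu l).eq_of_nhds] at h0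
    simp only [Finset.sum_eq_zero_iff, Finset.mem_univ, true_implies] at h
    simp [h, hu0 l] at h0
  · intro j
    filter_upwards [hXY j, eventually_all.2 hαu] with y h1 h2
    rw [h1, ← hM j, Finset.sum_apply]
    simp only [Pi.smul_apply, smul_eq_mul, h2]

end chain

section covers
variable {n N : ℕ} {T : Type*}

/-- The maps `P j`, with Jacobian weights `|J j|`, cover a neighbourhood of the origin: integrals
pull back boundedly, and integrals of functions supported near the origin are finite sums of
pulled back integrals with cutoffs concentrated near the origin. -/
def Covers (P : T → (Fin n → ℝ) → (Fin n → ℝ)) (J : T → (Fin n → ℝ) → ℝ) : Prop :=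
  (∀ j, ∃ C : ENNReal, C ≠ ⊤ ∧ ∃ W ∈ 𝓝 (0 : Fin n → ℝ), ∀ g : (Fin n → ℝ) → ENNReal,
    ∫⁻ y in W, g (P j y) * ENNReal.ofReal |J j y| ≤ C * ∫⁻ x, g x) ∧
  ∀ V : T → Set (Fin n → ℝ), (∀ j, V j ∈ 𝓝 0) → ∃ (S : Finset T) (ρ : T → (Fin n → ℝ) → ℝ),
    (∀ j, ContDiff ℝ 1 (ρ j) ∧ HasCompactSupport (ρ j) ∧ tsupport (ρ j) ⊆ V j) ∧
    ∃ V₀ ∈ 𝓝 (0 : Fin n → ℝ), ∀ g : (Fin n → ℝ) → ℂ, Continuous g → HasCompactSupport g →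
      tsupport g ⊆ V₀ → ∫ x, g x = ∑ j ∈ S, ∫ y, ((ρ j y * |J j y| : ℝ) : ℂ) * g (P j y)

theorem LocalDecay.of_covers {s : ℝ} {f D : (Fin n → ℝ) → ℝ} {X : Fin N → (Fin n → ℝ) → ℝ}
    {P : T → (Fin n → ℝ) → (Fin n → ℝ)} {J : T → (Fin n → ℝ) → ℝ} (hPJ : Covers P J)
    (hP : ∀ j, AnalyticAt ℝ (P j) 0) (hP0 : ∀ j, P j 0 = 0) (hf : AnalyticAt ℝ f 0)
    (hX : ∀ i, AnalyticAt ℝ (X i) 0) (hD : AnalyticAt ℝ D 0)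
    (h : ∀ j, LocalDecay s (f ∘ P j) (fun i => X i ∘ P j) (fun y => D (P j y) * J j y)) :
    LocalDecay s f X D := by
  rintro ⟨V, hV, hfin⟩
  obtain ⟨hpull, hcov⟩ := hPJ
  have hint : ∀ j, ∃ W ∈ 𝓝 (0 : Fin n → ℝ), ∫⁻ y in W,
      ENNReal.ofReal (|(f ∘ P j) y| ^ (-s) * |D (P j y) * J j y|) ≠ ⊤ := by
    intro j
    obtain ⟨C, hC, W, hW, hle⟩ := hpull j
    have hPV : P j ⁻¹' interior V ∈ 𝓝 (0 : Fin n → ℝ) :=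
      (hP j).continuousAt.preimage_mem_nhds (by rw [hP0]; exact interior_mem_nhds.2 hV)
    obtain ⟨W', hW', hW'o, hW'0⟩ := mem_nhds_iff.1 (inter_mem hW hPV)
    refine ⟨W', hW'o.mem_nhds hW'0, ne_top_of_le_ne_top (ENNReal.mul_ne_top hC hfin) ?_⟩
    have h1 := hle ((interior V).indicator fun x => ENNReal.ofReal (|f x| ^ (-s) * |D x|))
    rw [lintegral_indicator isOpen_interior.measurableSet] at h1
    refine le_trans ?_ (h1.trans (by gcongr; exact interior_subset))
    refine le_trans ?_ (lintegral_mono_set (fun y hy => (hW' hy).1))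
    refine setLIntegral_mono' hW'o.measurableSet fun y hy => ?_
    rw [Set.indicator_of_mem (show P j y ∈ interior V from (hW' hy).2),
      ← ENNReal.ofReal_mul (by positivity), abs_mul, mul_assoc]
    rfl
  choose V₁ hV₁ δ hδ hdecay using fun j => h j (hint j)
  have hsm : ∀ j, V₁ j ∩ {y | ContDiffAt ℝ 1 (P j) y} ∈ 𝓝 (0 : Fin n → ℝ) := fun j =>
    inter_mem (hV₁ j) ((hP j).eventually_analyticAt.mono fun y hy => hy.contDiffAt)
  obtain ⟨S, ρ, hρ, V₀, hV₀, hsum⟩ := hcov _ hsm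
  have hcont : ∀ᶠ x in 𝓝 (0 : Fin n → ℝ), ContinuousAt f x ∧ ContinuousAt D x ∧
      ∀ i, ContinuousAt (X i) x :=
    (hf.eventually_analyticAt.mono fun y hy => hy.continuousAt).and
      ((hD.eventually_analyticAt.mono fun y hy => hy.continuousAt).and
        (eventually_all.2 fun i => (hX i).eventually_analyticAt.mono fun y hy => hy.continuousAt))
  obtain ⟨ε, hεS, hε⟩ : ∃ ε : ℝ, (∀ j ∈ S, ε < δ j) ∧ 0 < ε := by
    have h1 : ∀ᶠ ε in 𝓝[>] (0 : ℝ), ∀ j ∈ S, ε < δ j :=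
      (Finset.eventually_all S).2 fun j _ =>
        (gt_mem_nhds (hδ j)).filter_mono nhdsWithin_le_nhds
    exact (h1.and self_mem_nhdsWithin).exists
  refine ⟨_, inter_mem hV₀ hcont, ε, hε, ?_⟩
  intro χ hχ hχc hχV
  have hχj : ∀ j, ∃ C, ∀ η : Fin N → ℝ, (∀ i, |η i| < δ j) → ∀ l : ℝ, 1 ≤ |l| →
      ‖∫ y, ((ρ j y * χ (P j y) * |D (P j y) * J j y| : ℝ) : ℂ) *
        cexp (I * ((l * (f (P j y) + ∑ i, η i * X i (P j y)) : ℝ) : ℂ))‖ ≤ C * |l| ^ (-s) := by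
    intro j
    obtain ⟨h1, h2, h3⟩ := hρ j
    exact hdecay j (fun y => ρ j y * χ (P j y))
      (contDiff_smul_of_tsupport h1 fun y hy => hχ.contDiffAt.comp y (h3 hy).2) h2.mul_right
      ((closure_mono (Function.support_mul_subset_left _ _)).trans (h3.trans Set.inter_subset_left))
  choose C hC using hχj
  refine ⟨∑ j ∈ S, C j, fun η hη l hl => ?_⟩
  set G : (Fin n → ℝ) → ℂ := fun y =>
    ((χ y * |D y| : ℝ) : ℂ) * cexp (I * ((l * (f y + ∑ i, η i * X i y) : ℝ) : ℂ)) with hG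
  have hGcont : Continuous G := by
    refine continuous_mul_of_tsupport (χ := χ) (v := fun y => ((|D y| : ℝ) : ℂ) *
      cexp (I * ((l * (f y + ∑ i, η i * X i y) : ℝ) : ℂ))) hχ.continuous (fun y hy => ?_) |>.congr
      fun y => by simp only [hG]; push_cast; ring
    obtain ⟨hfc, hDc, hXc⟩ := (hχV hy).2
    have hph : ContinuousAt (fun y => l * (f y + ∑ i, η i * X i y)) y :=
      continuousAt_const.mul (hfc.add (tendsto_finsetSum _ fun i _ =>
        continuousAt_const.mul (hXc i)))
    exact (continuous_ofReal.continuousAt.comp hDc.abs).mul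
      (Complex.continuous_exp.continuousAt.comp (continuousAt_const.mul
        (continuous_ofReal.continuousAt.comp hph)))
  have hsupp : Function.support G ⊆ Function.support χ := fun y hy h => hy (by simp [hG, h])
  have hGc : HasCompactSupport G := hχc.mono hsupp
  rw [hsum G hGcont hGc ((closure_mono hsupp).trans (hχV.trans Set.inter_subset_left)),
    Finset.sum_mul]
  refine (norm_sum_le _ _).trans (Finset.sum_le_sum fun j hj => ?_)
  refine le_trans (le_of_eq ?_) (hC j η (fun i => (hη i).trans (hεS j hj)) l hl)
  congr 1
  refine integral_congr_ae (Eventually.of_forall fun y => ?_)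
  simp only [hG, abs_mul]
  push_cast
  ring

end covers

theorem exists_cutoff {E : Type*} [NormedAddCommGroup E] [NormedSpace ℝ E] [FiniteDimensional ℝ E]
    {V : Set E} {x : E} (hV : V ∈ 𝓝 x) : ∃ r > 0, ∃ τ : E → ℝ, ContDiff ℝ 1 τ ∧
      HasCompactSupport τ ∧ tsupport τ ⊆ V ∧ (∀ y, 0 ≤ τ y) ∧ ∀ y ∈ Metric.ball x r, τ y = 1 := by
  obtain ⟨R, hR, hRV⟩ := Metric.nhds_basis_closedBall.mem_iff.1 hV
  let τ : ContDiffBump x := ⟨R / 2, R, by positivity, by linarith⟩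
  exact ⟨R / 2, by positivity, τ, τ.contDiff, τ.hasCompactSupport, by rwa [τ.tsupport_eq],
    fun y => τ.nonneg, fun y hy => τ.one_of_mem_closedBall (Metric.ball_subset_closedBall hy)⟩

/-- A partition of unity on the projective line, concentrated near the point at infinity and near
finitely many real numbers. -/
theorem exists_projective_partition {ε₀ : ℝ} (hε₀ : 0 < ε₀) {ε : ℝ → ℝ} (hε : ∀ c, 0 < ε c) :
    ∃ (S : Finset ℝ) (ω : ℝ → ℝ) (q : ℝ → ℝ → ℝ), ContDiff ℝ 1 ω ∧ (∀ c, ContDiff ℝ 1 (q c)) ∧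
      HasCompactSupport ω ∧ (∀ c, HasCompactSupport (q c)) ∧
      (∀ z, ω z ≠ 0 → |z - 0| < ε₀) ∧ (∀ c z, q c z ≠ 0 → |z - c| < ε c) ∧
      ∀ t, t ≠ 0 → ω t⁻¹ + ∑ c ∈ S, q c t = 1 := by
  obtain ⟨r, hr, ω, hω, hωc, hωs, -, hω1⟩ := exists_cutoff (Metric.ball_mem_nhds (0 : ℝ) hε₀)
  set θ : ℝ → ℝ := fun t => if t = 0 then 1 else 1 - ω t⁻¹ with hθ
  have hθs : ContDiff ℝ 1 θ := by
    rw [contDiff_iff_contDiffAt]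
    intro t
    by_cases ht : t = 0
    · subst ht
      refine (contDiffAt_const (c := (1 : ℝ))).congr_of_eventuallyEq ?_
      filter_upwards [Metric.ball_mem_nhds (0 : ℝ) (inv_pos.2 hε₀)] with t ht
      simp only [hθ]
      split_ifs with h
      · rfl
      · have : ω t⁻¹ = 0 := by
          by_contra h1
          have h2 := mem_ball_zero_iff.1 (hωs (subset_tsupport ω h1))
          rw [mem_ball_zero_iff, Real.norm_eq_abs] at ht
          rw [Real.norm_eq_abs, abs_inv] at h2
          exact absurd ((inv_lt_comm₀ (abs_pos.2 h) hε₀).1 h2) (not_lt.2 ht.le)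
        rw [this, sub_zero]
    · refine (contDiffAt_const.sub (hω.contDiffAt.comp t (contDiffAt_inv
        ℝ ht))).congr_of_eventuallyEq
        (f₁ := θ) (f := fun t => 1 - ω t⁻¹) ?_
      filter_upwards [isOpen_ne.mem_nhds ht] with z hz
      simp [hθ, show z ≠ 0 from hz]
  have hθK : ∀ t, θ t ≠ 0 → t ∈ Set.Icc (-r⁻¹) r⁻¹ := by
    intro t ht
    by_contra h
    rw [Set.mem_Icc, ← abs_le, not_le] at h
    have ht0 : t ≠ 0 := abs_pos.1 ((inv_pos.2 hr).trans h)
    refine ht ?_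
    simp only [hθ, if_neg ht0]
    rw [hω1, sub_self]
    rw [mem_ball_zero_iff, Real.norm_eq_abs, abs_inv]
    exact inv_lt_of_inv_lt₀ hr h
  have hθt : tsupport θ ⊆ Set.Icc (-r⁻¹) r⁻¹ := closure_minimal hθK isClosed_Icc
  choose a ha b hb hbc hbs hb0 hb1 using fun c =>
    exists_cutoff (Metric.ball_mem_nhds c (hε c))
  obtain ⟨S, -, hS⟩ := isCompact_Icc.elim_nhds_subcover (X := ℝ) (s := Set.Icc (-r⁻¹) r⁻¹)
    (fun c => Metric.ball c (a c)) (fun c _ => Metric.ball_mem_nhds c (ha c))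
  have hpos : ∀ t ∈ Set.Icc (-r⁻¹) r⁻¹, ∑ c ∈ S, b c t ≠ 0 := by
    intro t ht
    obtain ⟨c, hc, htc⟩ := Set.mem_iUnion₂.1 (hS ht)
    refine (Finset.sum_pos' (fun c _ => hb0 c t) ⟨c, hc, ?_⟩).ne'
    rw [hb1 c t htc]
    exact one_pos
  have hθc : HasCompactSupport θ := isCompact_Icc.of_isClosed_subset (isClosed_tsupport θ) hθt
  refine ⟨S, ω, fun c t => θ t * (b c t / ∑ c ∈ S, b c t), hω, fun c => ?_, hωc,
    fun c => hθc.mul_right, fun z hz => ?_, fun c z hz => ?_, fun t ht => ?_⟩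
  · exact contDiff_smul_of_tsupport hθs fun t ht => (hb c).contDiffAt.div
      (ContDiffAt.sum fun c _ => (hb c).contDiffAt) (hpos t (hθt ht))
  · exact hωs (subset_tsupport ω hz)
  · have : b c z ≠ 0 := fun h => hz (by simp [h])
    exact hbs c (subset_tsupport _ this)
  · rw [← Finset.mul_sum, ← Finset.sum_div]
    by_cases h : θ t = 0
    · rw [h, zero_mul]
      simp only [hθ, if_neg ht] at h
      linarith
    · rw [div_self (hpos t (hθK t h)), mul_one]
      simp [hθ, if_neg ht]

section jacobian
variable {n : ℕ}

theorem hasFDerivAt_update_coord (i : Fin n) {F : (Fin n → ℝ) → ℝ} {F' : (Fin n → ℝ) →L[ℝ] ℝ}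
    {y : Fin n → ℝ} (hF : HasFDerivAt F F' y) :
    ∃ L : (Fin n → ℝ) →L[ℝ] (Fin n → ℝ), HasFDerivAt (fun y => Function.update y i (F y)) L y ∧
      L.det = F' (Pi.single i 1) := by
  have h1 : (fun y => Function.update y i (F y)) =
      fun y => y + (F y - y i) • (Pi.single i (1 : ℝ) : Fin n → ℝ) := by
    ext y j
    rcases eq_or_ne j i with rfl | h
    · simp
    · simp [h]
  rw [h1]
  refine ⟨_, (hasFDerivAt_id y).add
    ((hF.sub (ContinuousLinearMap.proj (R := ℝ) (φ := fun _ : Fin n => ℝ) i).hasFDerivAt).smul_const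
      (Pi.single i (1 : ℝ) : Fin n → ℝ)), ?_⟩
  have h2 := LinearMap.transvection.det
    (F' - ContinuousLinearMap.proj (R := ℝ) (φ := fun _ : Fin n => ℝ) i :
      (Fin n → ℝ) →L[ℝ] ℝ).toLinearMap
    (Pi.single i (1 : ℝ) : Fin n → ℝ)
  refine Eq.trans (congrArg LinearMap.det ?_) (h2.trans ?_)
  · ext; simp [LinearMap.transvection]
  · simp

theorem hasFDerivAt_blowUp {i k : Fin n} (hik : i ≠ k) (c : ℝ) (y : Fin n → ℝ) :
    ∃ L : (Fin n → ℝ) →L[ℝ] (Fin n → ℝ), HasFDerivAt (blowUp i k c) L y ∧ L.det = y k := by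
  have hp : ∀ j, HasFDerivAt (fun y : Fin n → ℝ => y j)
    (ContinuousLinearMap.proj (R := ℝ) (φ := fun _ : Fin n => ℝ) j) y := fun j =>
    (ContinuousLinearMap.proj (R := ℝ) (φ := fun _ : Fin n => ℝ) j).hasFDerivAt
  obtain ⟨L, hL, hdet⟩ := hasFDerivAt_update_coord i ((hp k).mul ((hp i).const_add c))
  exact ⟨L, hL, by rw [hdet]; simp [hik.symm]⟩

theorem hasFDerivAt_powMap (k : Fin n) (p : ℕ) (σ : ℝ) (y : Fin n → ℝ) :
    ∃ L : (Fin n → ℝ) →L[ℝ] (Fin n → ℝ), HasFDerivAt (powMap k p σ) L y ∧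
      L.det = σ * ((2 * p : ℕ) * y k ^ (2 * p - 1)) := by
  have hp : HasFDerivAt (fun y : Fin n → ℝ => y k)
    (ContinuousLinearMap.proj (R := ℝ) (φ := fun _ : Fin n => ℝ) k) y :=
    (ContinuousLinearMap.proj (R := ℝ) (φ := fun _ : Fin n => ℝ) k).hasFDerivAt
  obtain ⟨L, hL, hdet⟩ := hasFDerivAt_update_coord k ((hp.pow (2 * p)).const_mul σ)
  exact ⟨L, hL, by rw [hdet]; simp⟩

theorem lintegral_comp_mul_le {P : (Fin n → ℝ) → (Fin n → ℝ)} {J : (Fin n → ℝ) → ℝ}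
    {s : Set (Fin n → ℝ)} (hs : MeasurableSet s) {c : ℝ} (hc : 0 ≤ c)
    (hP : ∀ y ∈ s, ∃ L : (Fin n → ℝ) →L[ℝ] (Fin n → ℝ), HasFDerivAt P L y ∧ |J y| ≤ c * |L.det|)
    (hinj : Set.InjOn P s) (g : (Fin n → ℝ) → ENNReal) :
    ∫⁻ y in s, g (P y) * ENNReal.ofReal |J y| ≤ ENNReal.ofReal c * ∫⁻ x, g x := by
  choose! L hL hJ using hP
  calc _ ≤ ∫⁻ y in s, ENNReal.ofReal c * (ENNReal.ofReal |(L y).det| * g (P y)) := by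
        refine setLIntegral_mono' hs fun y hy => ?_
        rw [mul_comm, ← mul_assoc, ← ENNReal.ofReal_mul hc]
        gcongr
        exact hJ y hy
    _ = ENNReal.ofReal c * ∫⁻ x in P '' s, g x := by
        rw [lintegral_const_mul' _ _ ENNReal.ofReal_ne_top,
          lintegral_image_eq_lintegral_abs_det_fderiv_mul volume hs
          (fun y hy => (hL y hy).hasFDerivWithinAt) hinj]
    _ ≤ _ := by gcongr; exact Measure.restrict_le_self

theorem measurableSet_coord (k : Fin n) {s : Set ℝ} (hs : MeasurableSet s) :
    MeasurableSet {y : Fin n → ℝ | y k ∈ s} :=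
  measurable_pi_apply k hs

theorem ae_univ_coord_ne_zero (k : Fin n) :
    ({y | y k ≠ 0} : Set (Fin n → ℝ)) =ᵐ[volume] Set.univ := by
  rw [eventuallyEq_univ]
  exact measure_eq_zero_iff_ae_notMem.1 (volume_coord_eq_zero k)

theorem injOn_blowUp {i k : Fin n} (hik : i ≠ k) (c : ℝ) :
    Set.InjOn (blowUp i k c) {y | y k ≠ 0} := by
  intro y hy z hz h
  have hj : ∀ j, j ≠ i → y j = z j := fun j hj => by
    simpa [blowUp, hj] using congrFun h j
  have hi : y k * (c + y i) = z k * (c + z i) := by simpa [blowUp] using congrFun h i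
  rw [← hj k hik.symm] at hi
  have := mul_left_cancel₀ (show y k ≠ 0 from hy) hi
  ext j
  rcases eq_or_ne j i with rfl | h
  · linarith
  · exact hj j h

theorem integral_blowUp {F : Type*} [NormedAddCommGroup F] [NormedSpace ℝ F] {i k : Fin n}
    (hik : i ≠ k) (c : ℝ) (g : (Fin n → ℝ) → F) :
    ∫ y, |y k| • g (blowUp i k c y) = ∫ x, g x := by
  have hs : MeasurableSet {y : Fin n → ℝ | y k ≠ 0} :=
    measurableSet_coord k (measurableSet_singleton (0 : ℝ)).compl
  choose L hL hdet using hasFDerivAt_blowUp hik c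
  have h1 := integral_image_eq_integral_abs_det_fderiv_smul volume hs
    (fun y _ => (hL y).hasFDerivWithinAt) (injOn_blowUp hik c) g
  have h2 : blowUp i k c '' {y | y k ≠ 0} = {y | y k ≠ 0} := by
    ext x
    constructor
    · rintro ⟨y, hy, rfl⟩
      simpa [blowUp, hik.symm] using hy
    · intro hx
      refine ⟨Function.update x i (x i / x k - c), by simpa [hik.symm] using hx, ?_⟩
      ext j
      rcases eq_or_ne j i with rfl | h
      · simp only [blowUp, Function.update_self, Function.update_of_ne hik.symm]
        have : x k ≠ 0 := hx
        field_simp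
        ring
      · simp [blowUp, h]
  rw [h2, setIntegral_congr_set (ae_univ_coord_ne_zero k),
    setIntegral_congr_set (ae_univ_coord_ne_zero k), setIntegral_univ, setIntegral_univ] at h1
  simp_rw [h1, hdet]

end jacobian

section blow
variable {n : ℕ}

theorem integral_blowUp_chart {i k : Fin n} (hik : i ≠ k) (c : ℝ) {w : ℝ → ℝ} {r : ℝ}
    (hw : ∀ z, w z ≠ 0 → |z - c| < r) {τ : (Fin n → ℝ) → ℝ}
    (hτ : ∀ y ∈ Metric.ball (0 : Fin n → ℝ) r, τ y = 1) {g : (Fin n → ℝ) → ℂ}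
    (hg : ∀ x, g x ≠ 0 → x ∈ Metric.ball (0 : Fin n → ℝ) r) :
    ∫ x, (w (x i / x k) : ℂ) * g x =
      ∫ y, ((w (c + y i) * τ y * |y k| : ℝ) : ℂ) * g (blowUp i k c y) := by
  rw [← integral_blowUp hik c]
  refine integral_congr_ae ?_
  filter_upwards [ae_coord_ne_zero (n := n)] with y hy
  have h1 : blowUp i k c y i / blowUp i k c y k = c + y i := by
    simp only [blowUp, Function.update_self, Function.update_of_ne hik.symm]
    field_simp [hy k]
  rw [h1]
  by_cases h2 : w (c + y i) = 0
  · simp [h2]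
  by_cases h3 : g (blowUp i k c y) = 0
  · simp [h3]
  have h4 := mem_ball_zero_iff.1 (hg _ h3)
  have hr : 0 < r := (norm_nonneg _).trans_lt h4
  have h5 : y ∈ Metric.ball (0 : Fin n → ℝ) r := by
    rw [mem_ball_zero_iff, pi_norm_lt_iff hr]
    intro j
    rcases eq_or_ne j i with rfl | h
    · simpa using hw _ h2
    · have := (pi_norm_lt_iff hr).1 h4 j
      simpa [blowUp, h] using this
  rw [hτ y h5, Complex.real_smul]
  push_cast
  ring

theorem lintegral_blowUp_le {i k : Fin n} (hik : i ≠ k) (c : ℝ) (g : (Fin n → ℝ) → ENNReal) :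
    ∫⁻ y, g (blowUp i k c y) * ENNReal.ofReal |y k| ≤ ENNReal.ofReal 1 * ∫⁻ x, g x := by
  have hs : MeasurableSet {y : Fin n → ℝ | y k ≠ 0} :=
    measurableSet_coord k (measurableSet_singleton (0 : ℝ)).compl
  have h1 := lintegral_comp_mul_le (J := fun y => y k) hs zero_le_one (fun y _ => by
    obtain ⟨L, hL, hdet⟩ := hasFDerivAt_blowUp hik c y
    exact ⟨L, hL, by rw [hdet, one_mul]⟩) (injOn_blowUp hik c) g
  rwa [setLIntegral_congr (ae_univ_coord_ne_zero k), setLIntegral_univ] at h1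

theorem contDiff_coord (i : Fin n) : ContDiff ℝ 1 (fun y : Fin n → ℝ => y i) :=
  contDiff_apply ℝ ℝ i

theorem covers_blowUp {i k : Fin n} (hik : i ≠ k) :
    Covers (fun o : Option ℝ => o.elim (blowUp k i 0) (blowUp i k))
      (fun o y => o.elim (y i) (fun _ => y k)) := by
  refine ⟨?_, ?_⟩
  · rintro (_ | c)
    · exact ⟨_, ENNReal.ofReal_ne_top, Set.univ, univ_mem, fun g => by
        rw [setLIntegral_univ]; exact lintegral_blowUp_le hik.symm 0 g⟩
    · exact ⟨_, ENNReal.ofReal_ne_top, Set.univ, univ_mem, fun g => by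
        rw [setLIntegral_univ]; exact lintegral_blowUp_le hik c g⟩
  intro V hV
  choose r hr τ hτ hτc hτV hτ0 hτ1 using fun o => exists_cutoff (hV o)
  obtain ⟨S, ω, q, hω, hq, hωc, hqc, hωs, hqs, hsum⟩ :=
    exists_projective_partition (hr none) (fun c => hr (some c))
  refine ⟨S.insertNone, fun o y => o.elim (ω (0 + y k) * τ none y)
    (fun c => q c (c + y i) * τ (some c) y), ?_, ?_⟩
  · rintro (_ | c)
    · exact ⟨(hω.comp (contDiff_const.add (contDiff_coord k))).mul (hτ _), (hτc _).mul_left,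
        (closure_mono (Function.support_mul_subset_right _ _)).trans (hτV none)⟩
    · exact ⟨((hq c).comp (contDiff_const.add (contDiff_coord i))).mul (hτ _), (hτc _).mul_left,
        (closure_mono (Function.support_mul_subset_right _ _)).trans (hτV (some c))⟩
  refine ⟨⋂ o ∈ S.insertNone, Metric.ball 0 (r o),
    (Finset.iInter_mem_sets _).2 fun o _ => Metric.ball_mem_nhds 0 (hr o), ?_⟩
  intro g hg hgc hgV
  have hgi : Integrable g := hg.integrable_of_hasCompactSupport hgc
  have hgs : ∀ o ∈ S.insertNone, ∀ x, g x ≠ 0 → x ∈ Metric.ball (0 : Fin n → ℝ) (r o) :=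
    fun o ho x hx => Set.mem_iInter₂.1 (hgV (subset_tsupport g hx)) o ho
  have hint : ∀ w : ℝ → ℝ, ContDiff ℝ 1 w → HasCompactSupport w → ∀ a b : Fin n,
      Integrable fun x : Fin n → ℝ => (w (x a / x b) : ℂ) * g x := by
    intro w hw hwc a b
    obtain ⟨C, hC⟩ := hw.continuous.bounded_above_of_compact_support hwc
    refine hgi.bdd_mul (c := C) ?_ (Eventually.of_forall fun x => by
      rw [Complex.norm_real]; exact hC _)
    exact (Complex.measurable_ofReal.comp (hw.continuous.measurable.comp
      ((measurable_pi_apply a).div (measurable_pi_apply b)))).aestronglyMeasurable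
  have hsplit : ∫ x, g x = ∫ x, ((ω (x k / x i) : ℂ) * g x +
      ∑ c ∈ S, (q c (x i / x k) : ℂ) * g x) := by
    refine integral_congr_ae ?_
    filter_upwards [ae_coord_ne_zero (n := n)] with x hx
    have h1 := hsum (x i / x k) (div_ne_zero (hx i) (hx k))
    rw [inv_div] at h1
    rw [← Finset.sum_mul, ← add_mul, ← ofReal_sum, ← ofReal_add, h1, ofReal_one, one_mul]
  rw [hsplit, integral_add (hint ω hω hωc k i) (integrable_finsetSum _ fun c _ =>
    hint _ (hq c) (hqc c) i k), integral_finsetSum _ fun c _ => hint _ (hq c) (hqc c) i k,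
    Finset.sum_insertNone]
  congr 1
  · exact integral_blowUp_chart hik.symm 0 hωs (hτ1 none)
      (hgs none (Finset.none_mem_insertNone))
  · exact Finset.sum_congr rfl fun c hc => integral_blowUp_chart hik c (hqs c) (hτ1 (some c))
      (hgs (some c) (Finset.some_mem_insertNone.2 hc))

end blow

section pow
variable {n : ℕ}

theorem injOn_powMap (k : Fin n) {p : ℕ} (hp : 0 < p) {σ : ℝ} (hσ : σ ≠ 0) {ε : ℝ} :
    Set.InjOn (powMap k p σ) {y | 0 < ε * y k} := by
  intro y hy z hz h
  have hj : ∀ j, j ≠ k → y j = z j := fun j hj => by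
    simpa [powMap, hj] using congrFun h j
  have hk : σ * y k ^ (2 * p) = σ * z k ^ (2 * p) := by simpa [powMap] using congrFun h k
  have hk2 : |y k| = |z k| := by
    have := mul_left_cancel₀ hσ hk
    rw [← (even_two_mul p).pow_abs, ← (even_two_mul p).pow_abs (z k)] at this
    exact (pow_left_inj₀ (abs_nonneg _) (abs_nonneg _) (by omega)).1 this
  ext j
  rcases eq_or_ne j k with rfl | h
  · rcases abs_eq_abs.1 hk2 with h1 | h1
    · exact h1
    · have hy : 0 < ε * y j := hy
      have hz : 0 < ε * z j := hz
      rw [h1] at hy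
      linarith
  · exact hj j h

theorem image_powMap (k : Fin n) {p : ℕ} (hp : 0 < p) {σ ε : ℝ} (hσ : σ ^ 2 = 1) (hε : ε ^ 2 = 1) :
    powMap k p σ '' {y | 0 < ε * y k} = {x | 0 < σ * x k} := by
  ext x
  constructor
  · rintro ⟨y, hy, rfl⟩
    have hy0 : y k ≠ 0 := right_ne_zero_of_mul (ne_of_gt hy)
    have := (even_two_mul p).pow_pos hy0
    simp only [powMap, Set.mem_ofPred_eq, Function.update_self, ← mul_assoc, ← sq, hσ, one_mul]
    exact this
  · intro hx
    have hx : 0 < σ * x k := hx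
    refine ⟨Function.update x k (ε * (σ * x k) ^ ((2 * p : ℕ) : ℝ)⁻¹), ?_, ?_⟩
    · simp only [Set.mem_ofPred_eq, Function.update_self, ← mul_assoc, ← sq, hε, one_mul]
      positivity
    · have h1 : ε ^ (2 * p) = 1 := by rw [pow_mul, hε, one_pow]
      simp only [powMap, Function.update_self, Function.update_idem, mul_pow, h1, one_mul]
      rw [Real.rpow_inv_natCast_pow hx.le (by omega), ← mul_assoc, ← sq, hσ, one_mul,
        Function.update_eq_self]

theorem setIntegral_powMap (k : Fin n) {p : ℕ} (hp : 0 < p) {σ ε : ℝ} (hσ : σ ^ 2 = 1)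
    (hε : ε ^ 2 = 1) (g : (Fin n → ℝ) → ℂ) :
    ∫ y in {y | 0 < ε * y k}, ((p * |y k ^ (2 * p - 1)| : ℝ) : ℂ) * g (powMap k p σ y) =
      (1 / 2) * ∫ x in {x | 0 < σ * x k}, g x := by
  have hs : MeasurableSet {y : Fin n → ℝ | 0 < ε * y k} :=
    measurableSet_lt measurable_const (measurable_const.mul (measurable_pi_apply k))
  have hσ0 : σ ≠ 0 := fun h => by simp [h] at hσ
  choose L hL hdet using hasFDerivAt_powMap (n := n) k p σ
  rw [← image_powMap k hp hσ hε, integral_image_eq_integral_abs_det_fderiv_smul volume hs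
    (fun y _ => (hL y).hasFDerivWithinAt) (injOn_powMap k hp hσ0), ← integral_const_mul]
  refine integral_congr_ae (Eventually.of_forall fun y => ?_)
  have hσ1 : |σ| = 1 := by rwa [← sq_eq_sq₀ (abs_nonneg _) zero_le_one, sq_abs, one_pow]
  simp only [hdet, Complex.real_smul, abs_mul, hσ1, one_mul, Nat.abs_cast]
  push_cast
  ring

theorem covers_powMap (k : Fin n) {p : ℕ} (hp : 0 < p) :
    Covers (fun b : Bool => powMap k p (if b then 1 else -1))
      (fun _ y => y k ^ (2 * p - 1)) := by
  have hσ : ∀ b : Bool, (if b then 1 else -1 : ℝ) ^ 2 = 1 := by rintro (_ | _) <;> norm_num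
  have hσ0 : ∀ b : Bool, (if b then 1 else -1 : ℝ) ≠ 0 := by rintro (_ | _) <;> norm_num
  have hσ1 : ∀ b : Bool, |(if b then 1 else -1 : ℝ)| = 1 := by rintro (_ | _) <;> norm_num
  have hms : ∀ ε : ℝ, MeasurableSet {y : Fin n → ℝ | 0 < ε * y k} := fun ε =>
    measurableSet_lt measurable_const (measurable_const.mul (measurable_pi_apply k))
  have hcompl : ({y : Fin n → ℝ | 0 < 1 * y k}ᶜ : Set _) =ᵐ[volume] {y | 0 < -1 * y k} := by
    rw [eventuallyEq_set]
    filter_upwards [ae_coord_ne_zero (n := n)] with y hy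
    simp only [Set.mem_compl_iff, Set.mem_ofPred_eq, one_mul, neg_one_mul, not_lt, neg_pos]
    exact ⟨fun h => lt_of_le_of_ne h (hy k), le_of_lt⟩
  have hhalves : ∀ g : (Fin n → ℝ) → ℂ, Integrable g → ∫ x, g x =
      (∫ x in {y | 0 < 1 * y k}, g x) + ∫ x in {y | 0 < -1 * y k}, g x := by
    intro g hg
    rw [← integral_add_compl (hms 1) hg, setIntegral_congr_set hcompl]
  refine ⟨fun b => ⟨2 * ENNReal.ofReal 1, by simp, Set.univ, univ_mem, fun g => ?_⟩, fun V hV => ?_⟩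
  · have h1 : ∀ ε : ℝ, ∫⁻ y in {y | 0 < ε * y k}, g (powMap k p (if b then 1 else -1) y) *
        ENNReal.ofReal |y k ^ (2 * p - 1)| ≤ ENNReal.ofReal 1 * ∫⁻ x, g x := fun ε =>
      lintegral_comp_mul_le (J := fun y => y k ^ (2 * p - 1)) (hms ε) zero_le_one (fun y _ => by
        obtain ⟨L, hL, hdet⟩ := hasFDerivAt_powMap k p (if b then 1 else -1) y
        refine ⟨L, hL, ?_⟩
        rw [hdet, abs_mul, hσ1, one_mul, one_mul, abs_mul, Nat.abs_cast]
        refine le_mul_of_one_le_left (abs_nonneg _) ?_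
        exact_mod_cast (by omega : 1 ≤ 2 * p)) (injOn_powMap k hp (hσ0 b)) g
    rw [setLIntegral_univ, ← lintegral_add_compl _ (hms 1), setLIntegral_congr hcompl, mul_assoc,
      two_mul (ENNReal.ofReal 1 * _)]
    exact add_le_add (h1 1) (h1 (-1))
  · obtain ⟨r, hr, τ, hτ, hτc, hτV, -, hτ1⟩ := exists_cutoff (inter_mem (hV true) (hV false))
    refine ⟨Finset.univ, fun _ y => p * τ y, fun b => ⟨contDiff_const.mul hτ, hτc.mul_left, ?_⟩,
      Metric.ball 0 (min r (r ^ (2 * p))), Metric.ball_mem_nhds 0 (by positivity), ?_⟩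
    · refine (closure_mono (Function.support_mul_subset_right _ _)).trans (hτV.trans ?_)
      cases b
      · exact Set.inter_subset_right
      · exact Set.inter_subset_left
    intro g hg hgc hgV
    have hgi : Integrable g := hg.integrable_of_hasCompactSupport hgc
    have hcut : ∀ b : Bool, ∀ y, ((p * τ y * |y k ^ (2 * p - 1)| : ℝ) : ℂ) *
        g (powMap k p (if b then 1 else -1) y) = ((p * |y k ^ (2 * p - 1)| : ℝ) : ℂ) *
        g (powMap k p (if b then 1 else -1) y) := by
      intro b y
      by_cases h : g (powMap k p (if b then 1 else -1) y) = 0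
      · simp [h]
      have h1 := mem_ball_zero_iff.1 (hgV (subset_tsupport g h))
      have h2 : y ∈ Metric.ball (0 : Fin n → ℝ) r := by
        rw [mem_ball_zero_iff, pi_norm_lt_iff hr]
        intro j
        have h3 := (norm_le_pi_norm _ j).trans_lt h1
        rcases eq_or_ne j k with rfl | hj
        · have h4 := h3.trans_le (min_le_right _ _)
          simp only [powMap, Function.update_self, Real.norm_eq_abs, abs_mul, hσ1, one_mul,
            abs_pow] at h4
          exact lt_of_pow_lt_pow_left₀ _ hr.le h4
        · have h4 := h3.trans_le (min_le_left _ _)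
          simpa [powMap, hj] using h4
      rw [hτ1 y h2, mul_one]
    have hpull : ∀ b : Bool, ∫ y, ((p * τ y * |y k ^ (2 * p - 1)| : ℝ) : ℂ) *
        g (powMap k p (if b then 1 else -1) y) =
        ∫ x in {x | 0 < (if b then 1 else -1 : ℝ) * x k}, g x := by
      intro b
      have hcp : Continuous (powMap k p (if b then 1 else -1)) := by
        unfold powMap; fun_prop
      have hc : Continuous fun y : Fin n → ℝ => ((p * τ y * |y k ^ (2 * p - 1)| : ℝ) : ℂ) *
          g (powMap k p (if b then 1 else -1) y) := by
        have := hτ.continuous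
        fun_prop
      have hcs : HasCompactSupport fun y : Fin n → ℝ => ((p * τ y * |y k ^ (2 * p - 1)| : ℝ) : ℂ) *
          g (powMap k p (if b then 1 else -1) y) :=
        hτc.mono fun y hy h => hy (by simp [h])
      rw [hhalves _ (hc.integrable_of_hasCompactSupport hcs)]
      simp_rw [hcut]
      rw [setIntegral_powMap k hp (hσ b) (by norm_num),
        setIntegral_powMap k hp (hσ b) (by norm_num)]
      ring
    simp_rw [hpull]
    rw [hhalves g hgi]
    simp

end pow

section diffeo
variable {n N : ℕ}

theorem analyticAt_det_fderiv {h : (Fin n → ℝ) → (Fin n → ℝ)} {x : Fin n → ℝ}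
    (hh : AnalyticAt ℝ h x) : AnalyticAt ℝ (fun y => (fderiv ℝ h y).det) x := by
  have h1 : (fun y => (fderiv ℝ h y).det) = fun y => ∑ σ : Equiv.Perm (Fin n),
      ((Equiv.Perm.sign σ : ℤ) : ℝ) * ∏ i, fderiv ℝ h y (Pi.single i 1) (σ i) := by
    ext y
    rw [ContinuousLinearMap.det, ← LinearMap.det_toMatrix', Matrix.det_apply']
    simp [LinearMap.toMatrix'_apply]
  rw [h1]
  refine Finset.analyticAt_fun_sum _ fun σ _ => analyticAt_const.mul
    (Finset.analyticAt_fun_prod _ fun i _ => ?_)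
  exact (ContinuousLinearMap.proj (R := ℝ) (φ := fun _ : Fin n => ℝ) (σ i)).analyticAt _ |>.comp
    ((ContinuousLinearMap.apply ℝ (Fin n → ℝ) (Pi.single i (1 : ℝ) : Fin n → ℝ)).analyticAt _
      |>.comp hh.fderiv)

theorem covers_diffeo {h k : (Fin n → ℝ) → (Fin n → ℝ)} (hh : AnalyticAt ℝ h 0)
    (hk : AnalyticAt ℝ k 0) (h0 : h 0 = 0) (k0 : k 0 = 0) (hkh : ∀ᶠ x in 𝓝 0, k (h x) = x)
    (hhk : ∀ᶠ x in 𝓝 0, h (k x) = x) : Covers (fun _ : Unit => h) (fun _ _ => 1) := by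
  set d : (Fin n → ℝ) → ℝ := fun y => (fderiv ℝ h y).det with hd
  have hda : AnalyticAt ℝ d 0 := analyticAt_det_fderiv hh
  have hd0 : d 0 ≠ 0 := by
    have h1 : HasFDerivAt (k ∘ h) ((fderiv ℝ k (h 0)).comp (fderiv ℝ h 0)) 0 :=
      HasFDerivAt.comp _ (by rw [h0]; exact hk.differentiableAt.hasFDerivAt)
        hh.differentiableAt.hasFDerivAt
    have h2 : HasFDerivAt (k ∘ h) (ContinuousLinearMap.id ℝ (Fin n → ℝ)) 0 :=
      (hasFDerivAt_id _).congr_of_eventuallyEq hkh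
    have h3 := congrArg (fun A : (Fin n → ℝ) →L[ℝ] (Fin n → ℝ) =>
      LinearMap.det (A : (Fin n → ℝ) →ₗ[ℝ] (Fin n → ℝ))) (h1.unique h2)
    simp only [ContinuousLinearMap.toLinearMap_comp, LinearMap.det_comp,
      ContinuousLinearMap.coe_id, LinearMap.det_id] at h3
    exact right_ne_zero_of_mul (h3.symm ▸ one_ne_zero)
  obtain ⟨W, hW, hWo, hW0⟩ := mem_nhds_iff.1 (hkh.and (hh.eventually_analyticAt.and
    (hda.eventually_analyticAt.and (hda.continuousAt.abs.eventually
      (lt_mem_nhds (half_lt_self (abs_pos.2 hd0)))))))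
  have hWnhds : W ∈ 𝓝 (0 : Fin n → ℝ) := hWo.mem_nhds hW0
  have hder : ∀ y ∈ W, HasFDerivAt h (fderiv ℝ h y) y := fun y hy =>
    (hW hy).2.1.differentiableAt.hasFDerivAt
  have hinj : Set.InjOn h W := fun y hy z hz hyz => by
    rw [← (hW hy).1, ← (hW hz).1, hyz]
  have hdpos : 0 < |d 0| := abs_pos.2 hd0
  refine ⟨fun _ => ⟨ENNReal.ofReal (2 / |d 0|), ENNReal.ofReal_ne_top, W, hWnhds, fun g =>
    lintegral_comp_mul_le (J := fun _ => 1) hWo.measurableSet (by positivity)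
      (fun y hy => ⟨_, hder y hy, ?_⟩) hinj g⟩, fun V hV => ?_⟩
  · have := (hW hy).2.2.2
    change |(1 : ℝ)| ≤ 2 / |d 0| * |d y|
    rw [abs_one, div_mul_eq_mul_div, le_div_iff₀ hdpos]
    linarith
  · obtain ⟨r, hr, τ, hτ, hτc, hτV, -, hτ1⟩ := exists_cutoff (inter_mem (hV ()) hWnhds)
    refine ⟨Finset.univ, fun _ y => τ y * |d y|, fun _ => ⟨?_, hτc.mul_right, ?_⟩, ?_⟩
    · refine contDiff_smul_of_tsupport hτ fun y hy => ?_
      obtain ⟨-, -, h1, h2⟩ := hW (hτV hy).2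
      exact h1.contDiffAt.abs (abs_pos.1 ((half_pos hdpos).trans h2))
    · exact (closure_mono (Function.support_mul_subset_left _ _)).trans
        (hτV.trans Set.inter_subset_left)
    refine ⟨{x | h (k x) = x ∧ k x ∈ W ∩ Metric.ball 0 r}, hhk.and
      (hk.continuousAt.preimage_mem_nhds (by
        rw [k0]; exact inter_mem hWnhds (Metric.ball_mem_nhds 0 hr))), fun g hg hgc hgV => ?_⟩
    have h1 : ∫ x, g x = ∫ x in h '' W, g x := by
      refine (setIntegral_eq_integral_of_forall_compl_eq_zero fun x hx => ?_).symm
      by_contra hgx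
      obtain ⟨h2, h3, -⟩ := hgV (subset_tsupport g hgx)
      exact hx ⟨k x, h3, h2⟩
    rw [h1, integral_image_eq_integral_abs_det_fderiv_smul volume hWo.measurableSet
      (fun y hy => (hder y hy).hasFDerivWithinAt) hinj, Finset.univ_unique, Finset.sum_singleton]
    refine Eq.trans ?_ (setIntegral_eq_integral_of_forall_compl_eq_zero (s := W) fun y hy => ?_)
    · refine setIntegral_congr_fun hWo.measurableSet fun y hy => ?_
      by_cases hgy : g (h y) = 0
      · simp [hgy]
      have h2 := (hgV (subset_tsupport g hgy)).2.2
      rw [(hW hy).1] at h2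
      simp [hτ1 y h2, hd]
    · have : τ y = 0 := by
        by_contra h2
        exact hy (hτV (subset_tsupport τ h2)).2
      simp [this]

/-- The decay property descends along a resolution. -/
theorem Resolution.localDecay {s : ℝ} {Q : ((Fin n → ℝ) → (Fin n → ℝ)) → ((Fin n → ℝ) → ℝ) → Prop}
    (hQ : Resolution Q) : ∀ {f D : (Fin n → ℝ) → ℝ} {X : Fin N → (Fin n → ℝ) → ℝ},
    AnalyticAt ℝ f 0 → (∀ i, AnalyticAt ℝ (X i) 0) → AnalyticAt ℝ D 0 →
    (∀ π D', Q π D' → LocalDecay s (f ∘ π) (fun i => X i ∘ π) (fun y => D (π y) * D' y)) →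
    LocalDecay s f X D := by
  induction hQ with
  | leaf Q h =>
    intro f D X _ _ _ H
    simpa using H id 1 h
  | diffeo Q h k hh hk h0 k0 hkh hhk _ ih =>
    intro f D X hf hX hD H
    refine LocalDecay.of_covers (covers_diffeo hh hk h0 k0 hkh hhk) (fun _ => hh) (fun _ => h0)
      hf hX hD fun _ => ?_
    refine ih (hf.comp_of_eq hh h0) (fun i => (hX i).comp_of_eq hh h0)
      ((hD.comp_of_eq hh h0).mul analyticAt_const) fun π D' hQ => ?_
    have h4 := H _ _ hQ
    simp only [mul_one]
    exact h4
  | pow Q k p hp _ _ ih₁ ih₂ =>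
    intro f D X hf hX hD H
    refine LocalDecay.of_covers (covers_powMap k hp) (fun _ => analyticAt_powMap ..)
      (fun _ => powMap_zero k hp _) hf hX hD fun b => ?_
    have key : ∀ σ : ℝ, AnalyticAt ℝ (f ∘ powMap k p σ) 0 ∧
        (∀ i, AnalyticAt ℝ (X i ∘ powMap k p σ) 0) ∧
        AnalyticAt ℝ (fun y => D (powMap k p σ y) * y k ^ (2 * p - 1)) 0 := fun σ =>
      ⟨hf.comp_of_eq (analyticAt_powMap ..) (powMap_zero k hp σ),
        fun i => (hX i).comp_of_eq (analyticAt_powMap ..) (powMap_zero k hp σ),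
        (hD.comp_of_eq (analyticAt_powMap ..) (powMap_zero k hp σ)).mul
          ((analyticAt_coord k 0).pow _)⟩
    cases b with
    | true =>
      obtain ⟨h1, h2, h3⟩ := key 1
      refine ih₁ h1 h2 h3 fun π D' hQ => ?_
      have h4 := H _ _ hQ
      simp only [← mul_assoc] at h4
      exact h4
    | false =>
      obtain ⟨h1, h2, h3⟩ := key (-1)
      refine ih₂ h1 h2 h3 fun π D' hQ => ?_
      have h4 := H _ _ hQ
      simp only [← mul_assoc] at h4
      exact h4
  | blow Q i k hik _ _ ih₁ ih₂ =>
    intro f D X hf hX hD H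
    have key : ∀ (i k : Fin n) (c : ℝ), AnalyticAt ℝ (f ∘ blowUp i k c) 0 ∧
        (∀ j, AnalyticAt ℝ (X j ∘ blowUp i k c) 0) ∧
        AnalyticAt ℝ (fun y => D (blowUp i k c y) * y k) 0 := fun i k c =>
      ⟨hf.comp_of_eq (analyticAt_blowUp ..) (blowUp_zero ..),
        fun j => (hX j).comp_of_eq (analyticAt_blowUp ..) (blowUp_zero ..),
        (hD.comp_of_eq (analyticAt_blowUp ..) (blowUp_zero ..)).mul (analyticAt_coord k 0)⟩
    refine LocalDecay.of_covers (covers_blowUp hik) ?_ ?_ hf hX hD ?_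
    · rintro (_ | c) <;> exact analyticAt_blowUp ..
    · rintro (_ | c) <;> exact blowUp_zero ..
    · rintro (_ | c)
      · obtain ⟨h1, h2, h3⟩ := key k i 0
        refine ih₁ h1 h2 h3 fun π D' hQ => ?_
        have h4 := H _ _ hQ
        simp only [← mul_assoc] at h4
        exact h4
      · obtain ⟨h1, h2, h3⟩ := key i k c
        refine ih₂ c h1 h2 h3 fun π D' hQ => ?_
        have h4 := H _ _ hQ
        simp only [← mul_assoc] at h4
        exact h4

theorem localDecay_of_analyticAt {f : (Fin n → ℝ) → ℝ} (hf : AnalyticAt ℝ f 0) (hf0 : f 0 = 0)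
    (hfz : ¬ f =ᶠ[𝓝 0] 0) {X : Fin N → (Fin n → ℝ) → ℝ} (hX : ∀ i, AnalyticAt ℝ (X i) 0) :
    LocalDecay (1 / (N + 1)) f X 1 := by
  have hN : (0 : ℝ) < N + 1 := by positivity
  refine (exists_chain hf hf0 hfz (List.ofFn X) (by simpa [List.mem_ofFn] using hX)).localDecay
    hf hX analyticAt_const ?_
  rintro π D ⟨hD, L, hL, hlen, hfL, hXL⟩
  simp only [Pi.one_apply, one_mul]
  refine localDecay_of_chain (by positivity) hL ?_ hfL (fun j => ?_) hD
  · rw [one_div_mul_eq_div, div_le_one hN]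
    rw [List.length_ofFn] at hlen
    exact_mod_cast hlen
  · obtain ⟨Y, hY, h⟩ := hXL (X j) (by simp [List.mem_ofFn])
    exact ⟨_, Y, hY, h⟩

end diffeo

section nonstationary
variable {E : Type*} [NormedAddCommGroup E] [NormedSpace ℝ E]

variable [FiniteDimensional ℝ E] [MeasurableSpace E] [BorelSpace E]

theorem integral_fderiv_eq_zero (μ : Measure E) [μ.IsAddHaarMeasure] {H : E → ℂ}
    (hH : ContDiff ℝ 1 H) (hc : HasCompactSupport H) (e : E) : ∫ x, fderiv ℝ H x e ∂μ = 0 := by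
  have hi : Integrable H μ := hH.continuous.integrable_of_hasCompactSupport hc
  have hi' : Integrable (fun x => fderiv ℝ H x e) μ :=
    ((hH.continuous_fderiv one_ne_zero).clm_apply continuous_const).integrable_of_hasCompactSupport
      (hc.fderiv_apply ℝ e)
  have h := integral_mul_fderiv_eq_neg_fderiv_mul_of_integrable (𝕜 := ℂ) (μ := μ)
    (f := fun _ : E => (1 : ℂ)) (g := H) (v := e) (by simp) (by simpa using hi') (by simpa using hi)
    (fun _ _ => differentiableAt_const _) (fun x _ => hH.differentiable one_ne_zero x)
  simpa using h

/-- Integration by parts in a direction `e` along which the linear part of the phase dominates. -/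
theorem exists_nonstationary_bound (μ : Measure E) [μ.IsAddHaarMeasure] {f φ : E → ℝ} (e : E)
    {δ : ℝ} (hδ : 0 < δ) (hφ : ContDiff ℝ 1 φ) (hφc : HasCompactSupport φ)
    (hf : ∀ x ∈ tsupport φ, AnalyticAt ℝ f x)
    (hfe : ∀ x ∈ tsupport φ, |fderiv ℝ f x e| ≤ δ / 2) :
    ∃ C, 0 ≤ C ∧ ∀ (ℓ : E →L[ℝ] ℝ) (l : ℝ), ℓ e ≠ 0 → δ * |l| ≤ |ℓ e| →
      ‖∫ x, (φ x : ℂ) * cexp (-I * ((l * f x + ℓ x : ℝ) : ℂ)) ∂μ‖ ≤ C / |ℓ e| := by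
  set q : E → ℝ := fun x => fderiv ℝ f x e with hq
  have hqa : ∀ x ∈ tsupport φ, AnalyticAt ℝ q x := fun x hx =>
    ((ContinuousLinearMap.apply ℝ ℝ e).analyticAt _).comp (hf x hx).fderiv
  have hφ' : Continuous fun x => fderiv ℝ φ x e :=
    (hφ.continuous_fderiv one_ne_zero).clm_apply continuous_const
  have hφi : Integrable (fun x => fderiv ℝ φ x e) μ :=
    hφ'.integrable_of_hasCompactSupport (hφc.fderiv_apply ℝ e)
  have hφq : Integrable (fun x => φ x * fderiv ℝ q x e) μ := by
    refine Continuous.integrable_of_hasCompactSupport ?_ hφc.mul_right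
    have := continuous_mul_of_tsupport (χ := φ) (v := fun x => ((fderiv ℝ q x e : ℝ) : ℂ))
      hφ.continuous fun x hx => continuous_ofReal.continuousAt.comp
        ((hqa x hx).fderiv.continuousAt.clm_apply continuousAt_const)
    refine (continuous_re.comp this).congr fun x => ?_
    simp
  set Bd : E → ℝ := fun x => 2 * |fderiv ℝ φ x e| + 4 / δ * |φ x * fderiv ℝ q x e| with hBd
  have hBdi : Integrable Bd μ := (hφi.abs.const_mul 2).add (hφq.abs.const_mul (4 / δ))
  refine ⟨∫ x, Bd x ∂μ, integral_nonneg fun x => by simp only [hBd, Pi.zero_apply]; positivity,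
    fun ℓ l ha hl => ?_⟩
  set a := ℓ e with haa
  have ha0 : 0 < |a| := abs_pos.2 ha
  set p : E → ℝ := fun x => l * f x + ℓ x with hp
  have hp' : ∀ x ∈ tsupport φ, HasFDerivAt p (l • fderiv ℝ f x + ℓ) x := fun x hx =>
    ((hf x hx).differentiableAt.hasFDerivAt.const_mul l).add ℓ.hasFDerivAt
  have hlow : ∀ x ∈ tsupport φ, |a| / 2 ≤ |l * q x + a| := by
    intro x hx
    have h1 : |l * q x| ≤ |a| / 2 := by
      rw [abs_mul]
      calc |l| * |q x| ≤ |l| * (δ / 2) := by gcongr; exact hfe x hx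
        _ ≤ |a| / 2 := by linarith
    have := abs_sub_abs_le_abs_sub a (-(l * q x))
    rw [abs_neg, sub_neg_eq_add, add_comm a] at this
    linarith
  have hne : ∀ x ∈ tsupport φ, l * q x + a ≠ 0 := fun x hx =>
    abs_pos.1 ((half_pos ha0).trans_le (hlow x hx))
  set ex : E → ℂ := fun x => cexp (-I * ((p x : ℝ) : ℂ)) with hex
  have hexn : ∀ x, ‖ex x‖ = 1 := fun x => by
    have : -I * ((p x : ℝ) : ℂ) = I * ((-p x : ℝ) : ℂ) := by push_cast; ring
    simp only [hex]
    rw [this, norm_exp_I_mul_ofReal]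
  have hexd : ∀ x ∈ tsupport φ, HasFDerivAt ex
      (ex x • (-I • (ofRealCLM.comp (l • fderiv ℝ f x + ℓ)))) x := fun x hx =>
    ((ofRealCLM.hasFDerivAt.comp x (hp' x hx)).const_mul (-I)).cexp
  have hexs : ∀ x ∈ tsupport φ, ContDiffAt ℝ 1 ex x := fun x hx =>
    (contDiffAt_const.mul (ofRealCLM.contDiff.contDiffAt.comp x
      ((contDiffAt_const.mul (hf x hx).contDiffAt).add ℓ.contDiff.contDiffAt))).cexp
  set w : E → ℝ := fun x => (l * q x + a)⁻¹ with hw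
  have hwd : ∀ x ∈ tsupport φ,
      HasFDerivAt w (-((l * q x + a) ^ 2)⁻¹ • (l • fderiv ℝ q x)) x := fun x hx =>
    (hasDerivAt_inv (hne x hx)).comp_hasFDerivAt x
      (((hqa x hx).differentiableAt.hasFDerivAt.const_mul l).add_const a)
  have hws : ∀ x ∈ tsupport φ, ContDiffAt ℝ 1 w x := fun x hx =>
    ((contDiffAt_const.mul (hqa x hx).contDiffAt).add contDiffAt_const).inv (hne x hx)
  set H : E → ℂ := fun x => φ x • (w x • ex x) with hH
  have hHs : ContDiff ℝ 1 H := contDiff_smul_of_tsupport hφ fun x hx => (hws x hx).smul (hexs x hx)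
  have hHc : HasCompactSupport H := hφc.smul_right
  set G : E → ℂ := fun x => (φ x : ℂ) * ex x with hG
  have hGi : Integrable G μ :=
    (continuous_mul_of_tsupport hφ.continuous fun x hx =>
      (hexs x hx).continuousAt).integrable_of_hasCompactSupport
      (hφc.mono fun x hx h => hx (by simp [h]))
  have hHi : Integrable (fun x => fderiv ℝ H x e) μ :=
    ((hHs.continuous_fderiv one_ne_zero).clm_apply
      continuous_const).integrable_of_hasCompactSupport (hHc.fderiv_apply ℝ e)
  have hpt : ∀ x, ‖fderiv ℝ H x e + I * G x‖ ≤ |a|⁻¹ * Bd x := by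
    intro x
    have hBd0 : 0 ≤ Bd x := by simp only [hBd]; positivity
    by_cases hx : x ∈ tsupport φ
    · have h1 : HasFDerivAt H _ x := (hφ.differentiable one_ne_zero x).hasFDerivAt.smul
        ((hwd x hx).smul (hexd x hx))
      have h2 : fderiv ℝ H x e + I * G x =
          ((φ x * (-((l * q x + a) ^ 2)⁻¹ * (l * fderiv ℝ q x e)) + fderiv ℝ φ x e * w x : ℝ) : ℂ) *
            ex x := by
        have h3 : (l * q x + a : ℂ) ≠ 0 := by exact_mod_cast hne x hx
        rw [h1.fderiv]
        simp [hG, hw, ← haa]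
        rw [show fderiv ℝ f x e = q x from rfl]
        field_simp
        ring
      have h3 := hlow x hx
      have h4 : |w x| ≤ 2 * |a|⁻¹ := by
        simp only [hw]
        rw [abs_inv, ← div_eq_mul_inv, ← inv_div]
        exact inv_anti₀ (by positivity) h3
      have h5 : |((l * q x + a) ^ 2)⁻¹ * l| ≤ 4 / δ * |a|⁻¹ := by
        have : ((l * q x + a) ^ 2)⁻¹ = |w x| ^ 2 := by simp [hw]
        rw [abs_mul, this, abs_pow, abs_abs]
        calc |w x| ^ 2 * |l| ≤ (2 * |a|⁻¹) ^ 2 * (|a| / δ) := by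
              gcongr
              rw [le_div_iff₀ hδ]
              linarith
          _ = _ := by field_simp; ring
      rw [h2, norm_mul, hexn, mul_one, Complex.norm_real, Real.norm_eq_abs]
      calc _ ≤ |φ x * (-((l * q x + a) ^ 2)⁻¹ * (l * fderiv ℝ q x e))| +
            |fderiv ℝ φ x e * w x| := abs_add_le _ _
        _ = |((l * q x + a) ^ 2)⁻¹ * l| * |φ x * fderiv ℝ q x e| + |w x| * |fderiv ℝ φ x e| := by
            simp only [abs_mul, abs_neg]
            ring
        _ ≤ 4 / δ * |a|⁻¹ * |φ x * fderiv ℝ q x e| + 2 * |a|⁻¹ * |fderiv ℝ φ x e| := by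
            gcongr
        _ = |a|⁻¹ * Bd x := by simp only [hBd]; ring
    · have h1 : H =ᶠ[𝓝 x] fun _ => 0 := by
        filter_upwards [(isClosed_tsupport φ).isOpen_compl.mem_nhds hx] with z hz
        simp only [hH]
        rw [image_eq_zero_of_notMem_tsupport hz, zero_smul]
      rw [h1.fderiv_eq]
      simp only [hG, image_eq_zero_of_notMem_tsupport hx]
      simpa using mul_nonneg (inv_nonneg.2 ha0.le) hBd0
  calc ‖∫ x, G x ∂μ‖ = ‖∫ x, (fderiv ℝ H x e + I * G x) ∂μ‖ := by
        rw [integral_add hHi (hGi.const_mul I), integral_fderiv_eq_zero μ hHs hHc, zero_add,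
          integral_const_mul, norm_mul, norm_I, one_mul]
    _ ≤ ∫ x, |a|⁻¹ * Bd x ∂μ :=
        norm_integral_le_of_norm_le (hBdi.const_mul _) (Eventually.of_forall hpt)
    _ = _ := by rw [integral_const_mul, div_eq_inv_mul]

end nonstationary

theorem isBigO_rpow_of_isLittleO_sub {v : ℝ → ℝ} {c g s : ℝ} {k : ℕ} (hs : s < g)
    (h : (fun ε => v ε - c * ε ^ g * Real.log (1 / ε) ^ k)
      =o[𝓝[>] 0] fun ε => ε ^ g * Real.log (1 / ε) ^ k) :
    v =O[𝓝[>] 0] fun ε => ε ^ s := by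
  have h1 : (fun ε : ℝ => ε ^ g * Real.log (1 / ε) ^ k) =O[𝓝[>] 0] fun ε => ε ^ s := by
    have h2 := (isLittleO_abs_log_rpow_rpow_nhdsGT_zero (s := s - g) k (by linarith)).isBigO
    refine IsBigO.of_norm_left
      (((isBigO_refl (fun ε : ℝ => ε ^ g) (𝓝[>] 0)).mul h2).norm_left.congr' ?_ ?_)
    · exact Eventually.of_forall fun ε => by simp [Real.rpow_natCast]
    · filter_upwards [self_mem_nhdsWithin] with ε hε
      rw [← Real.rpow_add hε, add_sub_cancel]
  refine ((h.isBigO.trans h1).add (h1.const_mul_left c)).congr_left fun ε => ?_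
  ring

theorem lintegral_abs_rpow_neg_ne_top {α : Type*} [MeasurableSpace α] {μ : Measure α}
    [IsFiniteMeasure μ] {f : α → ℝ} (hf : AEMeasurable f μ) {s s' : ℝ} (hs : 0 < s) (hs' : s < s')
    (h : (fun ε => μ.real {x | |f x| < ε}) =O[𝓝[>] 0] fun ε => ε ^ s') :
    ∫⁻ x, ENNReal.ofReal (|f x| ^ (-s)) ∂μ ≠ ⊤ := by
  obtain ⟨C, hC⟩ := h.bound
  obtain ⟨ε₀, hε₀, hsub⟩ := mem_nhdsGT_iff_exists_Ioo_subset.1 hC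
  replace hε₀ : 0 < ε₀ := hε₀
  set T : ℝ := ε₀ ^ (-s) with hT
  have hT0 : 0 < T := Real.rpow_pos_of_pos hε₀ _
  have htail : ∀ t ∈ Set.Ioi T,
      μ {x | t < |f x| ^ (-s)} ≤ ENNReal.ofReal (C * t ^ (-(s' / s))) := by
    intro t ht
    have ht0 : 0 < t := hT0.trans ht
    have hlt : t ^ (-s⁻¹) < ε₀ := by
      have := Real.rpow_lt_rpow_of_neg hT0 ht (neg_lt_zero.2 (inv_pos.2 hs))
      rwa [hT, ← Real.rpow_mul hε₀.le, neg_mul_neg, mul_inv_cancel₀ hs.ne', Real.rpow_one] at this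
    have h0 : 0 < t ^ (-s⁻¹) := Real.rpow_pos_of_pos ht0 _
    have h1 := hsub ⟨h0, hlt⟩
    simp only [Set.mem_ofPred_eq, Real.norm_eq_abs, abs_of_nonneg measureReal_nonneg] at h1
    rw [abs_of_nonneg (Real.rpow_nonneg h0.le _), ← Real.rpow_mul ht0.le,
      show -s⁻¹ * s' = -(s' / s) by ring] at h1
    calc μ {x | t < |f x| ^ (-s)} ≤ μ {x | |f x| < t ^ (-s⁻¹)} := by
          refine measure_mono fun x hx => ?_
          simp only [Set.mem_ofPred_eq] at hx ⊢
          have hfx : 0 < |f x| := by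
            refine (abs_nonneg _).lt_of_ne fun h => ?_
            rw [← h, Real.zero_rpow (by linarith)] at hx
            linarith
          have := Real.rpow_lt_rpow_of_neg ht0 hx (neg_lt_zero.2 (inv_pos.2 hs))
          rwa [← Real.rpow_mul hfx.le, neg_mul_neg, mul_inv_cancel₀ hs.ne', Real.rpow_one] at this
      _ = ENNReal.ofReal (μ.real {x | |f x| < t ^ (-s⁻¹)}) := (ofReal_measureReal).symm
      _ ≤ _ := ENNReal.ofReal_le_ofReal h1
  rw [lintegral_eq_lintegral_meas_lt μ (Eventually.of_forall fun x => Real.rpow_nonneg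
    (abs_nonneg _) _) ((hf.abs).pow_const _), ← Set.Ioc_union_Ioi_eq_Ioi hT0.le]
  refine ((lintegral_union_le _ _ _).trans_lt (ENNReal.add_lt_top.2 ⟨?_, ?_⟩)).ne
  · calc _ ≤ ∫⁻ _ in Set.Ioc 0 T, μ Set.univ :=
          lintegral_mono fun _ => measure_mono (Set.subset_univ _)
      _ < ⊤ := by
          rw [lintegral_const]
          exact ENNReal.mul_lt_top (measure_lt_top _ _) (by simp)
  · refine (setLIntegral_mono' measurableSet_Ioi htail).trans_lt ?_
    have : IntegrableOn (fun t : ℝ => C * t ^ (-(s' / s))) (Set.Ioi T) :=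
      (integrableOn_Ioi_rpow_of_lt (by rw [neg_lt_neg_iff, one_lt_div hs]; exact hs')
        hT0).const_mul C
    exact Integrable.lintegral_lt_top this

theorem not_eventuallyEq_zero_of_sublevel {E : Type*} [NormedAddCommGroup E] [MeasurableSpace E]
    [ProperSpace E] {μ : Measure E} [IsFiniteMeasureOnCompacts μ] [μ.IsOpenPosMeasure]
    {f : E → ℝ} {r₀ s : ℝ} (hr₀ : 0 < r₀) (hs : 0 < s)
    (h : ∀ r, 0 < r → r < r₀ →
      (fun ε => (μ {x | ‖x‖ < r ∧ |f x| < ε}).toReal) =O[𝓝[>] 0] fun ε => ε ^ s) :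
    ¬ f =ᶠ[𝓝 0] 0 := by
  intro hf
  obtain ⟨ρ, hρ, hb⟩ := Metric.eventually_nhds_iff_ball.1 hf
  set r := min ρ (r₀ / 2) with hr
  have hr0 : 0 < r := lt_min hρ (half_pos hr₀)
  have h1 := h r hr0 ((min_le_right _ _).trans_lt (half_lt_self hr₀))
  have h2 : (fun ε : ℝ => (μ {x | ‖x‖ < r ∧ |f x| < ε}).toReal) =ᶠ[𝓝[>] 0]
      fun _ => (μ (Metric.ball 0 r)).toReal := by
    filter_upwards [self_mem_nhdsWithin] with ε hε
    congr 2
    ext x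
    simp only [Set.mem_ofPred_eq, mem_ball_zero_iff, and_iff_left_iff_imp]
    intro hx
    rw [hb x (by simpa using hx.trans_le (min_le_left _ _))]
    simpa using hε
  have h3 : Tendsto (fun ε : ℝ => ε ^ s) (𝓝[>] 0) (𝓝 0) := by
    have := (Real.continuousAt_rpow_const 0 s (Or.inr hs.le)).tendsto
    rw [Real.zero_rpow hs.ne'] at this
    exact this.mono_left nhdsWithin_le_nhds
  have h4 := tendsto_nhds_unique ((h1.trans_tendsto h3).congr' h2) tendsto_const_nhds
  exact (ENNReal.toReal_pos (Metric.measure_ball_pos μ _ hr0).ne' measure_ball_lt_top.ne).ne h4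

section euclidean
variable {n : ℕ} {f : EuclideanSpace ℝ (Fin n) → ℝ}

theorem exists_stationary_bound (hf : AnalyticAt ℝ f 0) (hf0 : f 0 = 0) (hfz : ¬ f =ᶠ[𝓝 0] 0)
    {s : ℝ} (hs : s = 1 / (n + 1))
    (hint : ∃ W ∈ 𝓝 0, ∫⁻ x in W, ENNReal.ofReal (|f x| ^ (-s)) ≠ ⊤) :
    ∃ V ∈ 𝓝 (0 : EuclideanSpace ℝ (Fin n)), ∃ δ > 0, ∀ χ : EuclideanSpace ℝ (Fin n) → ℝ,
      ContDiff ℝ 1 χ → HasCompactSupport χ → tsupport χ ⊆ V →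
      ∃ C, ∀ η : Fin n → ℝ, (∀ i, |η i| < δ) → ∀ l : ℝ, 1 ≤ |l| →
        ‖∫ x, (χ x : ℂ) * cexp (I * ((l * (f x + ∑ i, η i * x i) : ℝ) : ℂ))‖ ≤ C * |l| ^ (-s) := by
  set L := (PiLp.continuousLinearEquiv 2 ℝ (fun _ : Fin n => ℝ)).symm with hL
  have hLm : MeasurePreserving L volume volume := PiLp.volume_preserving_toLp (Fin n)
  have hLe : MeasurableEmbedding L := L.toHomeomorph.measurableEmbedding
  have hL0 : L 0 = 0 := map_zero L
  have hLt : Tendsto L (𝓝 0) (𝓝 0) := by simpa [hL0] using L.continuous.tendsto 0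
  have hLt' : Tendsto L.symm (𝓝 0) (𝓝 0) := by simpa using L.symm.continuous.tendsto 0
  obtain ⟨W, hW, hWi⟩ := hint
  obtain ⟨V, hV, δ, hδ, H⟩ := localDecay_of_analyticAt (f := f ∘ L) (n := n) (N := n)
    (X := fun i y => y i) (AnalyticAt.comp (by rwa [hL0]) (L.analyticAt _)) (by simp [hL0, hf0])
    (fun h => hfz ((hLt'.eventually h).mono fun x hx => by simpa using hx))
    (fun i => (ContinuousLinearMap.proj (R := ℝ) (φ := fun _ : Fin n => ℝ) i).analyticAt _)
    ⟨L ⁻¹' W, hLt hW, by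
      rw [← hs]
      simpa using (hLm.setLIntegral_comp_preimage_emb hLe
        (fun x => ENNReal.ofReal (|f x| ^ (-s))) W).trans_ne hWi⟩
  refine ⟨L.symm ⁻¹' V, hLt' hV, δ, hδ, fun χ hχ hχc hχV => ?_⟩
  have hts : tsupport (χ ∘ L) ⊆ L ⁻¹' tsupport χ :=
    closure_minimal (fun y hy => subset_tsupport _ hy) ((isClosed_tsupport χ).preimage L.continuous)
  obtain ⟨C, hC⟩ := H (χ ∘ L) (hχ.comp L.contDiff)
    (hχc.comp_homeomorph L.toHomeomorph)
    (fun y hy => by simpa using hχV (hts hy))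
  refine ⟨C, fun η hη l hl => ?_⟩
  have := hC η hη l hl
  rw [← hs] at this
  rw [← hLm.integral_comp hLe]
  have hLi : ∀ y i, (L y) i = y i := fun _ _ => rfl
  simpa [hLi] using this

theorem norm_le_sum_abs {ι : Type*} [Fintype ι] (x : EuclideanSpace ℝ ι) : ‖x‖ ≤ ∑ i, |x i| := by
  rw [EuclideanSpace.norm_eq, Real.sqrt_le_left (by positivity)]
  exact Finset.sum_sq_le_sq_sum_of_nonneg fun _ _ => abs_nonneg _

theorem rpow_neg_le_of_le_mul {a b K s : ℝ} (ha : 0 < a) (hb : 0 < b) (hK : 0 ≤ K) (hs : 0 ≤ s)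
    (h : a ≤ K * b) : b ^ (-s) ≤ K ^ s * a ^ (-s) := by
  rw [Real.rpow_neg hb.le, Real.rpow_neg ha.le, ← div_eq_mul_inv, le_div_iff₀ (by positivity),
    inv_mul_le_iff₀ (by positivity), mul_comm, ← Real.mul_rpow hK hb.le]
  exact Real.rpow_le_rpow ha.le h hs

theorem exists_nhds_decay {U : Set (EuclideanSpace ℝ (Fin n))} (hn : 1 ≤ n) (hU : U ∈ 𝓝 0)
    (hfa : AnalyticOnNhd ℝ f U) (hf0 : f 0 = 0) (hdf : fderiv ℝ f 0 = 0) (hfz : ¬ f =ᶠ[𝓝 0] 0)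
    {s : ℝ} (hs : s = 1 / (n + 1))
    (hint : ∃ W ∈ 𝓝 0, ∫⁻ x in W, ENNReal.ofReal (|f x| ^ (-s)) ≠ ⊤) :
    ∃ V ∈ 𝓝 0, V ⊆ U ∧ ∀ φ : EuclideanSpace ℝ (Fin n) → ℝ, ContDiff ℝ 1 φ →
      HasCompactSupport φ → tsupport φ ⊆ V →
      ∃ C : ℝ, 0 < C ∧ ∀ ξ : EuclideanSpace ℝ (Fin (n + 1)), 1 ≤ ‖ξ‖ →
        ‖∫ x, (φ x : ℂ) *
          cexp (-I * ((ξ (Fin.last n) * f x + ∑ i : Fin n, ξ i.castSucc * x i : ℝ) : ℂ))‖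
          ≤ C * ‖ξ‖ ^ (-s) := by
  have hs0 : 0 ≤ s := by rw [hs]; positivity
  have hs1 : s ≤ 1 := by
    rw [hs, div_le_one (by positivity)]
    linarith [n.cast_nonneg (α := ℝ)]
  have h0 := hfa 0 (mem_of_mem_nhds hU)
  obtain ⟨V, hV, δ, hδ, H⟩ := exists_stationary_bound h0 hf0 hfz hs hint
  have hfd (i : Fin n) : ∀ᶠ x in 𝓝 0, |fderiv ℝ f x (EuclideanSpace.single i 1)| < δ / 2 := by
    have h1 : ContinuousAt (fun x => |fderiv ℝ f x (EuclideanSpace.single i 1)|) 0 :=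
      (h0.fderiv.continuousAt.clm_apply continuousAt_const).abs
    exact h1.eventually_lt continuousAt_const (by simpa [hdf] using hδ)
  refine ⟨V ∩ U ∩ {x | ∀ i : Fin n, |fderiv ℝ f x (EuclideanSpace.single i 1)| < δ / 2},
    inter_mem (inter_mem hV hU) (eventually_all.2 hfd), fun x hx => hx.1.2,
    fun φ hφ hφc hφN => ?_⟩
  obtain ⟨C₀, hC₀⟩ := H φ hφ hφc fun x hx => (hφN hx).1.1
  choose C₁ hC₁0 hC₁ using fun i : Fin n => exists_nonstationary_bound volume
    (EuclideanSpace.single i (1 : ℝ)) hδ hφ hφc (fun x hx => hfa x (hφN hx).1.2)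
    (fun x hx => ((hφN hx).2 i).le)
  set M := ∫ x, ‖φ x‖ with hM
  have hM0 : 0 ≤ M := integral_nonneg fun _ => norm_nonneg _
  set K := 1 + n * δ with hK
  set K' := 1 / δ + n with hK'
  have hK0 : 0 ≤ K := by positivity
  have hK'0 : 0 ≤ K' := by positivity
  have hKs : 0 ≤ K ^ s := Real.rpow_nonneg hK0 _
  have hS : 0 ≤ ∑ i, C₁ i := Finset.sum_nonneg fun i _ => hC₁0 i
  refine ⟨|C₀| * K ^ s + M * K ^ s + (∑ i, C₁ i) * K' + 1, by positivity, fun ξ hξ => ?_⟩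
  have hξ0 : 0 < ‖ξ‖ := one_pos.trans_le hξ
  have hξs : 0 < ‖ξ‖ ^ (-s) := Real.rpow_pos_of_pos hξ0 _
  set l := ξ (Fin.last n) with hl
  have : Nonempty (Fin n) := ⟨⟨0, hn⟩⟩
  obtain ⟨i₀, hi₀⟩ := Finite.exists_max fun i : Fin n => |ξ i.castSucc|
  have hnorm : ‖ξ‖ ≤ |l| + n * |ξ i₀.castSucc| := by
    refine (norm_le_sum_abs ξ).trans ?_
    rw [Fin.sum_univ_castSucc, add_comm]
    gcongr
    simpa using Finset.sum_le_card_nsmul Finset.univ _ _ fun i _ => hi₀ i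
  rcases lt_or_ge |ξ i₀.castSucc| (δ * |l|) with hlt | hge
  · have hl0 : 0 < |l| := by
      by_contra h
      have : |l| = 0 := le_antisymm (not_lt.1 h) (abs_nonneg _)
      rw [this, mul_zero] at hlt
      exact absurd hlt (abs_nonneg _).not_gt
    have hnorm' : ‖ξ‖ ≤ K * |l| := by
      have : (n : ℝ) * |ξ i₀.castSucc| ≤ n * (δ * |l|) := by gcongr
      rw [hK]
      linarith
    rcases le_or_gt 1 |l| with hl1 | hl1
    · have h1 := hC₀ (fun i => ξ i.castSucc / l) (fun i => by
        rw [abs_div, div_lt_iff₀ hl0]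
        exact (hi₀ i).trans_lt hlt) (-l) (by rwa [abs_neg])
      have h2 : ∀ x : EuclideanSpace ℝ (Fin n),
          -I * ((l * f x + ∑ i : Fin n, ξ i.castSucc * x i : ℝ) : ℂ) =
            I * ((-l * (f x + ∑ i : Fin n, ξ i.castSucc / l * x i) : ℝ) : ℂ) := fun x => by
        have h3 : ∀ i : Fin n, l * (ξ i.castSucc / l * x i) = ξ i.castSucc * x i := fun i => by
          rw [← mul_assoc, mul_div_cancel₀ _ (abs_pos.1 hl0)]
        simp only [mul_add, Finset.mul_sum, neg_mul, h3, Finset.sum_neg_distrib, ← neg_add,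
          ofReal_neg, mul_neg]
      simp only [h2]
      refine h1.trans ?_
      rw [abs_neg]
      calc C₀ * |l| ^ (-s) ≤ |C₀| * (K ^ s * ‖ξ‖ ^ (-s)) :=
            mul_le_mul (le_abs_self _) (rpow_neg_le_of_le_mul hξ0 hl0 hK0 hs0 hnorm')
              (Real.rpow_nonneg (abs_nonneg _) _) (abs_nonneg _)
        _ = |C₀| * K ^ s * ‖ξ‖ ^ (-s) := by ring
        _ ≤ _ := by
          gcongr
          have : 0 ≤ M * K ^ s + (∑ i, C₁ i) * K' + 1 := by positivity
          linarith
    · have h1 : (1 : ℝ) ≤ K ^ s * ‖ξ‖ ^ (-s) := by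
        have := rpow_neg_le_of_le_mul (b := 1) hξ0 one_pos hK0 hs0
          (hnorm'.trans (by gcongr))
        rwa [Real.one_rpow] at this
      calc _ ≤ M := by
            refine (norm_integral_le_integral_norm _).trans_eq (integral_congr_ae
              (Eventually.of_forall fun x => ?_))
            simp only
            rw [norm_mul, neg_mul, ← mul_neg, ← ofReal_neg, norm_exp_I_mul_ofReal, mul_one,
              Complex.norm_real]
        _ ≤ M * (K ^ s * ‖ξ‖ ^ (-s)) := le_mul_of_one_le_right hM0 h1
        _ = M * K ^ s * ‖ξ‖ ^ (-s) := by ring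
        _ ≤ _ := by
          gcongr
          have : 0 ≤ |C₀| * K ^ s + (∑ i, C₁ i) * K' + 1 := by positivity
          linarith
  · have hnorm' : ‖ξ‖ ≤ K' * |ξ i₀.castSucc| := by
      have : |l| ≤ 1 / δ * |ξ i₀.castSucc| := by
        rwa [one_div, ← div_eq_inv_mul, le_div_iff₀ hδ, mul_comm]
      rw [hK', add_mul]
      linarith
    have ha0 : 0 < |ξ i₀.castSucc| := by
      by_contra h
      rw [le_antisymm (not_lt.1 h) (abs_nonneg _), mul_zero] at hnorm'
      linarith
    set ℓ : EuclideanSpace ℝ (Fin n) →L[ℝ] ℝ :=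
      ∑ i : Fin n, ξ i.castSucc • EuclideanSpace.proj i with hℓ
    have hℓx : ∀ x, ℓ x = ∑ i : Fin n, ξ i.castSucc * x i := fun x => by
      simp [hℓ]
    have hℓe : ℓ (EuclideanSpace.single i₀ 1) = ξ i₀.castSucc := by
      simp [hℓx]
    have h1 := hC₁ i₀ ℓ l (by rw [hℓe]; exact abs_pos.1 ha0) (by rwa [hℓe])
    rw [hℓe] at h1
    simp only [hℓx] at h1
    refine h1.trans ?_
    calc C₁ i₀ / |ξ i₀.castSucc| ≤ C₁ i₀ * (K' * ‖ξ‖⁻¹) := by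
          rw [div_eq_mul_inv]
          refine mul_le_mul_of_nonneg_left ?_ (hC₁0 _)
          rw [← div_eq_mul_inv, le_div_iff₀ hξ0, inv_mul_le_iff₀ ha0, mul_comm]
          exact hnorm'
      _ ≤ (∑ i, C₁ i) * (K' * ‖ξ‖ ^ (-s)) := by
          gcongr
          · exact Finset.single_le_sum (fun i _ => hC₁0 i) (Finset.mem_univ _)
          · rw [← Real.rpow_neg_one]
            exact Real.rpow_le_rpow_of_exponent_le hξ (by linarith)
      _ = (∑ i, C₁ i) * K' * ‖ξ‖ ^ (-s) := by ring
      _ ≤ _ := by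
          gcongr
          have : 0 ≤ |C₀| * K ^ s + M * K ^ s + 1 := by positivity
          linarith

end euclidean

end OscillatoryDecay

/-- Fourier transform decay of a hypersurface measure; case `g > 1/(n+1)`. -/
theorem stmt2
    (n : ℕ) (hn : 1 ≤ n)
    (f : EuclideanSpace ℝ (Fin n) → ℝ)
    (U : Set (EuclideanSpace ℝ (Fin n))) (hU : U ∈ 𝓝 (0 : EuclideanSpace ℝ (Fin n)))
    (hfa : AnalyticOnNhd ℝ f U) (hf0 : f 0 = 0) (hdf : fderiv ℝ f 0 = 0)
    (g : ℝ) (hg : 1 / (n + 1) < g)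
    (k : ℕ) (hk : k ≤ n - 1)
    (r₀ : ℝ) (hr₀ : 0 < r₀)
    (hasymp : ∀ r : ℝ, 0 < r → r < r₀ → ∃ c : ℝ, 0 < c ∧
      (fun ε : ℝ =>
          (volume {x : EuclideanSpace ℝ (Fin n) | ‖x‖ < r ∧ |f x| < ε}).toReal
            - c * ε ^ g * (Real.log (1 / ε)) ^ k)
        =o[𝓝[>] (0 : ℝ)] fun ε : ℝ => ε ^ g * (Real.log (1 / ε)) ^ k) :
    ∃ N : Set (EuclideanSpace ℝ (Fin n)), N ∈ 𝓝 (0 : EuclideanSpace ℝ (Fin n)) ∧ N ⊆ U ∧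
      ∀ φ : EuclideanSpace ℝ (Fin n) → ℝ,
        ContDiff ℝ (⊤ : ℕ∞) φ → HasCompactSupport φ → tsupport φ ⊆ N →
        ∃ C : ℝ, 0 < C ∧
          ∀ ξ : EuclideanSpace ℝ (Fin (n + 1)), 2 < ‖ξ‖ →
            ‖∫ x : EuclideanSpace ℝ (Fin n),
                (φ x : ℂ) * Complex.exp (-(Complex.I) *
                  ((ξ (Fin.last n) * f x + ∑ i : Fin n, ξ i.castSucc * x i : ℝ) : ℂ))‖
              ≤ C * ‖ξ‖ ^ (-(1 / (n + 1) : ℝ)) := by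
  set s : ℝ := 1 / (n + 1) with hs
  have hs0 : 0 < s := by positivity
  obtain ⟨s', hs', hg'⟩ := exists_between hg
  have hv : ∀ r, 0 < r → r < r₀ →
      (fun ε => (volume {x | ‖x‖ < r ∧ |f x| < ε}).toReal) =O[𝓝[>] 0] fun ε => ε ^ s' :=
    fun r hr hr' =>
      let ⟨_, _, h⟩ := hasymp r hr hr'
      OscillatoryDecay.isBigO_rpow_of_isLittleO_sub hg' h
  have hfz := OscillatoryDecay.not_eventuallyEq_zero_of_sublevel hr₀ (hs0.trans hs') hv
  obtain ⟨ρ, hρ, hb⟩ := Metric.mem_nhds_iff.1 hU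
  set r := min ρ (r₀ / 2)
  have hr : 0 < r := lt_min hρ (half_pos hr₀)
  have hrU : Metric.ball 0 r ⊆ U := (Metric.ball_subset_ball (min_le_left _ _)).trans hb
  have : IsFiniteMeasure (volume.restrict (Metric.ball (0 : EuclideanSpace ℝ (Fin n)) r)) :=
    isFiniteMeasure_restrict.2 measure_ball_lt_top.ne
  have hint := OscillatoryDecay.lintegral_abs_rpow_neg_ne_top
    (μ := volume.restrict (Metric.ball (0 : EuclideanSpace ℝ (Fin n)) r))
    ((hfa.continuousOn.mono hrU).aemeasurable measurableSet_ball) hs0 hs'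
    ((hv r hr ((min_le_right _ _).trans_lt (half_lt_self hr₀))).congr_left fun ε => by
      rw [measureReal_def, Measure.restrict_apply' measurableSet_ball]
      congr 2
      ext x
      simp [and_comm])
  obtain ⟨N, hN, hNU, H⟩ := OscillatoryDecay.exists_nhds_decay hn hU hfa hf0 hdf hfz hs
    ⟨_, Metric.ball_mem_nhds 0 hr, hint⟩
  refine ⟨N, hN, hNU, fun φ hφ hφc hφN => ?_⟩
  obtain ⟨C, hC, h⟩ := H φ (hφ.of_le (by exact_mod_cast le_top)) hφc hφN
  exact ⟨C, hC, fun ξ hξ => h ξ (by linarith)⟩
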